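/- arXiv:1202.3082 — 3 statements merged into one kernel-verified Lean document; each statement's English description precedes it below -/
import Mathlib

section
/- Let G be a finite connected simple graph with at least two vertices, let s be the number of vertices of G of degree 3, and let t be the number of vertices of G of degree at least 4. If G is not isomorphic to C_6^2, not isomorphic to C_8^2, and not isomorphic to G_8, then G has a spanning tree with at least (2/5)·t + (1/5)·s + 2 leaves. -/
open scoped Classical

/-- The number of leaves (vertices of degree 1) of a graph `T` (intended: a tree). -/
noncomputable def leafCount {V : Type*} [Fintype V] (T : SimpleGraph V) : ℕ :=
  Fintype.card {v : V // T.degree v = 1}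

/-- `C_k²`, the square of the `k`-cycle: vertices `ZMod k`, with `i ~ j` iff
`i - j ≡ ±1` or `±2 (mod k)`. -/
def cycleSq (k : ℕ) : SimpleGraph (ZMod k) :=
  SimpleGraph.fromRel (fun i j => i - j = 1 ∨ i - j = 2)

/-- The graph `G₈` on 8 vertices `a₁ a₂ b₁ b₂ b₃ r₁ r₂ r₃`
(encoded as `0 1 2 3 4 5 6 7`) with edges `a₁a₂`; `aᵢrⱼ` for all `i, j`;
`bᵢbⱼ` for all `i ≠ j`; and `bᵢrⱼ` for all `i ≠ j`. -/
def G8 : SimpleGraph (Fin 8) :=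
  SimpleGraph.fromRel (fun u v =>
    (u, v) ∈ [((0 : Fin 8), (1 : Fin 8)), (0, 5), (0, 6), (0, 7), (1, 5), (1, 6), (1, 7),
      (2, 3), (2, 4), (3, 4), (2, 6), (2, 7), (3, 5), (3, 7), (4, 5), (4, 6)])

namespace LeafyTree

variable {V : Type*} [Fintype V] {G : SimpleGraph V}

/-- The closed neighbourhood of a finite set of vertices. -/
noncomputable def clos (G : SimpleGraph V) (D : Finset V) : Finset V :=
  Finset.univ.filter fun v => v ∈ D ∨ ∃ u ∈ D, G.Adj u v

/-- The vertices outside `D` which have a neighbour in `D`. -/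
noncomputable def bdry (G : SimpleGraph V) (D : Finset V) : Finset V :=
  clos G D \ D

/-- The neighbours of `x` outside the closed neighbourhood of `D`. -/
noncomputable def outn (G : SimpleGraph V) (D : Finset V) (x : V) : Finset V :=
  Finset.univ.filter fun r => G.Adj x r ∧ r ∉ clos G D

/-- The boundary vertices without neighbours outside the closed neighbourhood of `D`. -/
noncomputable def dead (G : SimpleGraph V) (D : Finset V) : Finset V :=
  (bdry G D).filter fun y => outn G D y = ∅

/-- The weight of a vertex: 2 for degree at least 4, 1 for degree 3, and 0 otherwise. -/
noncomputable def wt (G : SimpleGraph V) (v : V) : ℤ :=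
  if 4 ≤ G.degree v then 2 else if G.degree v = 3 then 1 else 0

/-- The potential of a set of internal vertices. -/
noncomputable def pot (G : SimpleGraph V) (D : Finset V) : ℤ :=
  4 * (bdry G D).card + (dead G D).card - ∑ v ∈ clos G D, wt G v

/-- Nonempty vertex sets built from a single vertex by adding neighbours one at a time. -/
inductive Grow (G : SimpleGraph V) : Finset V → Prop
  | single (v : V) : Grow G {v}
  | add {D : Finset V} {p : V} (hD : Grow G D) (hp : p ∈ bdry G D) : Grow G (insert p D)

lemma mem_clos {D : Finset V} {v : V} : v ∈ clos G D ↔ v ∈ D ∨ ∃ u ∈ D, G.Adj u v := by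
  simp [clos]

lemma mem_bdry {D : Finset V} {v : V} : v ∈ bdry G D ↔ v ∉ D ∧ ∃ u ∈ D, G.Adj u v := by
  simp only [bdry, Finset.mem_sdiff, mem_clos]; tauto

lemma mem_outn {D : Finset V} {x r : V} : r ∈ outn G D x ↔ G.Adj x r ∧ r ∉ clos G D := by
  simp [outn]

lemma bdry_sub {D : Finset V} {v : V} (h : v ∈ bdry G D) : v ∈ clos G D :=
  (Finset.mem_sdiff.1 h).1

lemma mem_clos_insert {D : Finset V} {p v : V} (hp : p ∈ bdry G D) :
    v ∈ clos G (insert p D) ↔ v ∈ clos G D ∨ G.Adj p v := by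
  have := bdry_sub hp
  simp only [mem_clos, Finset.mem_insert] at *
  grind

lemma mem_outn_insert {D : Finset V} {p x r : V} (hp : p ∈ bdry G D) :
    r ∈ outn G (insert p D) x ↔ G.Adj x r ∧ r ∉ clos G D ∧ ¬ G.Adj p r := by
  rw [mem_outn, mem_clos_insert hp]; tauto

lemma clos_insert {D : Finset V} {p : V} (hp : p ∈ bdry G D) :
    clos G (insert p D) = clos G D ∪ outn G D p := by
  ext v
  rw [mem_clos_insert hp, Finset.mem_union, mem_outn]; tauto

lemma bdry_insert {D : Finset V} {p : V} (hp : p ∈ bdry G D) :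
    bdry G (insert p D) = (bdry G D).erase p ∪ outn G D p := by
  ext v
  have h1 := G.irrefl (v := p)
  simp only [bdry, clos_insert hp, Finset.mem_union, Finset.mem_sdiff, Finset.mem_insert,
    Finset.mem_erase, mem_outn]
  have : v ∈ D → v ∈ clos G D := fun h => mem_clos.2 (Or.inl h)
  grind

lemma disjoint_outn {D : Finset V} {p : V} : Disjoint (clos G D) (outn G D p) := by
  rw [Finset.disjoint_left]; intro v h1 h2
  exact (mem_outn.1 h2).2 h1

/-- The effect on the potential of making a live boundary vertex internal. -/
lemma pot_insert {D : Finset V} {p : V} (hp : p ∈ bdry G D) (Y : Finset V)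
    (hne : outn G D p ≠ ∅)
    (hY : ∀ y ∈ Y, y ∈ bdry G (insert p D) ∧ outn G (insert p D) y = ∅ ∧
      (y ∈ outn G D p ∨ outn G D y ≠ ∅)) :
    pot G D - 4 + ∑ r ∈ outn G D p, (4 - wt G r) + Y.card ≤ pot G (insert p D) := by
  have hb : ((bdry G (insert p D)).card : ℤ) = (bdry G D).card - 1 + (outn G D p).card := by
    rw [bdry_insert hp, Finset.card_union_of_disjoint, Finset.card_erase_of_mem hp]
    · have : 0 < (bdry G D).card := Finset.card_pos.2 ⟨p, hp⟩
      push_cast [Nat.cast_sub this]; ring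
    · exact (disjoint_outn (G := G) (D := D) (p := p)).mono_left
        ((Finset.erase_subset _ _).trans Finset.sdiff_subset)
  have hs : ∑ v ∈ clos G (insert p D), wt G v
      = ∑ v ∈ clos G D, wt G v + ∑ v ∈ outn G D p, wt G v := by
    rw [clos_insert hp, Finset.sum_union disjoint_outn]
  have hd : (dead G D).card + Y.card ≤ (dead G (insert p D)).card := by
    rw [← Finset.card_union_of_disjoint]
    · apply Finset.card_le_card
      intro y hy
      rw [Finset.mem_union] at hy
      rcases hy with hy | hy
      · simp only [dead, Finset.mem_filter] at hy ⊢
        refine ⟨?_, ?_⟩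
        · rw [bdry_insert hp]
          refine Finset.mem_union_left _ (Finset.mem_erase.2 ⟨?_, hy.1⟩)
          rintro rfl; exact hne hy.2
        · ext r
          have : r ∉ outn G D y := by simp [hy.2]
          rw [mem_outn] at this
          rw [mem_outn_insert hp]; simp; tauto
      · obtain ⟨h1, h2, _⟩ := hY y hy
        exact Finset.mem_filter.2 ⟨h1, h2⟩
    · rw [Finset.disjoint_left]
      intro y h1 h2
      obtain ⟨h3, h4⟩ := Finset.mem_filter.1 h1
      rcases (hY y h2).2.2 with h | h
      · exact (mem_outn.1 h).2 (bdry_sub h3)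
      · exact h h4
  have e : ∑ r ∈ outn G D p, (4 - wt G r)
      = 4 * (outn G D p).card - ∑ r ∈ outn G D p, wt G r := by
    rw [Finset.sum_sub_distrib]; simp [mul_comm]
  unfold pot
  rw [hb, hs, e]
  have : ((dead G D).card : ℤ) + Y.card ≤ (dead G (insert p D)).card := by exact_mod_cast hd
  linarith

lemma wt_le (v : V) : wt G v ≤ 2 := by unfold wt; split_ifs <;> norm_num

lemma Grow.nonempty {D : Finset V} (h : Grow G D) : D.Nonempty := by
  cases h <;> simp

/-- A connected dominating set yields a spanning tree all of whose internal vertices lie in it. -/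
lemma exists_tree [Nontrivial V] {D : Finset V} (hD : Grow G D) (hs : clos G D = Finset.univ) :
    ∃ T ≤ G, T.IsTree ∧ Fintype.card V ≤ leafCount T + D.card := by
  have hdom : ∀ v, v ∉ D → ∃ u ∈ D, G.Adj u v := by
    intro v hv
    have : v ∈ clos G D := by rw [hs]; exact Finset.mem_univ v
    rcases mem_clos.1 this with h | h
    · exact absurd h hv
    · exact h
  choose! f hfD hfA using hdom
  let H : SimpleGraph V := SimpleGraph.fromRel
    (fun u v => G.Adj u v ∧ ((u ∈ D ∧ v ∈ D) ∨ (u ∉ D ∧ v = f u)))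
  have hHG : H ≤ G := by
    intro u v h
    rw [SimpleGraph.fromRel_adj] at h
    rcases h.2 with h | h
    · exact h.1
    · exact h.1.symm
  have hreach : ∀ D', Grow G D' → D' ⊆ D → ∀ x ∈ D', ∀ y ∈ D', H.Reachable x y := by
    intro D' h
    induction h with
    | single v => intro _ x hx y hy; simp at hx hy; subst hx; subst hy; rfl
    | @add D' p hD' hp ih =>
      intro hsub
      have hsub' : D' ⊆ D := fun x hx => hsub (Finset.mem_insert_of_mem hx)
      obtain ⟨hpn, u, hu, hup⟩ := mem_bdry.1 hp
      have hup' : H.Reachable u p := by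
        apply SimpleGraph.Adj.reachable
        rw [SimpleGraph.fromRel_adj]
        exact ⟨hup.ne, Or.inl ⟨hup, Or.inl ⟨hsub' hu, hsub (Finset.mem_insert_self _ _)⟩⟩⟩
      have key : ∀ x ∈ insert p D', H.Reachable u x := by
        intro x hx
        rcases Finset.mem_insert.1 hx with rfl | hx
        · exact hup'
        · exact ih hsub' u hu x hx
      intro x hx y hy
      exact (key x hx).symm.trans (key y hy)
  obtain ⟨d, hd⟩ := hD.nonempty
  have hall : ∀ v, H.Reachable d v := by
    intro v
    by_cases hv : v ∈ D
    · exact hreach D hD subset_rfl d hd v hv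
    · refine (hreach D hD subset_rfl d hd (f v) (hfD v hv)).trans ?_
      apply SimpleGraph.Adj.reachable
      rw [SimpleGraph.fromRel_adj]
      exact ⟨(hfA v hv).ne, Or.inr ⟨(hfA v hv).symm, Or.inr ⟨hv, rfl⟩⟩⟩
  have hconn : H.Connected :=
    { preconnected := fun u v => (hall u).symm.trans (hall v), nonempty := ⟨d⟩ }
  obtain ⟨T, hT, hTt⟩ := hconn.exists_isTree_le
  refine ⟨T, hT.trans hHG, hTt, ?_⟩
  have hleaf : ∀ v, v ∉ D → T.degree v = 1 := by
    intro v hv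
    apply le_antisymm
    · rw [← SimpleGraph.card_neighborFinset_eq_degree]
      refine (Finset.card_le_card (t := {f v}) ?_).trans (by simp)
      intro w hw
      have hw' := hT ((SimpleGraph.mem_neighborFinset _ _ _).1 hw)
      rw [SimpleGraph.fromRel_adj] at hw'
      have hfv := hfD v hv
      simp only [Finset.mem_singleton]
      rcases hw'.2 with ⟨_, h | h⟩ | ⟨_, h | h⟩
      · exact absurd h.1 hv
      · exact h.2
      · exact absurd h.2 hv
      · exact absurd (h.2 ▸ hfD w h.1) hv
    · exact hTt.connected.preconnected.degree_pos_of_nontrivial v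
  unfold leafCount
  rw [Fintype.card_subtype]
  have : Finset.univ \ D ⊆ Finset.univ.filter (fun v => T.degree v = 1) := by
    intro v hv
    simp at hv
    simpa using hleaf v hv
  have h1 := Finset.card_le_card this
  have h2 := Finset.card_sdiff_add_card_eq_card (Finset.subset_univ D)
  rw [Finset.card_univ] at h2
  omega

lemma pot_spanning {D : Finset V} (hs : clos G D = Finset.univ) :
    pot G D = 5 * (Fintype.card V - D.card) - ∑ v, wt G v := by
  have h1 : dead G D = bdry G D := by
    apply Finset.filter_true_of_mem
    intro y _
    ext r; simp [mem_outn, hs]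
  have h2 : ((bdry G D).card : ℤ) = Fintype.card V - D.card := by
    have h2 := Finset.card_sdiff_add_card_eq_card (Finset.subset_univ D)
    rw [Finset.card_univ] at h2
    unfold bdry; rw [hs]; omega
  unfold pot
  rw [h1, h2, hs]; ring

lemma sum_wt : ∑ v, wt G v
    = 2 * (Fintype.card {v : V // 4 ≤ G.degree v}) + Fintype.card {v : V // G.degree v = 3} := by
  rw [Fintype.card_subtype, Fintype.card_subtype, Finset.card_filter, Finset.card_filter]
  push_cast
  rw [Finset.mul_sum, ← Finset.sum_add_distrib]
  apply Finset.sum_congr rfl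
  intro v _
  unfold wt
  split_ifs <;> first | omega

/-- A connected dominating set of potential at least 10 yields the required spanning tree. -/
lemma exists_tree_of_pot [Nontrivial V] {D : Finset V} (hD : Grow G D)
    (hs : clos G D = Finset.univ) (hp : 10 ≤ pot G D) :
    ∃ T ≤ G, T.IsTree ∧
      (2 / 5 : ℚ) * (Fintype.card {v : V // 4 ≤ G.degree v}) +
        (1 / 5 : ℚ) * (Fintype.card {v : V // G.degree v = 3}) + 2 ≤ leafCount T := by
  obtain ⟨T, h1, h2, h3⟩ := exists_tree hD hs
  refine ⟨T, h1, h2, ?_⟩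
  rw [pot_spanning hs, sum_wt] at hp
  have h4 : (2 * (Fintype.card {v : V // 4 ≤ G.degree v}) +
      Fintype.card {v : V // G.degree v = 3} + 10 : ℤ) ≤ 5 * leafCount T := by
    have : (Fintype.card V : ℤ) ≤ leafCount T + D.card := by exact_mod_cast h3
    linarith
  have h5 : (2 * (Fintype.card {v : V // 4 ≤ G.degree v}) +
      Fintype.card {v : V // G.degree v = 3} + 10 : ℚ) ≤ 5 * leafCount T := by exact_mod_cast h4
  linarith

lemma not_mem_of_outn {D : Finset V} {x r : V} (h : r ∈ outn G D x) : r ∉ clos G D :=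
  (mem_outn.1 h).2

lemma adj_of_outn {D : Finset V} {x r : V} (h : r ∈ outn G D x) : G.Adj x r :=
  (mem_outn.1 h).1

lemma sub_clos {D : Finset V} {v : V} (h : v ∈ D) : v ∈ clos G D := mem_clos.2 (Or.inl h)

lemma adj_mem_clos {D : Finset V} {v r : V} (h : v ∈ D) (hr : G.Adj v r) : r ∈ clos G D :=
  mem_clos.2 (Or.inr ⟨v, h, hr⟩)

/-- A vertex of the closed neighbourhood with an outer neighbour is on the boundary. -/
lemma mem_bdry_of_adj {D : Finset V} {v r : V} (h : v ∈ clos G D) (hr : G.Adj v r)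
    (hn : r ∉ clos G D) : v ∈ bdry G D :=
  Finset.mem_sdiff.2 ⟨h, fun hv => hn (adj_mem_clos hv hr)⟩

lemma not_mem_of_bdry {D : Finset V} {v : V} (h : v ∈ bdry G D) : v ∉ D :=
  (Finset.mem_sdiff.1 h).2

lemma card_insert_bdry {D : Finset V} {p : V} (hp : p ∈ bdry G D) :
    (insert p D).card = D.card + 1 := Finset.card_insert_of_notMem (not_mem_of_bdry hp)

lemma mem_bdry_insert {D : Finset V} {p y : V} (hp : p ∈ bdry G D) :
    y ∈ bdry G (insert p D) ↔ (y ∈ bdry G D ∧ y ≠ p) ∨ y ∈ outn G D p := by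
  rw [bdry_insert hp, Finset.mem_union, Finset.mem_erase]; tauto

lemma exists_adj_notMem {v : V} (T : Finset V) (h : T.card < G.degree v) :
    ∃ x, G.Adj v x ∧ x ∉ T := by
  rw [← SimpleGraph.card_neighborFinset_eq_degree] at h
  obtain ⟨x, hx, hT⟩ := Finset.exists_mem_notMem_of_card_lt_card h
  exact ⟨x, (SimpleGraph.mem_neighborFinset _ _ _).1 hx, hT⟩

lemma wt_eq_two {v : V} : wt G v = 2 ↔ 4 ≤ G.degree v := by
  unfold wt; split_ifs <;> simp_all

/-- `pot_insert` with crude bounds on the weights, and with the newly dead vertices described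
by their neighbours. -/
lemma pot_insert_le {D : Finset V} {p : V} (hp : p ∈ bdry G D) (Y : Finset V)
    (hne : outn G D p ≠ ∅)
    (hY : ∀ y ∈ Y, y ≠ p ∧ (y ∈ outn G D p ∨ y ∈ bdry G D ∧ outn G D y ≠ ∅) ∧
      ∀ r, G.Adj y r → r ∈ clos G D ∨ G.Adj p r) :
    pot G D - 4 + 2 * (outn G D p).card + Y.card ≤ pot G (insert p D) := by
  refine le_trans ?_ (pot_insert hp Y hne ?_)
  · have : ∑ r ∈ outn G D p, (2 : ℤ) ≤ ∑ r ∈ outn G D p, (4 - wt G r) :=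
      Finset.sum_le_sum fun r _ => by linarith [wt_le (G := G) r]
    rw [Finset.sum_const, nsmul_eq_mul] at this
    linarith
  · intro y hy
    obtain ⟨h1, h2, h3⟩ := hY y hy
    refine ⟨?_, ?_, ?_⟩
    · rw [mem_bdry_insert hp]; tauto
    · ext r
      rw [mem_outn_insert hp]; simp
      intro h4 h5; have := h3 r h4; tauto
    · tauto

lemma pot_insert_ge {D : Finset V} {p : V} (hp : p ∈ bdry G D) (h2 : 2 ≤ (outn G D p).card) :
    pot G D ≤ pot G (insert p D) := by
  have := pot_insert_le hp ∅ (by rintro h; simp [h] at h2) (by simp)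
  have h3 : (2 : ℤ) ≤ (outn G D p).card := by exact_mod_cast h2
  simp at this; linarith

/-- If adding `p` reaches every vertex, all new boundary vertices and all live ones die. -/
lemma pot_insert_spanning {D : Finset V} {p : V} (hp : p ∈ bdry G D)
    (hne : outn G D p ≠ ∅) (hs : clos G (insert p D) = Finset.univ)
    (L : Finset V) (hL : ∀ y ∈ L, y ≠ p ∧ y ∈ bdry G D ∧ outn G D y ≠ ∅) :
    pot G D - 4 + 3 * (outn G D p).card + L.card ≤ pot G (insert p D) := by
  have hd : Disjoint (outn G D p) L := by
    rw [Finset.disjoint_left]; intro y h1 h2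
    exact not_mem_of_outn h1 (bdry_sub (hL y h2).2.1)
  have := pot_insert_le hp (outn G D p ∪ L) hne ?_
  · rw [Finset.card_union_of_disjoint hd] at this
    push_cast at this
    linarith
  · intro y hy
    have hr : ∀ r, r ∈ clos G D ∨ G.Adj p r := by
      intro r; rw [← mem_clos_insert hp, hs]; exact Finset.mem_univ r
    rcases Finset.mem_union.1 hy with h | h
    · exact ⟨(adj_of_outn h).ne', Or.inl h, fun r _ => hr r⟩
    · exact ⟨(hL y h).1, Or.inr (hL y h).2, fun r _ => hr r⟩

/-- The live boundary vertices. -/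
noncomputable def live (G : SimpleGraph V) (D : Finset V) : Finset V :=
  (bdry G D).filter fun y => outn G D y ≠ ∅

lemma mem_live {D : Finset V} {y : V} : y ∈ live G D ↔ y ∈ bdry G D ∧ outn G D y ≠ ∅ := by
  simp [live]

/-- Adding `p` gains nothing: two outer neighbours, both of large degree, and nothing dies. -/
structure Clean (G : SimpleGraph V) (D : Finset V) (p a b : V) : Prop where
  hp : p ∈ bdry G D
  ne : a ≠ b
  out : outn G D p = {a, b}
  ha : 4 ≤ G.degree a
  hb : 4 ≤ G.degree b
  alive : ∀ y ∈ bdry G (insert p D), (y ∈ outn G D p ∨ outn G D y ≠ ∅) →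
    outn G (insert p D) y ≠ ∅

lemma Clean.symm {D : Finset V} {p a b : V} (h : Clean G D p a b) : Clean G D p b a :=
  ⟨h.hp, h.ne.symm, by rw [h.out, Finset.pair_comm], h.hb, h.ha, h.alive⟩

lemma clean_or {D : Finset V} {p : V} (hp : p ∈ bdry G D) (h2 : 2 ≤ (outn G D p).card) :
    pot G D + 1 ≤ pot G (insert p D) ∨ ∃ a b, Clean G D p a b := by
  by_contra hcon
  push Not at hcon
  obtain ⟨hlt, hno⟩ := hcon
  have hne : outn G D p ≠ ∅ := by rintro h; simp [h] at h2
  have h0 := pot_insert hp ∅ hne (by simp)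
  have hsum : ∀ r ∈ outn G D p, (2 : ℤ) ≤ 4 - wt G r := fun r _ => by
    linarith [wt_le (G := G) r]
  have hcs := Finset.sum_le_sum hsum
  rw [Finset.sum_const, nsmul_eq_mul] at hcs
  rw [Finset.card_empty, Nat.cast_zero, add_zero] at h0
  have hc : (outn G D p).card = 2 := by
    have : (2 * (outn G D p).card : ℤ) < 5 := by linarith
    have : 2 * (outn G D p).card < 5 := by exact_mod_cast this
    omega
  obtain ⟨a, b, hab, hout⟩ := Finset.card_eq_two.1 hc
  have h0' := h0
  rw [hout, Finset.sum_pair hab] at h0'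
  have := wt_le (G := G) a
  have := wt_le (G := G) b
  refine hno a b ⟨hp, hab, hout, wt_eq_two.1 (by linarith), wt_eq_two.1 (by linarith), ?_⟩
  intro y hy hy2 hy3
  have h1 := pot_insert hp {y} hne (by
    intro y' hy'
    rw [Finset.mem_singleton.1 hy']
    exact ⟨hy, hy3, hy2⟩)
  rw [hout, Finset.sum_pair hab] at h1
  simp at h1
  linarith

lemma Clean.card {D : Finset V} {p a b : V} (h : Clean G D p a b) : (outn G D p).card = 2 := by
  rw [h.out]; exact Finset.card_pair h.ne

lemma Clean.le {D : Finset V} {p a b : V} (h : Clean G D p a b) :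
    pot G D ≤ pot G (insert p D) := pot_insert_ge h.hp h.card.ge

lemma Clean.out_ne {D : Finset V} {p a b : V} (h : Clean G D p a b) : outn G D p ≠ ∅ := by
  rw [h.out]; simp

lemma Clean.live {D : Finset V} {p a b : V} (h : Clean G D p a b) :
    live G (insert p D) = (live G D).erase p ∪ {a, b} := by
  ext y
  rw [mem_live, mem_bdry_insert h.hp, Finset.mem_union, Finset.mem_erase, mem_live, ← h.out]
  constructor
  · rintro ⟨h1, h2⟩
    have : y ∈ bdry G D ∧ y ≠ p → outn G D y ≠ ∅ := by
      rintro - h3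
      apply h2
      ext r
      have : r ∉ outn G D y := by simp [h3]
      rw [mem_outn] at this
      rw [mem_outn_insert h.hp]; simp; tauto
    tauto
  · intro h1
    have := h.alive y (by rw [mem_bdry_insert h.hp]; tauto) (by tauto)
    tauto

lemma Clean.live_card {D : Finset V} {p a b : V} (h : Clean G D p a b) :
    (LeafyTree.live G (insert p D)).card = (LeafyTree.live G D).card + 1 := by
  have hp : p ∈ LeafyTree.live G D := mem_live.2 ⟨h.hp, h.out_ne⟩
  have : 0 < (LeafyTree.live G D).card := Finset.card_pos.2 ⟨p, hp⟩
  rw [h.live, Finset.card_union_of_disjoint, Finset.card_erase_of_mem hp, Finset.card_pair h.ne]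
  · omega
  · rw [Finset.disjoint_left]
    intro y h1 h2
    rw [← h.out] at h2
    exact not_mem_of_outn h2 (bdry_sub (mem_live.1 (Finset.mem_of_mem_erase h1)).1)

/-- Every boundary vertex has at most one outer neighbour. -/
def Stuck (G : SimpleGraph V) (D : Finset V) : Prop :=
  ∀ y ∈ bdry G D, (outn G D y).card ≤ 1

lemma Stuck.eq {D : Finset V} (h : Stuck G D) {y r s : V} (hy : y ∈ clos G D)
    (h1 : G.Adj y r) (h2 : r ∉ clos G D) (h3 : G.Adj y s) (h4 : s ∉ clos G D) : r = s :=
  Finset.card_le_one.1 (h y (mem_bdry_of_adj hy h1 h2)) r (mem_outn.2 ⟨h1, h2⟩) s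
    (mem_outn.2 ⟨h3, h4⟩)

/-- A larger connected set with potential bigger by 1, and by `k` if nothing is left outside. -/
def Improves (G : SimpleGraph V) (D : Finset V) (k : ℤ) : Prop :=
  ∃ D', Grow G D' ∧ D.card < D'.card ∧ pot G D + 1 ≤ pot G D' ∧
    (clos G D' = Finset.univ → pot G D + k ≤ pot G D')

lemma mem_clos_iff {D : Finset V} {p a b v : V} (hp : p ∈ bdry G D) (ho : outn G D p = {a, b}) :
    v ∈ clos G (insert p D) ↔ v ∈ clos G D ∨ v = a ∨ v = b := by
  rw [clos_insert hp, ho, Finset.mem_union, Finset.mem_insert, Finset.mem_singleton]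

lemma adj_of_pair {D : Finset V} {p a b : V} (ho : outn G D p = {a, b}) :
    G.Adj p a ∧ a ∉ clos G D ∧ G.Adj p b ∧ b ∉ clos G D := by
  have h1 : a ∈ outn G D p := by simp [ho]
  have h2 : b ∈ outn G D p := by simp [ho]
  exact ⟨adj_of_outn h1, not_mem_of_outn h1, adj_of_outn h2, not_mem_of_outn h2⟩

lemma eq_of_pair {D : Finset V} {p a b r : V} (ho : outn G D p = {a, b})
    (h : G.Adj p r) (hr : r ∉ clos G D) : r = a ∨ r = b := by
  have : r ∈ outn G D p := mem_outn.2 ⟨h, hr⟩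
  simpa [ho] using this

/-- Two boundary vertices covering both outer neighbours of a third one kill it. -/
lemma improves_of_two {D : Finset V} (hD : Grow G D) {p x y a b z w : V}
    (hp : p ∈ bdry G D) (hx : x ∈ bdry G D) (hy : y ∈ bdry G D)
    (hpo : outn G D p = {a, b}) (hxo : outn G D x = {a, z}) (hyo : outn G D y = {b, w})
    (hab : a ≠ b) (haz : a ≠ z) (haw : a ≠ w) (hbz : b ≠ z) (hbw : b ≠ w) (hzw : z ≠ w) :
    Improves G D 3 := by
  have hxy : x ≠ y := by
    rintro rfl
    have := eq_of_pair hxo (adj_of_pair hyo).1 (adj_of_pair hyo).2.1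
    grind
  have hpx : p ≠ x := by
    rintro rfl
    have := eq_of_pair hpo (adj_of_pair hxo).2.2.1 (adj_of_pair hxo).2.2.2
    grind
  have hpy : p ≠ y := by
    rintro rfl
    have := eq_of_pair hpo (adj_of_pair hyo).2.2.1 (adj_of_pair hyo).2.2.2
    grind
  have hxne : outn G D x ≠ ∅ := by simp [hxo]
  have hy1 : y ∈ bdry G (insert x D) := by rw [mem_bdry_insert hx]; tauto
  have hp1 : p ∈ bdry G (insert x D) := by rw [mem_bdry_insert hx]; tauto
  have hy1o : outn G (insert x D) y = {b, w} := by
    ext r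
    rw [← hyo, mem_outn_insert hx, mem_outn]
    have := eq_of_pair hxo (r := r)
    have := eq_of_pair hyo (r := r)
    grind
  have hp1o : outn G (insert x D) p ≠ ∅ := by
    have : b ∈ outn G (insert x D) p := by
      rw [mem_outn_insert hx]
      have := eq_of_pair hxo (r := b)
      have := adj_of_pair hpo
      grind
    intro h; simp [h] at this
  have g1 := pot_insert_ge hx (by rw [hxo, Finset.card_pair haz])
  have hyne : outn G (insert x D) y ≠ ∅ := by simp [hy1o]
  refine ⟨insert y (insert x D), (hD.add hx).add hy1, ?_, ?_, ?_⟩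
  · rw [card_insert_bdry hy1, card_insert_bdry hx]; omega
  · have := pot_insert_le hy1 {p} hyne (by
      intro q hq
      rw [Finset.mem_singleton.1 hq]
      refine ⟨hpy, Or.inr ⟨hp1, hp1o⟩, fun r hr => ?_⟩
      rw [mem_clos_insert hx]
      have := eq_of_pair hpo hr
      have := adj_of_pair hxo
      have := adj_of_pair hyo
      grind)
    rw [hy1o, Finset.card_pair hbw, Finset.card_singleton] at this
    push_cast at this
    linarith
  · intro hs
    have := pot_insert_spanning hy1 hyne hs {p} (by
      intro q hq
      rw [Finset.mem_singleton.1 hq]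
      exact ⟨hpy, hp1, hp1o⟩)
    rw [hy1o, Finset.card_pair hbw, Finset.card_singleton] at this
    push_cast at this
    linarith

/-- A boundary vertex with at least three outer neighbours. -/
lemma improves_of_three {D : Finset V} (hD : Grow G D) {x : V} (hx : x ∈ bdry G D)
    (h : 3 ≤ (outn G D x).card) : Improves G D 3 := by
  have h' : (3 : ℤ) ≤ (outn G D x).card := by exact_mod_cast h
  have hne : outn G D x ≠ ∅ := by rintro h0; simp [h0] at h
  refine ⟨insert x D, hD.add hx, by rw [card_insert_bdry hx]; omega, ?_, ?_⟩
  · have := pot_insert_le hx ∅ hne (by simp)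
    rw [Finset.card_empty] at this
    push_cast at this; linarith
  · intro hs
    have := pot_insert_spanning hx hne hs ∅ (by simp)
    rw [Finset.card_empty] at this
    push_cast at this; linarith

/-- Two boundary vertices with the same two outer neighbours, and a vertex left outside. -/
lemma improves_of_twins {D : Finset V} (hD : Grow G D) {x y a z b : V}
    (hx : x ∈ bdry G D) (hy : y ∈ bdry G D) (hxy : x ≠ y) (haz : a ≠ z)
    (hxo : outn G D x = {a, z}) (hyo : outn G D y = {a, z}) (hb : b ∉ clos G D)
    (hba : b ≠ a) (hbz : b ≠ z) : Improves G D 3 := by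
  refine ⟨insert x D, hD.add hx, by rw [card_insert_bdry hx]; omega, ?_, ?_⟩
  · have := pot_insert_le hx {y} (by simp [hxo]) (by
      intro q hq
      rw [Finset.mem_singleton.1 hq]
      refine ⟨hxy.symm, Or.inr ⟨hy, by simp [hyo]⟩, fun r hr => ?_⟩
      have := eq_of_pair hyo hr
      have := adj_of_pair hxo
      grind)
    rw [hxo, Finset.card_pair haz, Finset.card_singleton] at this
    push_cast at this
    linarith
  · intro hs
    have : b ∈ clos G (insert x D) := by rw [hs]; exact Finset.mem_univ b
    rw [mem_clos_iff hx hxo] at this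
    tauto

/-- The configuration in which the new neighbour `a` of `x` still has two outer neighbours. -/
lemma improves_of_chain {D : Finset V} (hD : Grow G D) {p x y a b z o : V}
    (hp : p ∈ bdry G D) (hx : x ∈ bdry G D) (hy : y ∈ bdry G D)
    (hpo : outn G D p = {a, b}) (hxo : outn G D x = {a, z}) (hyo : outn G D y = {b, z})
    (hab : a ≠ b) (haz : a ≠ z) (hbz : b ≠ z) (hadj : G.Adj a b)
    (hao : G.Adj a o) (hoc : o ∉ clos G D) (hoz : o ≠ z) (hob : o ≠ b) :
    Improves G D 3 := by
  have hxy : x ≠ y := by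
    rintro rfl
    have := eq_of_pair hxo (adj_of_pair hyo).1 (adj_of_pair hyo).2.1
    grind
  have hpx : p ≠ x := by
    rintro rfl
    have := eq_of_pair hpo (adj_of_pair hxo).2.2.1 (adj_of_pair hxo).2.2.2
    grind
  have hpy : p ≠ y := by
    rintro rfl
    have := eq_of_pair hpo (adj_of_pair hyo).2.2.1 (adj_of_pair hyo).2.2.2
    grind
  have hP := adj_of_pair hpo
  have hX := adj_of_pair hxo
  have hY := adj_of_pair hyo
  have ha1 : a ∈ bdry G (insert x D) := by
    rw [mem_bdry_insert hx, hxo]; simp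
  have hp1 : p ∈ bdry G (insert x D) := by rw [mem_bdry_insert hx]; tauto
  have hy1 : y ∈ bdry G (insert x D) := by rw [mem_bdry_insert hx]; tauto
  have hoa : o ≠ a := hao.ne'
  have hm : ∀ v, v ∈ clos G (insert x D) ↔ v ∈ clos G D ∨ v = a ∨ v = z :=
    fun v => mem_clos_iff hx hxo
  have hb1 : b ∉ clos G (insert x D) := by rw [hm]; grind
  have ho1 : o ∉ clos G (insert x D) := by rw [hm]; grind
  have hcard : 2 ≤ (outn G (insert x D) a).card := by
    rw [← Finset.card_pair hob]
    apply Finset.card_le_card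
    intro r hr
    rw [mem_outn]
    simp only [Finset.mem_insert, Finset.mem_singleton] at hr
    rcases hr with rfl | rfl <;> tauto
  have hcard' : (2 : ℤ) ≤ (outn G (insert x D) a).card := by exact_mod_cast hcard
  have hne : outn G (insert x D) a ≠ ∅ := by rintro h; simp [h] at hcard
  have hpn : outn G (insert x D) p ≠ ∅ :=
    Finset.ne_empty_of_mem (mem_outn.2 ⟨hP.2.2.1, hb1⟩)
  have hyn : outn G (insert x D) y ≠ ∅ :=
    Finset.ne_empty_of_mem (mem_outn.2 ⟨hY.1, hb1⟩)
  have hpa : p ≠ a := hP.1.ne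
  have hya : y ≠ a := fun h => hP.2.1 (h ▸ bdry_sub hy)
  have g1 := pot_insert_ge hx (by rw [hxo, Finset.card_pair haz])
  refine ⟨insert a (insert x D), (hD.add hx).add ha1, ?_, ?_, ?_⟩
  · rw [card_insert_bdry ha1, card_insert_bdry hx]; omega
  · have := pot_insert_le ha1 {p} hne (by
      intro q hq
      rw [Finset.mem_singleton.1 hq]
      refine ⟨hpa, Or.inr ⟨hp1, hpn⟩, fun r hr => ?_⟩
      rw [hm]
      have := eq_of_pair hpo hr
      grind)
    rw [Finset.card_singleton] at this
    push_cast at this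
    linarith
  · intro hs
    have := pot_insert_spanning ha1 hne hs {p} (by
      intro q hq
      rw [Finset.mem_singleton.1 hq]
      exact ⟨hpa, hp1, hpn⟩)
    rw [Finset.card_singleton] at this
    push_cast at this
    linarith

/-- Three outer vertices `c₁ c₂ c₃`, pairwise adjacent, such that the boundary vertices `t₁ t₂ t₃`
see exactly the pairs of them. -/
structure Sun (G : SimpleGraph V) (D : Finset V) (t₁ t₂ t₃ c₁ c₂ c₃ : V) : Prop where
  b₁ : t₁ ∈ bdry G D
  b₂ : t₂ ∈ bdry G D
  b₃ : t₃ ∈ bdry G D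
  o₁ : outn G D t₁ = {c₂, c₃}
  o₂ : outn G D t₂ = {c₁, c₃}
  o₃ : outn G D t₃ = {c₁, c₂}
  n₁₂ : G.Adj c₁ c₂
  n₁₃ : G.Adj c₁ c₃
  n₂₃ : G.Adj c₂ c₃
  span : ∀ v, v ∈ clos G D ∨ v = c₁ ∨ v = c₂ ∨ v = c₃
  live : ∀ y ∈ live G D, y = t₁ ∨ y = t₂ ∨ y = t₃

/-- In the configuration of `Sun` one may use the two boundary vertices `p` and `x`. -/
lemma improves_or_sun {D : Finset V} (hD : Grow G D) {p x y a b z : V}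
    (hc : Clean G D p a b) (hx : x ∈ bdry G D) (hy : y ∈ bdry G D)
    (hxo : outn G D x = {a, z}) (hyo : outn G D y = {b, z})
    (haz : G.Adj a z) (hbz : G.Adj b z) (hadj : G.Adj a b)
    (hA : ∀ r, G.Adj a r → r ∈ clos G D ∨ r = b ∨ r = z)
    (hB : ∀ r, G.Adj b r → r ∈ clos G D ∨ r = a ∨ r = z) :
    Improves G D 3 ∨ (Improves G D 2 ∧ Sun G D p y x z a b) := by
  have hp := hc.hp
  have hpo := hc.out
  have hP := adj_of_pair hpo
  have hX := adj_of_pair hxo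
  have hY := adj_of_pair hyo
  have hxy : x ≠ y := by
    rintro rfl
    have := eq_of_pair hxo (adj_of_pair hyo).1 (adj_of_pair hyo).2.1
    grind [SimpleGraph.Adj.ne]
  have hpx : p ≠ x := by
    rintro rfl
    have := eq_of_pair hpo (adj_of_pair hxo).2.2.1 (adj_of_pair hxo).2.2.2
    grind [SimpleGraph.Adj.ne]
  have hpy : p ≠ y := by
    rintro rfl
    have := eq_of_pair hpo (adj_of_pair hyo).2.2.1 (adj_of_pair hyo).2.2.2
    grind [SimpleGraph.Adj.ne]
  have hm : ∀ v, v ∈ clos G (insert p D) ↔ v ∈ clos G D ∨ v = a ∨ v = b :=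
    fun v => mem_clos_iff hp hpo
  have hz1 : z ∉ clos G (insert p D) := by
    rw [hm]; grind [SimpleGraph.Adj.ne]
  have hx1 : x ∈ bdry G (insert p D) := by rw [mem_bdry_insert hp]; tauto
  have hy1 : y ∈ bdry G (insert p D) := by rw [mem_bdry_insert hp]; tauto
  have ha1 : a ∈ bdry G (insert p D) := by rw [mem_bdry_insert hp, hpo]; simp
  have hb1 : b ∈ bdry G (insert p D) := by rw [mem_bdry_insert hp, hpo]; simp
  have hx1o : outn G (insert p D) x = {z} := by
    ext r
    rw [mem_outn, hm, Finset.mem_singleton]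
    have := eq_of_pair hxo (r := r)
    grind [SimpleGraph.Adj.ne]
  have hne : outn G (insert p D) x ≠ ∅ := by simp [hx1o]
  have han : outn G (insert p D) a ≠ ∅ := Finset.ne_empty_of_mem (mem_outn.2 ⟨haz, hz1⟩)
  have hbn : outn G (insert p D) b ≠ ∅ := Finset.ne_empty_of_mem (mem_outn.2 ⟨hbz, hz1⟩)
  have hyn : outn G (insert p D) y ≠ ∅ :=
    Finset.ne_empty_of_mem (mem_outn.2 ⟨hY.2.2.1, hz1⟩)
  have hax : a ≠ x := hX.1.ne'
  have hbx : b ≠ x := fun h => hP.2.2.2 (h ▸ bdry_sub hx)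
  have hya : y ≠ a := fun h => hP.2.1 (h ▸ bdry_sub hy)
  have hyb : y ≠ b := hY.1.ne
  have hc3 : ({a, b, y} : Finset V).card = 3 := by
    rw [Finset.card_eq_three]; exact ⟨a, b, y, hadj.ne, hya.symm, hyb.symm, rfl⟩
  have g1 := hc.le
  have hg : Grow G (insert x (insert p D)) := (hD.add hp).add hx1
  have hcd : D.card < (insert x (insert p D)).card := by
    rw [card_insert_bdry hx1, card_insert_bdry hp]; omega
  have h1 : pot G D + 1 ≤ pot G (insert x (insert p D)) := by
    have := pot_insert_le hx1 {a, b, y} hne (by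
      intro q hq
      simp only [Finset.mem_insert, Finset.mem_singleton] at hq
      have := hX.2.2.1
      rcases hq with rfl | rfl | rfl
      · refine ⟨hax, Or.inr ⟨ha1, han⟩, fun r hr => ?_⟩
        rw [hm]; have := hA r hr; grind
      · refine ⟨hbx, Or.inr ⟨hb1, hbn⟩, fun r hr => ?_⟩
        rw [hm]; have := hB r hr; grind
      · refine ⟨hxy.symm, Or.inr ⟨hy1, hyn⟩, fun r hr => ?_⟩
        rw [hm]; have := eq_of_pair hyo hr; grind)
    rw [hc3, hx1o, Finset.card_singleton] at this
    push_cast at this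
    linarith
  by_cases hs : clos G (insert x (insert p D)) = Finset.univ
  swap
  · exact Or.inl ⟨_, hg, hcd, h1, fun h => absurd h hs⟩
  by_cases hl : ∃ w ∈ live G D, w ≠ p ∧ w ≠ y ∧ w ≠ x
  · left
    obtain ⟨w, hw, hwp, hwy, hwx⟩ := hl
    obtain ⟨hwb, hwo⟩ := mem_live.1 hw
    refine ⟨_, hg, hcd, h1, fun _ => ?_⟩
    have hw1 : w ∈ bdry G (insert p D) := by rw [mem_bdry_insert hp]; tauto
    have hwa : w ≠ a := fun h => hP.2.1 (h ▸ bdry_sub hwb)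
    have hwb' : w ≠ b := fun h => hP.2.2.2 (h ▸ bdry_sub hwb)
    have hc4 : ({w, a, b, y} : Finset V).card = 4 := by
      rw [Finset.card_insert_of_notMem (by simp [hwa, hwb', hwy]), hc3]
    have := pot_insert_spanning hx1 hne hs {w, a, b, y} (by
      intro q hq
      simp only [Finset.mem_insert, Finset.mem_singleton] at hq
      rcases hq with rfl | rfl | rfl | rfl
      · exact ⟨hwx, hw1, hc.alive _ hw1 (Or.inr hwo)⟩
      · exact ⟨hax, ha1, han⟩
      · exact ⟨hbx, hb1, hbn⟩
      · exact ⟨hxy.symm, hy1, hyn⟩)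
    rw [hc4, hx1o, Finset.card_singleton] at this
    push_cast at this
    linarith
  · right
    refine ⟨⟨_, hg, hcd, h1, fun _ => ?_⟩, hp, hy, hx, hpo, ?_, ?_, haz.symm, hbz.symm, hadj,
      ?_, ?_⟩
    · have := pot_insert_spanning hx1 hne hs {a, b, y} (by
        intro q hq
        simp only [Finset.mem_insert, Finset.mem_singleton] at hq
        rcases hq with rfl | rfl | rfl
        · exact ⟨hax, ha1, han⟩
        · exact ⟨hbx, hb1, hbn⟩
        · exact ⟨hxy.symm, hy1, hyn⟩)
      rw [hc3, hx1o, Finset.card_singleton] at this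
      push_cast at this
      linarith
    · rw [hyo, Finset.pair_comm]
    · rw [hxo, Finset.pair_comm]
    · intro v
      have : v ∈ clos G (insert x (insert p D)) := by rw [hs]; exact Finset.mem_univ v
      rw [clos_insert hx1, hx1o, Finset.mem_union, hm, Finset.mem_singleton] at this
      tauto
    · intro w hw
      by_contra hcon
      exact hl ⟨w, hw, by tauto⟩

/-- When a clean step leads to a stuck position, an exchange improves the potential. -/
lemma exchange {D : Finset V} (hD : Grow G D) {p a b : V} (hc : Clean G D p a b)
    (hst : Stuck G (insert p D)) :
    Improves G D 3 ∨ (Improves G D 2 ∧ ∃ t₂ t₃ c₁ c₂ c₃, Sun G D p t₂ t₃ c₁ c₂ c₃) := by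
  have hp := hc.hp
  have hpo := hc.out
  have hP := adj_of_pair hpo
  have hm : ∀ v, v ∈ clos G (insert p D) ↔ v ∈ clos G D ∨ v = a ∨ v = b :=
    fun v => mem_clos_iff hp hpo
  have hone : ∀ y r s, (y ∈ clos G D ∨ y = a ∨ y = b) → G.Adj y r → r ∉ clos G D → r ≠ a →
      r ≠ b → G.Adj y s → s ∉ clos G D → s ≠ a → s ≠ b → r = s := by
    intro y r s hy h1 h2 h3 h4 h5 h6 h7 h8
    exact hst.eq ((hm y).2 hy) h1 (by rw [hm]; tauto) h5 (by rw [hm]; tauto)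
  have halive : ∀ y, y ≠ p → (y = a ∨ y = b ∨ y ∈ clos G D ∧ ∃ r, G.Adj y r ∧ r ∉ clos G D) →
      ∃ r, G.Adj y r ∧ r ∉ clos G D ∧ r ≠ a ∧ r ≠ b := by
    intro y hyp hy
    have key : outn G (insert p D) y ≠ ∅ := by
      rcases hy with rfl | rfl | ⟨h1, r, h2, h3⟩
      · apply hc.alive _ _ (Or.inl (by simp [hpo])); rw [mem_bdry_insert hp, hpo]; simp
      · apply hc.alive _ _ (Or.inl (by simp [hpo])); rw [mem_bdry_insert hp, hpo]; simp
      · have := mem_bdry_of_adj h1 h2 h3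
        apply hc.alive _ _ (Or.inr (Finset.ne_empty_of_mem (mem_outn.2 ⟨h2, h3⟩)))
        rw [mem_bdry_insert hp]; tauto
    obtain ⟨r, hr⟩ := Finset.nonempty_iff_ne_empty.2 key
    rw [mem_outn, hm] at hr
    exact ⟨r, hr.1, by tauto, by tauto, by tauto⟩
  obtain ⟨oa, hoa, hoac, hoaa, hoab⟩ := halive a hP.1.ne' (Or.inl rfl)
  obtain ⟨ob, hob, hobc, hoba, hobb⟩ := halive b hP.2.2.1.ne' (Or.inr (Or.inl rfl))
  by_cases h3 : ∃ x ∈ clos G D, x ≠ p ∧ G.Adj x a ∧ G.Adj x b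
  · left
    obtain ⟨x, hx, hxp, hxa, hxb⟩ := h3
    obtain ⟨z, hz, hzc, hza, hzb⟩ := halive x hxp (Or.inr (Or.inr ⟨hx, a, hxa, hP.2.1⟩))
    refine improves_of_three hD (mem_bdry_of_adj hx hxa hP.2.1) ?_
    have : ({a, b, z} : Finset V).card = 3 := by
      rw [Finset.card_eq_three]; exact ⟨a, b, z, hc.ne, hza.symm, hzb.symm, rfl⟩
    rw [← this]
    apply Finset.card_le_card
    intro r hr
    simp only [Finset.mem_insert, Finset.mem_singleton] at hr
    rw [mem_outn]
    rcases hr with rfl | rfl | rfl <;> tauto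
  have partnerA : ∀ x, G.Adj a x → x ≠ p → x ≠ b → x ≠ oa →
      x ∈ bdry G D ∧ ∃ z, z ∉ clos G D ∧ z ≠ a ∧ z ≠ b ∧ outn G D x = {a, z} := by
    intro x hx hxp hxb hxo
    have hxc : x ∈ clos G D := by
      by_contra hxc
      exact hxo (hone a x oa (by tauto) hx hxc hx.ne' hxb hoa hoac hoaa hoab)
    obtain ⟨z, hz, hzc, hza, hzb⟩ := halive x hxp (Or.inr (Or.inr ⟨hxc, a, hx.symm, hP.2.1⟩))
    refine ⟨mem_bdry_of_adj hxc hx.symm hP.2.1, z, hzc, hza, hzb, ?_⟩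
    ext r
    rw [mem_outn, Finset.mem_insert, Finset.mem_singleton]
    have := hone x r z (Or.inl hxc)
    have := hx.symm
    grind
  have partnerB : ∀ x, G.Adj b x → x ≠ p → x ≠ a → x ≠ ob →
      x ∈ bdry G D ∧ ∃ z, z ∉ clos G D ∧ z ≠ a ∧ z ≠ b ∧ outn G D x = {b, z} := by
    intro x hx hxp hxb hxo
    have hxc : x ∈ clos G D := by
      by_contra hxc
      exact hxo (hone b x ob (by tauto) hx hxc hxb hx.ne' hob hobc hoba hobb)
    obtain ⟨z, hz, hzc, hza, hzb⟩ := halive x hxp (Or.inr (Or.inr ⟨hxc, b, hx.symm, hP.2.2.2⟩))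
    refine ⟨mem_bdry_of_adj hxc hx.symm hP.2.2.2, z, hzc, hza, hzb, ?_⟩
    ext r
    rw [mem_outn, Finset.mem_insert, Finset.mem_singleton]
    have := hone x r z (Or.inl hxc)
    have := hx.symm
    grind
  have hcard3 : ∀ u v w : V, ({u, v, w} : Finset V).card ≤ 3 := fun u v w => Finset.card_le_three
  obtain ⟨x, hax, hxn⟩ := exists_adj_notMem (G := G) {p, b, oa}
    (lt_of_le_of_lt (hcard3 _ _ _) hc.ha)
  obtain ⟨y, hby, hyn⟩ := exists_adj_notMem (G := G) {p, a, ob}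
    (lt_of_le_of_lt (hcard3 _ _ _) hc.hb)
  simp only [Finset.mem_insert, Finset.mem_singleton, not_or] at hxn hyn
  obtain ⟨hx, z, hzc, hza, hzb, hxo⟩ := partnerA x hax hxn.1 hxn.2.1 hxn.2.2
  obtain ⟨hy, w, hwc, hwa, hwb, hyo⟩ := partnerB y hby hyn.1 hyn.2.1 hyn.2.2
  by_cases hzw : z = w
  swap
  · exact Or.inl (improves_of_two hD hp hx hy hpo hxo hyo hc.ne hza.symm hwa.symm hzb.symm
      hwb.symm hzw)
  subst hzw
  by_cases hab : G.Adj a b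
  swap
  · left
    obtain ⟨x', hax', hxn'⟩ := exists_adj_notMem (G := G) {p, x, oa}
      (lt_of_le_of_lt (hcard3 _ _ _) hc.ha)
    simp only [Finset.mem_insert, Finset.mem_singleton, not_or] at hxn'
    obtain ⟨hx', z', hzc', hza', hzb', hxo'⟩ := partnerA x' hax' hxn'.1
      (fun h => hab (h ▸ hax')) hxn'.2.2
    by_cases hzz : z' = z
    · subst hzz
      exact improves_of_twins hD hx hx' (Ne.symm hxn'.2.1) hza.symm hxo hxo' hP.2.2.2
        hc.ne.symm hzb.symm
    · exact improves_of_two hD hp hx' hy hpo hxo' hyo hc.ne hza'.symm hwa.symm hzb'.symm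
        hwb.symm hzz
  by_cases h1 : oa = z
  swap
  · exact Or.inl (improves_of_chain hD hp hx hy hpo hxo hyo hc.ne hza.symm hzb.symm hab hoa hoac
      h1 hoab)
  by_cases h2 : ob = z
  swap
  · exact Or.inl (improves_of_chain hD hp hy hx (hc.symm.out) hyo hxo hc.ne.symm hzb.symm hza.symm
      hab.symm hob hobc h2 hoba)
  subst h1
  subst h2
  have hA : ∀ r, G.Adj a r → r ∈ clos G D ∨ r = b ∨ r = ob := by
    intro r hr
    by_contra hcon
    push Not at hcon
    exact hcon.2.2 (hone a r _ (by tauto) hr hcon.1 hr.ne' hcon.2.1 hoa hoac hoaa hoab)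
  have hB : ∀ r, G.Adj b r → r ∈ clos G D ∨ r = a ∨ r = ob := by
    intro r hr
    by_contra hcon
    push Not at hcon
    exact hcon.2.2 (hone b r _ (by tauto) hr hcon.1 hcon.2.1 hr.ne' hob hobc hoba hobb)
  rcases improves_or_sun hD hc hx hy hxo hyo hoa hob hab hA hB with h | ⟨h, hsun⟩
  · exact Or.inl h
  · exact Or.inr ⟨h, _, _, _, _, _, hsun⟩

lemma Improves.mono {D : Finset V} {k l : ℤ} (h : Improves G D k) (hl : l ≤ k) :
    Improves G D l := by
  obtain ⟨D', h1, h2, h3, h4⟩ := h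
  exact ⟨D', h1, h2, h3, fun hs => by linarith [h4 hs]⟩

lemma Improves.of_le {D D₁ : Finset V} {k : ℤ} (h : Improves G D₁ k) (hc : D.card ≤ D₁.card)
    (hp : pot G D ≤ pot G D₁) : Improves G D k := by
  obtain ⟨D', h1, h2, h3, h4⟩ := h
  exact ⟨D', h1, by omega, by linarith, fun hs => by linarith [h4 hs]⟩

lemma Stuck.exists_of_not {D : Finset V} (h : ¬ Stuck G D) :
    ∃ y ∈ bdry G D, 2 ≤ (outn G D y).card := by
  unfold Stuck at h
  push Not at h
  exact h

lemma improves_of_gain {D : Finset V} (hD : Grow G D) {p : V} (hp : p ∈ bdry G D)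
    (h2 : 2 ≤ (outn G D p).card) (hg : pot G D + 1 ≤ pot G (insert p D)) :
    Improves G D (1 + (live G D).card) := by
  have hne : outn G D p ≠ ∅ := by rintro h; simp [h] at h2
  refine ⟨insert p D, hD.add hp, by rw [card_insert_bdry hp]; omega, hg, fun hs => ?_⟩
  have := pot_insert_spanning hp hne hs ((live G D).erase p) (by
    intro y hy
    rw [Finset.mem_erase, mem_live] at hy
    exact ⟨hy.1, hy.2⟩)
  have hpl : p ∈ live G D := mem_live.2 ⟨hp, hne⟩
  have h3 : 0 < (live G D).card := Finset.card_pos.2 ⟨p, hpl⟩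
  rw [Finset.card_erase_of_mem hpl] at this
  push_cast [Nat.cast_sub (show 1 ≤ (live G D).card from h3)] at this
  have h2' : (2 : ℤ) ≤ (outn G D p).card := by exact_mod_cast h2
  linarith

/-- A boundary vertex with two outer neighbours leads to a better set. -/
lemma improves {D : Finset V} (hD : Grow G D) {p : V} (hp : p ∈ bdry G D)
    (h2 : 2 ≤ (outn G D p).card) :
    Improves G D 2 ∧ (4 ≤ (live G D).card → Improves G D 3) := by
  induction hn : Fintype.card V - D.card using Nat.strong_induction_on generalizing D p with
  | _ n ih =>
    have hpl : p ∈ live G D := mem_live.2 ⟨hp, by rintro h; simp [h] at h2⟩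
    have h0 : 1 ≤ (live G D).card := Finset.card_pos.2 ⟨p, hpl⟩
    rcases clean_or hp h2 with hg | ⟨a, b, hc⟩
    · have := improves_of_gain hD hp h2 hg
      exact ⟨this.mono (by omega), fun h => this.mono (by omega)⟩
    · by_cases hst : Stuck G (insert p D)
      · rcases exchange hD hc hst with h | ⟨h, t₂, t₃, c₁, c₂, c₃, hs⟩
        · exact ⟨h.mono (by norm_num), fun _ => h⟩
        · refine ⟨h, fun h4 => ?_⟩
          have : live G D ⊆ {p, t₂, t₃} := fun y hy => by
            have := hs.live y hy
            simpa using this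
          have := Finset.card_le_card this
          have := Finset.card_le_three (a := p) (b := t₂) (c := t₃)
          omega
      · obtain ⟨y, hy, hy2⟩ := Stuck.exists_of_not hst
        have hle : (insert p D).card ≤ Fintype.card V := Finset.card_le_univ _
        have hcp := card_insert_bdry hp
        have hl := hc.live_card
        have := ih _ (by omega) (hD.add hp) hy hy2 rfl
        have hle := hc.le
        exact ⟨this.1.of_le (by omega) hle,
          fun h4 => (this.2 (by omega)).of_le (by omega) hle⟩

lemma improves_or_exists_sun {D : Finset V} (hD : Grow G D) {p : V} (hp : p ∈ bdry G D)
    (h2 : 2 ≤ (outn G D p).card) (h3 : 3 ≤ (live G D).card) :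
    Improves G D 3 ∨ (Improves G D 2 ∧ ∃ t₁ t₂ t₃ c₁ c₂ c₃, Sun G D t₁ t₂ t₃ c₁ c₂ c₃) := by
  rcases clean_or hp h2 with hg | ⟨a, b, hc⟩
  · exact Or.inl ((improves_of_gain hD hp h2 hg).mono (by omega))
  · by_cases hst : Stuck G (insert p D)
    · rcases exchange hD hc hst with h | ⟨h, h'⟩
      · exact Or.inl h
      · exact Or.inr ⟨h, p, h'⟩
    · obtain ⟨y, hy, hy2⟩ := Stuck.exists_of_not hst
      have hl := hc.live_card
      have hcp := card_insert_bdry hp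
      exact Or.inl (((improves (hD.add hp) hy hy2).2 (by omega)).of_le (by omega) hc.le)

lemma Sun.rot {D : Finset V} {t₁ t₂ t₃ c₁ c₂ c₃ : V} (h : Sun G D t₁ t₂ t₃ c₁ c₂ c₃) :
    Sun G D t₂ t₃ t₁ c₂ c₃ c₁ where
  b₁ := h.b₂
  b₂ := h.b₃
  b₃ := h.b₁
  o₁ := by rw [h.o₂, Finset.pair_comm]
  o₂ := by rw [h.o₃, Finset.pair_comm]
  o₃ := h.o₁
  n₁₂ := h.n₂₃
  n₁₃ := h.n₁₂.symm
  n₂₃ := h.n₁₃.symm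
  span v := by have := h.span v; tauto
  live y hy := by have := h.live y hy; tauto

lemma Sun.nbr {D : Finset V} {t₁ t₂ t₃ c₁ c₂ c₃ r : V} (h : Sun G D t₁ t₂ t₃ c₁ c₂ c₃)
    (hr : G.Adj c₁ r) : r = t₂ ∨ r = t₃ ∨ r = c₂ ∨ r = c₃ := by
  have hc1 := (adj_of_pair h.o₂).2.1
  rcases h.span r with h1 | h1 | h1 | h1
  · rcases h.live r (mem_live.2 ⟨mem_bdry_of_adj h1 hr.symm hc1,
      Finset.ne_empty_of_mem (mem_outn.2 ⟨hr.symm, hc1⟩)⟩) with rfl | h2 | h2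
    · have := eq_of_pair h.o₁ hr.symm hc1
      have := h.n₁₂.ne
      have := h.n₁₃.ne
      tauto
    · exact Or.inl h2
    · exact Or.inr (Or.inl h2)
  · exact absurd h1 hr.ne'
  · tauto
  · tauto

/-- A connected set with large potential which does not reach all vertices. -/
def Gadget (G : SimpleGraph V) : Prop :=
  ∃ D, Grow G D ∧ clos G D ≠ Finset.univ ∧ 9 ≤ pot G D

lemma clos_single (v : V) : clos G {v} = insert v (G.neighborFinset v) := by
  ext x; simp [mem_clos]

lemma mem_clos_single {v x : V} : x ∈ clos G {v} ↔ x = v ∨ G.Adj v x := by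
  simp [clos_single]

lemma bdry_single (v : V) : bdry G {v} = G.neighborFinset v := by
  ext x; simp [mem_bdry, eq_comm]
  rintro h rfl; exact G.irrefl h

lemma mem_bdry_single {v x : V} : x ∈ bdry G {v} ↔ G.Adj v x := by
  simp [bdry_single]

lemma pot_single (v : V) (Y : Finset V)
    (hY : ∀ y ∈ Y, G.Adj v y ∧ ∀ r, G.Adj y r → r = v ∨ G.Adj v r) :
    4 * (G.degree v : ℤ) - wt G v - ∑ r ∈ G.neighborFinset v, wt G r + Y.card ≤ pot G {v} := by
  have h1 : Y.card ≤ (dead G {v}).card := by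
    apply Finset.card_le_card
    intro y hy
    obtain ⟨h2, h3⟩ := hY y hy
    refine Finset.mem_filter.2 ⟨mem_bdry_single.2 h2, ?_⟩
    ext r
    rw [mem_outn, mem_clos_single]
    have := h3 r
    simp; tauto
  have h1' : (Y.card : ℤ) ≤ (dead G {v}).card := by exact_mod_cast h1
  unfold pot
  rw [clos_single, bdry_single, SimpleGraph.card_neighborFinset_eq_degree,
    Finset.sum_insert (by simp)]
  linarith

lemma pot_single_ge (v : V) (Y : Finset V)
    (hY : ∀ y ∈ Y, G.Adj v y ∧ ∀ r, G.Adj y r → r = v ∨ G.Adj v r) :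
    2 * (G.degree v : ℤ) - 2 + Y.card ≤ pot G {v} := by
  have := pot_single v Y hY
  have h1 : ∑ r ∈ G.neighborFinset v, wt G r ≤ ∑ r ∈ G.neighborFinset v, (2 : ℤ) :=
    Finset.sum_le_sum fun r _ => wt_le r
  rw [Finset.sum_const, nsmul_eq_mul, SimpleGraph.card_neighborFinset_eq_degree] at h1
  have := wt_le (G := G) v
  linarith

/-- A sun whose boundary triple contains an adjacent pair with a single further common
neighbour. -/
lemma Sun.gadget {D : Finset V} {t₁ t₂ t₃ c₁ c₂ c₃ x v : V} (h : Sun G D t₁ t₂ t₃ c₁ c₂ c₃)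
    (h23 : G.Adj t₂ t₃) (hx : G.Adj t₂ x) (hxc : x ∈ D)
    (ht₃ : ∀ r, G.Adj t₃ r → r = x ∨ r = t₂ ∨ r = c₁ ∨ r = c₂)
    (hv : v ∈ D) (hvt : ¬ G.Adj v t₂) : Gadget G := by
  have H1 := adj_of_pair h.o₁
  have H2 := adj_of_pair h.o₂
  have H3 := adj_of_pair h.o₃
  have ht : ∀ t ∈ bdry G D, t ≠ v ∧ t ≠ x ∧ t ≠ c₁ ∧ t ≠ c₂ ∧ t ≠ c₃ := by
    intro t ht
    have h1 := not_mem_of_bdry ht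
    have h2 := bdry_sub ht
    refine ⟨?_, ?_, ?_, ?_, ?_⟩ <;> rintro rfl <;> tauto
  have T1 := ht _ h.b₁
  have T2 := ht _ h.b₂
  have T3 := ht _ h.b₃
  have h3c : ¬ G.Adj t₃ c₃ := fun hh => by
    have := eq_of_pair h.o₃ hh H1.2.2.2
    have := h.n₁₃.ne; have := h.n₂₃.ne
    grind
  have h12 : t₁ ≠ t₂ := by
    rintro rfl
    have := eq_of_pair h.o₂ H1.1 H1.2.1
    have := h.n₁₂.ne; have := h.n₂₃.ne
    grind
  have h13 : t₁ ≠ t₃ := by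
    rintro rfl
    exact h3c H1.2.2.1
  have hDc : ∀ d ∈ D, ∀ c, c ∉ clos G D → ¬ G.Adj c d ∧ c ≠ d := fun d hd c hc =>
    ⟨fun hh => hc (adj_mem_clos hd hh.symm), fun e => hc (e ▸ sub_clos hd)⟩
  have hx3 := hDc x hxc c₃ H1.2.2.2
  have hv3 := hDc v hv c₃ H1.2.2.2
  have hN3 : ∀ r, G.Adj c₃ r → r = t₁ ∨ r = t₂ ∨ r = c₁ ∨ r = c₂ := fun r hr =>
    h.rot.rot.nbr hr
  have hdeg : 4 ≤ G.degree c₃ := by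
    have : ({t₁, t₂, c₁, c₂} : Finset V).card = 4 := by
      rw [Finset.card_insert_of_notMem (by simp; tauto),
        Finset.card_eq_three.2 ⟨t₂, c₁, c₂, by tauto, by tauto, h.n₁₂.ne, rfl⟩]
    rw [← this, ← SimpleGraph.card_neighborFinset_eq_degree]
    apply Finset.card_le_card
    intro r hr
    simp only [Finset.mem_insert, Finset.mem_singleton] at hr
    rw [SimpleGraph.mem_neighborFinset]
    rcases hr with rfl | rfl | rfl | rfl
    · exact H1.2.2.1.symm
    · exact H2.2.2.1.symm
    · exact h.n₁₃.symm
    · exact h.n₂₃.symm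
  have hdeg' : (4 : ℤ) ≤ G.degree c₃ := by exact_mod_cast hdeg
  have p1 := pot_single_ge (G := G) c₃ ∅ (by simp)
  have ht2 : t₂ ∈ bdry G {c₃} := mem_bdry_single.2 H2.2.2.1.symm
  have ho : ({x, t₃} : Finset V) ⊆ outn G {c₃} t₂ := by
    intro r hr
    simp only [Finset.mem_insert, Finset.mem_singleton] at hr
    rw [mem_outn, mem_clos_single]
    rcases hr with rfl | rfl
    · exact ⟨hx, by tauto⟩
    · exact ⟨h23, by rw [G.adj_comm] at h3c; tauto⟩
  have hoc := Finset.card_le_card ho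
  rw [Finset.card_pair T3.2.1.symm] at hoc
  have hoc' : (2 : ℤ) ≤ (outn G {c₃} t₂).card := by exact_mod_cast hoc
  have hne : outn G {c₃} t₂ ≠ ∅ := by rintro h; simp [h] at hoc
  have c3 : ({c₁, c₂, t₃} : Finset V).card = 3 :=
    Finset.card_eq_three.2 ⟨c₁, c₂, t₃, h.n₁₂.ne, by tauto, by tauto, rfl⟩
  have hlive : ∀ c, G.Adj c t₃ → outn G {c₃} c ≠ ∅ := fun c hc => by
    refine Finset.ne_empty_of_mem (mem_outn.2 ⟨hc, ?_⟩)
    rw [mem_clos_single]; rw [G.adj_comm] at h3c; tauto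
  have p2 := pot_insert_le ht2 {c₁, c₂, t₃} hne (by
    intro y hy
    simp only [Finset.mem_insert, Finset.mem_singleton] at hy
    rcases hy with rfl | rfl | rfl
    · refine ⟨by tauto, Or.inr ⟨mem_bdry_single.2 h.n₁₃.symm, hlive _ H3.1.symm⟩, fun r hr => ?_⟩
      rw [mem_clos_single]
      have := h.nbr hr
      have := h.n₂₃.symm
      have := H2.2.2.1.symm
      grind
    · refine ⟨by tauto, Or.inr ⟨mem_bdry_single.2 h.n₂₃.symm, hlive _ H3.2.2.1.symm⟩,
        fun r hr => ?_⟩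
      rw [mem_clos_single]
      have := h.rot.nbr hr
      have := h.n₁₃.symm
      have := H1.2.2.1.symm
      grind
    · refine ⟨h23.ne', Or.inl (ho (by simp)), fun r hr => ?_⟩
      rw [mem_clos_single]
      have := ht₃ r hr
      have := h.n₁₃.symm
      have := h.n₂₃.symm
      have := H2.2.2.1.symm
      grind)
  rw [c3] at p2
  push_cast at p2
  refine ⟨insert t₂ {c₃}, (Grow.single c₃).add ht2, fun hs => ?_, ?_⟩
  · have hv1 : v ∈ clos G (insert t₂ {c₃}) := by rw [hs]; exact Finset.mem_univ v
    rw [mem_clos_insert ht2, mem_clos_single] at hv1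
    have := G.adj_comm v t₂
    grind
  · rw [Finset.card_empty, Nat.cast_zero] at p1
    linarith

/-- A larger connected set with at least the same potential, and more if it reaches all
vertices. -/
def Extends (G : SimpleGraph V) (D : Finset V) : Prop :=
  ∃ D', Grow G D' ∧ D.card < D'.card ∧ pot G D ≤ pot G D' ∧
    (clos G D' = Finset.univ → pot G D + 1 ≤ pot G D' ∧
      ((∀ v, 2 ≤ G.degree v) → pot G D + 2 ≤ pot G D' ∨ Gadget G))

lemma Improves.extends {D D₁ : Finset V} {k : ℤ} (h : Improves G D₁ k) (hc : D.card ≤ D₁.card)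
    (hp : pot G D + 2 - k ≤ pot G D₁) (hp' : pot G D - 1 ≤ pot G D₁) : Extends G D := by
  obtain ⟨D', h1, h2, h3, h4⟩ := h
  exact ⟨D', h1, by omega, by linarith, fun hs => ⟨by linarith [h4 hs],
    fun _ => Or.inl (by linarith [h4 hs])⟩⟩

lemma three_le_card {α : Type*} {S : Finset α} {a b c : α} (ha : a ∈ S) (hb : b ∈ S) (hc : c ∈ S)
    (hab : a ≠ b) (hac : a ≠ c) (hbc : b ≠ c) : 3 ≤ S.card := by
  rw [← Finset.card_eq_three.2 ⟨a, b, c, hab, hac, hbc, rfl⟩]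
  apply Finset.card_le_card
  intro r hr
  simp only [Finset.mem_insert, Finset.mem_singleton] at hr
  rcases hr with rfl | rfl | rfl <;> assumption

/-- The situation in which a clean step at `x` is followed by a sun containing another old
boundary vertex `y`. -/
lemma Clean.gadget {D₂ : Finset V} {x y a b v t₂ t₃ c₁ c₂ c₃ : V} (hc : Clean G D₂ x a b)
    (hs : Sun G (insert x D₂) y t₂ t₃ c₁ c₂ c₃) (hv : v ∈ D₂) (hy : y ∈ bdry G D₂)
    (hy2 : (outn G D₂ y).card = 2) : Gadget G := by
  have hx := hc.hp
  have hP := adj_of_pair hc.out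
  have hlive := hc.live
  have ha3l : a ∈ LeafyTree.live G (insert x D₂) := by rw [hlive]; simp
  have hb3l : b ∈ LeafyTree.live G (insert x D₂) := by rw [hlive]; simp
  have hya : y ≠ a := fun h => hP.2.1 (h ▸ bdry_sub hy)
  have hyb : y ≠ b := fun h => hP.2.2.2 (h ▸ bdry_sub hy)
  have hal := hs.live a ha3l
  have hbl := hs.live b hb3l
  have hab := hc.ne
  have hm : ∀ r, r ∈ clos G (insert x D₂) ↔ r ∈ clos G D₂ ∨ r = a ∨ r = b :=
    fun r => mem_clos_iff hx hc.out
  have E1 := adj_of_pair hs.o₁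
  have E2 := adj_of_pair hs.o₂
  have E3 := adj_of_pair hs.o₃
  have t2c : t₂ = a ∧ t₃ = b ∨ t₂ = b ∧ t₃ = a := by grind
  have t2n : t₂ ∉ clos G D₂ ∧ G.Adj x t₂ ∧ t₂ ≠ y := by grind
  have t3n : t₃ ∉ clos G D₂ ∧ G.Adj x t₃ ∧ t₃ ≠ y := by grind
  have hyo : ∀ t, t ∉ clos G D₂ → G.Adj y t → t = c₂ ∨ t = c₃ := by
    intro t ht hyt
    have hsub : ({c₂, c₃} : Finset V) ⊆ outn G D₂ y := by
      intro r hr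
      simp only [Finset.mem_insert, Finset.mem_singleton] at hr
      rw [mem_outn]
      have := hm r
      grind
    have := Finset.eq_of_subset_of_card_le hsub (by rw [Finset.card_pair hs.n₂₃.ne, hy2])
    have : t ∈ ({c₂, c₃} : Finset V) := by rw [this, mem_outn]; exact ⟨hyt, ht⟩
    simpa using this
  have pick : ∀ t u, (t = t₂ ∧ u = t₃ ∨ t = t₃ ∧ u = t₂) → ∀ r, r = a ∨ r = b →
      r = t ∨ r = u := by
    clear * - t2c
    grind
  have key : ∀ t u cc cd, (t = t₂ ∧ u = t₃ ∨ t = t₃ ∧ u = t₂) →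
      outn G (insert x D₂) t = {cc, cd} →
      ∀ r, G.Adj t r → r = x ∨ r = u ∨ r = cc ∨ r = cd := by
    intro t u cc cd htu ho r hr
    have htn : t ∉ clos G D₂ ∧ t ≠ y ∧ t ≠ c₂ ∧ t ≠ c₃ := by
      have h1 := fun h : t = c₂ => (hm c₂).not.1 E1.2.1 (by grind)
      have h2 := fun h : t = c₃ => (hm c₃).not.1 E1.2.2.2 (by grind)
      grind
    by_cases hrc : r ∈ clos G (insert x D₂)
    · rcases (hm r).1 hrc with h | h
      · left
        by_contra hrx
        have hrl : r ∈ LeafyTree.live G D₂ := mem_live.2 ⟨mem_bdry_of_adj h hr.symm htn.1,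
          Finset.ne_empty_of_mem (mem_outn.2 ⟨hr.symm, htn.1⟩)⟩
        have hrl' : r ∈ LeafyTree.live G (insert x D₂) := by
          rw [hlive, Finset.mem_union, Finset.mem_erase]; exact Or.inl ⟨hrx, hrl⟩
        rcases hs.live r hrl' with rfl | rfl | rfl
        · rcases hyo t htn.1 hr.symm with h | h
          · exact absurd h htn.2.2.1
          · exact absurd h htn.2.2.2
        · exact t2n.1 h
        · exact t3n.1 h
      · rcases pick t u htu r h with h | h
        · exact absurd h hr.ne'
        · exact Or.inr (Or.inl h)
    · right; right
      exact eq_of_pair ho hr hrc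
  have hd2 : 4 ≤ G.degree t₂ := by
    rcases t2c with ⟨rfl, -⟩ | ⟨rfl, -⟩
    · exact hc.ha
    · exact hc.hb
  have h23 : G.Adj t₂ t₃ := by
    obtain ⟨r, hr, hn⟩ := exists_adj_notMem (G := G) {x, c₁, c₃}
      (lt_of_le_of_lt Finset.card_le_three hd2)
    have := key t₂ t₃ _ _ (Or.inl ⟨rfl, rfl⟩) hs.o₂ r hr
    simp only [Finset.mem_insert, Finset.mem_singleton, not_or] at hn
    rcases this with h | h | h | h
    · tauto
    · exact h ▸ hr
    · tauto
    · tauto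
  exact hs.gadget h23 t2n.2.1.symm (Finset.mem_insert_self _ _)
    (key t₃ t₂ _ _ (Or.inr ⟨rfl, rfl⟩) hs.o₃) (Finset.mem_insert_of_mem hv)
    (fun h => t2n.1 (adj_mem_clos hv h))

/-- Given a triangle of vertices outside all the other closed neighbourhoods, one can continue. -/
lemma extends_of_pair {D D₂ : Finset V} (hD₂ : Grow G D₂) (hcard : D.card ≤ D₂.card)
    (hpot : pot G D - 1 ≤ pot G D₂) {v x y : V} (hv : v ∈ D₂) (hxy : x ≠ y)
    (hx : x ∈ bdry G D₂) (hy : y ∈ bdry G D₂)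
    (hold : ∀ t ∈ bdry G D₂, t ≠ x → t ≠ y → (outn G D₂ t).card ≤ 1)
    (hdx : 4 ≤ G.degree x) (hdy : 4 ≤ G.degree y)
    (hNx : ∀ r, G.Adj x r → r = v ∨ r = y ∨ r ∉ clos G D₂)
    (hNy : ∀ r, G.Adj y r → r = v ∨ r = x ∨ r ∉ clos G D₂) : Extends G D := by
  by_cases hx3 : 3 ≤ (outn G D₂ x).card
  · exact (improves_of_three hD₂ hx hx3).extends hcard (by linarith) hpot
  by_cases hy3 : 3 ≤ (outn G D₂ y).card
  · exact (improves_of_three hD₂ hy hy3).extends hcard (by linarith) hpot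
  have hNsub : ∀ x y, (∀ r, G.Adj x r → r = v ∨ r = y ∨ r ∉ clos G D₂) →
      G.neighborFinset x ⊆ insert v (insert y (outn G D₂ x)) := by
    intro x y h r hr
    rw [SimpleGraph.mem_neighborFinset] at hr
    have := h r hr
    simp only [Finset.mem_insert, mem_outn]; tauto
  have hxle := Finset.card_le_card (hNsub x y hNx)
  have hyle := Finset.card_le_card (hNsub y x hNy)
  rw [SimpleGraph.card_neighborFinset_eq_degree] at hxle hyle
  have e1 := Finset.card_insert_le v (insert y (outn G D₂ x))
  have e2 := Finset.card_insert_le y (outn G D₂ x)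
  have e3 := Finset.card_insert_le v (insert x (outn G D₂ y))
  have e4 := Finset.card_insert_le x (outn G D₂ y)
  have hx2 : 2 ≤ (outn G D₂ x).card := by omega
  have hy2 : (outn G D₂ y).card = 2 := by omega
  have hyl : y ∈ live G D₂ := mem_live.2 ⟨hy, by rintro h; simp [h] at hy2⟩
  have hxl : x ∈ live G D₂ := mem_live.2 ⟨hx, by rintro h; simp [h] at hx2⟩
  rcases clean_or hx hx2 with hg | ⟨a, b, hc⟩
  · have h2 : 2 ≤ (live G D₂).card := by
      rw [← Finset.card_pair hxy]
      apply Finset.card_le_card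
      intro r hr
      simp only [Finset.mem_insert, Finset.mem_singleton] at hr
      rcases hr with rfl | rfl <;> assumption
    exact (improves_of_gain hD₂ hx hx2 hg).extends hcard (by omega) hpot
  have hcd := card_insert_bdry hx
  by_cases hst : Stuck G (insert x D₂)
  · rcases exchange hD₂ hc hst with h | ⟨-, t₂, t₃, c₁, c₂, c₃, hs⟩
    · exact h.extends hcard (by linarith) hpot
    · exfalso
      have o₂ := hs.o₂
      have o₃ := hs.o₃
      have h2 : t₂ = x ∨ t₂ = y := by
        by_contra hcon
        push Not at hcon
        have := hold t₂ hs.b₂ hcon.1 hcon.2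
        rw [o₂, Finset.card_pair hs.n₁₃.ne] at this
        omega
      have h3 : t₃ = x ∨ t₃ = y := by
        by_contra hcon
        push Not at hcon
        have := hold t₃ hs.b₃ hcon.1 hcon.2
        rw [o₃, Finset.card_pair hs.n₁₂.ne] at this
        omega
      have E1 := adj_of_pair hs.o₁
      have E2 := adj_of_pair hs.o₂
      have E3 := adj_of_pair hs.o₃
      have := hs.n₁₂.ne
      have := hs.n₁₃.ne
      have := hs.n₂₃.ne
      have n12 : x ≠ t₂ := by rintro rfl; have := eq_of_pair o₂ E1.1 E1.2.1; tauto
      have n13 : x ≠ t₃ := by rintro rfl; have := eq_of_pair o₃ E1.2.2.1 E1.2.2.2; tauto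
      have n23 : t₂ ≠ t₃ := by
        rintro rfl; have := eq_of_pair o₃ E2.2.2.1 E2.2.2.2; tauto
      grind
  obtain ⟨q, hq, hq2⟩ := Stuck.exists_of_not hst
  have hP := adj_of_pair hc.out
  have hlive := hc.live
  have hy3l : y ∈ live G (insert x D₂) := by
    rw [hlive, Finset.mem_union, Finset.mem_erase]; exact Or.inl ⟨hxy.symm, hyl⟩
  have ha3l : a ∈ live G (insert x D₂) := by rw [hlive]; simp
  have hb3l : b ∈ live G (insert x D₂) := by rw [hlive]; simp
  have hya : y ≠ a := fun h => hP.2.1 (h ▸ bdry_sub hy)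
  have hyb : y ≠ b := fun h => hP.2.2.2 (h ▸ bdry_sub hy)
  have hl3 := three_le_card hy3l ha3l hb3l hya hyb hc.ne
  rcases improves_or_exists_sun (hD₂.add hx) hq hq2 hl3 with h | ⟨h, hS⟩
  · exact h.extends (by omega) (by linarith [hc.le]) (by linarith [hc.le])
  have hS' : ∃ t₂ t₃ c₁ c₂ c₃, Sun G (insert x D₂) y t₂ t₃ c₁ c₂ c₃ := by
    obtain ⟨t₁, t₂, t₃, c₁, c₂, c₃, hs⟩ := hS
    rcases hs.live y hy3l with rfl | rfl | rfl
    · exact ⟨_, _, _, _, _, hs⟩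
    · exact ⟨_, _, _, _, _, hs.rot⟩
    · exact ⟨_, _, _, _, _, hs.rot.rot⟩
  obtain ⟨t₂, t₃, c₁, c₂, c₃, hs⟩ := hS'
  obtain ⟨D', h1, h2, h3, h4⟩ := h
  refine ⟨D', h1, by omega, by linarith [hc.le], fun hu => ⟨by linarith [hc.le, h4 hu],
    fun _ => Or.inr ?_⟩⟩
  exact hc.gadget hs hv hy hy2

lemma exists_adj_of_ne_univ (hG : G.Connected) {D : Finset V} (hD : D.Nonempty)
    (hs : clos G D ≠ Finset.univ) : ∃ u ∈ clos G D, ∃ v, v ∉ clos G D ∧ G.Adj u v := by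
  obtain ⟨a, ha⟩ := hD
  obtain ⟨b, hb⟩ : ∃ b, b ∉ clos G D := by
    by_contra h
    push Not at h
    exact hs (Finset.eq_univ_of_forall h)
  obtain ⟨p⟩ := hG.preconnected a b
  obtain ⟨d, -, h1, h2⟩ := p.exists_boundary_dart (clos G D : Set V)
    (by simpa using sub_clos ha) (by simpa using hb)
  exact ⟨d.fst, by simpa using h1, d.snd, by simpa using h2, d.adj⟩

lemma exists_stuck_debt_gain {D₁ : Finset V} {v x y : V} (hv : v ∈ bdry G D₁)
    (hxy : x ≠ y) (ho : outn G D₁ v = {x, y}) (hs : clos G (insert v D₁) = Finset.univ) :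
    pot G D₁ + 3 ≤ pot G (insert v D₁) := by
  have hne : outn G D₁ v ≠ ∅ := by simp [ho]
  have H := adj_of_pair ho
  by_cases hd : 4 ≤ G.degree x
  · obtain ⟨t, hxt, htn⟩ := exists_adj_notMem (G := G) (v := x) {v, y}
      (lt_of_le_of_lt Finset.card_le_two (by omega))
    simp only [Finset.mem_insert, Finset.mem_singleton, not_or] at htn
    have htc : t ∈ clos G D₁ := by
      have : t ∈ clos G (insert v D₁) := by rw [hs]; exact Finset.mem_univ t
      rw [mem_clos_iff hv ho] at this
      have := hxt.ne'
      tauto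
    have := pot_insert_spanning hv hne hs {t} (by
      intro q hq
      rw [Finset.mem_singleton.1 hq]
      exact ⟨htn.1, mem_bdry_of_adj htc hxt.symm H.2.1,
        Finset.ne_empty_of_mem (mem_outn.2 ⟨hxt.symm, H.2.1⟩)⟩)
    rw [ho, Finset.card_pair hxy, Finset.card_singleton] at this
    push_cast at this
    linarith
  · have hall : ∀ r, r ∈ clos G (insert v D₁) := fun r => by rw [hs]; exact Finset.mem_univ r
    have := pot_insert hv {x, y} hne (by
      intro q hq
      rw [← ho] at hq
      refine ⟨by rw [mem_bdry_insert hv]; tauto, ?_, Or.inl hq⟩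
      ext r
      rw [mem_outn]
      have := hall r
      simp; tauto)
    rw [ho, Finset.card_pair hxy, Finset.sum_pair hxy] at this
    push_cast at this
    have h1 : wt G x ≤ 1 := by unfold wt; split_ifs <;> norm_num
    have h2 := wt_le (G := G) y
    linarith

set_option maxHeartbeats 400000 in
/-- In a connected graph every set which does not reach all vertices can be extended. -/
theorem extends_of_ne_univ (hG : G.Connected) {D : Finset V} (hD : Grow G D)
    (hs : clos G D ≠ Finset.univ) : Extends G D := by
  by_cases hst : Stuck G D
  swap
  · obtain ⟨y, hy, hy2⟩ := Stuck.exists_of_not hst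
    exact (improves hD hy hy2).1.extends le_rfl (by linarith) (by linarith)
  obtain ⟨u, huc, v, hv, huv⟩ := exists_adj_of_ne_univ hG hD.nonempty hs
  have hout : ∀ t ∈ clos G D, G.Adj v t → t ∈ bdry G D ∧ outn G D t = {v} := by
    intro t ht hvt
    refine ⟨mem_bdry_of_adj ht hvt.symm hv, ?_⟩
    ext r
    rw [mem_outn, Finset.mem_singleton]
    constructor
    · rintro ⟨h1, h2⟩
      exact hst.eq ht h1 h2 hvt.symm hv
    · rintro rfl
      exact ⟨hvt.symm, hv⟩
  obtain ⟨hu, huo⟩ := hout u huc huv.symm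
  set J := (G.neighborFinset v).filter (· ∈ clos G D) with hJ
  set O := (G.neighborFinset v).filter (· ∉ clos G D) with hO
  have hmJ : ∀ r, r ∈ J ↔ G.Adj v r ∧ r ∈ clos G D := fun r => by simp [hJ]
  have hmO : ∀ r, r ∈ O ↔ G.Adj v r ∧ r ∉ clos G D := fun r => by simp [hO]
  have hJO : J.card + O.card = G.degree v := by
    rw [← SimpleGraph.card_neighborFinset_eq_degree]
    exact Finset.card_filter_add_card_filter_not _
  have huJ : u ∈ J := (hmJ u).2 ⟨huv.symm, huc⟩
  have hj1 : 1 ≤ J.card := Finset.card_pos.2 ⟨u, huJ⟩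
  have hune : outn G D u ≠ ∅ := by simp [huo]
  have hJY : ∀ y ∈ J.erase u, y ∈ bdry G (insert u D) ∧ outn G (insert u D) y = ∅ ∧
      (y ∈ outn G D u ∨ outn G D y ≠ ∅) := by
    intro y hy
    rw [Finset.mem_erase, hmJ] at hy
    obtain ⟨h1, h2⟩ := hout y hy.2.2 hy.2.1
    refine ⟨by rw [mem_bdry_insert hu]; exact Or.inl ⟨h1, hy.1⟩, ?_, Or.inr (by simp [h2])⟩
    ext r
    rw [mem_outn_insert hu]
    have : r ∈ outn G D y ↔ r = v := by simp [h2]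
    rw [mem_outn] at this
    simp only [Finset.notMem_empty, iff_false]
    rintro ⟨h3, h4, h5⟩
    exact h5 ((this.1 ⟨h3, h4⟩) ▸ huv)
  have hJc : ((J.erase u).card : ℤ) = J.card - 1 := by
    rw [Finset.card_erase_of_mem huJ]; push_cast [Nat.cast_sub hj1]; ring
  have g1 := pot_insert hu (J.erase u) hune hJY
  rw [huo, Finset.sum_singleton, hJc] at g1
  have hc1 := card_insert_bdry hu
  have hg1 := hD.add hu
  have hvo : v ∈ outn G D u := by simp [huo]
  have hv1 : v ∈ bdry G (insert u D) := by rw [mem_bdry_insert hu]; exact Or.inr hvo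
  by_cases hOe : O = ∅
  · have g2 := pot_insert hu (insert v (J.erase u)) hune (by
      intro y hy
      rcases Finset.mem_insert.1 hy with rfl | hy
      · refine ⟨hv1, ?_, Or.inl hvo⟩
        ext r
        rw [mem_outn_insert hu]
        have : r ∉ O := by simp [hOe]
        rw [hmO] at this
        simp; tauto
      · exact hJY y hy)
    rw [Finset.card_insert_of_notMem (by simp [hmJ])] at g2
    rw [huo, Finset.sum_singleton] at g2
    push_cast at g2
    rw [hJc] at g2
    rw [hOe, Finset.card_empty, add_zero] at hJO
    have hd : wt G v + 1 ≤ G.degree v ∧ (2 ≤ G.degree v → wt G v + 2 ≤ G.degree v) := by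
      unfold wt; split_ifs <;> omega
    refine ⟨insert u D, hg1, by omega, ?_, fun _ => ⟨?_, fun h2 => Or.inl ?_⟩⟩
    · have := hd.1; omega
    · have := hd.1; omega
    · have := hd.2 (h2 v); omega
  obtain ⟨w, hw⟩ := Finset.nonempty_iff_ne_empty.2 hOe
  rw [hmO] at hw
  have hu1 : ∀ r, r ∉ clos G D → G.Adj u r → r = v := fun r h1 h2 => by
    have : r ∈ outn G D u := mem_outn.2 ⟨h2, h1⟩
    simpa [huo] using this
  have hns : clos G (insert u D) ≠ Finset.univ := by
    intro h
    have : w ∈ clos G (insert u D) := by rw [h]; exact Finset.mem_univ w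
    rw [mem_clos_insert hu] at this
    have := hu1 w hw.2
    have := hw.1.ne'
    tauto
  by_cases hjw : wt G v + 1 ≤ J.card
  · exact ⟨insert u D, hg1, by omega, by linarith, fun h => absurd h hns⟩
  have hvO : outn G (insert u D) v = O := by
    ext r
    rw [mem_outn_insert hu, hmO]
    constructor
    · tauto
    · rintro ⟨h1, h2⟩
      exact ⟨h1, h2, fun h3 => h1.ne' (hu1 r h2 h3)⟩
  have hne1 : outn G (insert u D) v ≠ ∅ := by rw [hvO]; exact hOe
  have hc2 := card_insert_bdry hv1
  have hwv := wt_le (G := G) v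
  have hcase : 3 ≤ O.card ∨ (O.card = 2 ∧ wt G v ≤ J.card) := by
    revert hjw
    unfold wt; split_ifs <;> omega
  rcases hcase with h3 | ⟨h2, hwJ⟩
  · have h3' : (3 : ℤ) ≤ (outn G (insert u D) v).card := by rw [hvO]; exact_mod_cast h3
    have hj1' : (1 : ℤ) ≤ J.card := by exact_mod_cast hj1
    refine ⟨insert v (insert u D), hg1.add hv1, by omega, ?_, fun hs2 => ?_⟩
    · have := pot_insert_le hv1 ∅ hne1 (by simp)
      rw [Finset.card_empty] at this
      push_cast at this; linarith
    · have := pot_insert_spanning hv1 hne1 hs2 ∅ (by simp)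
      rw [Finset.card_empty] at this
      push_cast at this
      exact ⟨by linarith, fun _ => Or.inl (by linarith)⟩
  have hpot : pot G D - 1 ≤ pot G (insert u D) := by linarith
  rcases clean_or hv1 (by rw [hvO, h2]) with hg | ⟨x, y, hc⟩
  · obtain ⟨x, y, hxy, hOxy⟩ := Finset.card_eq_two.1 h2
    refine ⟨insert v (insert u D), hg1.add hv1, by omega, by linarith, fun hs2 => ?_⟩
    have := exists_stuck_debt_gain hv1 hxy (hvO.trans hOxy) hs2
    exact ⟨by linarith, fun _ => Or.inl (by linarith)⟩
  have H := adj_of_pair hc.out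
  have hm1 : ∀ r, r ∈ clos G (insert u D) ↔ r ∈ clos G D ∨ r = v := fun r => by
    rw [clos_insert hu, huo, Finset.mem_union, Finset.mem_singleton]
  have hm2 : ∀ r, r ∈ clos G (insert v (insert u D)) ↔ r ∈ clos G (insert u D) ∨ r = x ∨ r = y :=
    fun r => mem_clos_iff hv1 hc.out
  have hstuck2 : ∀ t ∈ bdry G D, ∀ r s, G.Adj t r → r ∉ clos G D → G.Adj t s → s ∉ clos G D →
      r = s := fun t ht r s h1 h2 h3 h4 => hst.eq (bdry_sub ht) h1 h2 h3 h4
  have hN : ∀ x y, outn G (insert u D) v = {x, y} → x ∉ clos G (insert u D) →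
      ∀ r, G.Adj x r → r = v ∨ r = y ∨ r ∉ clos G (insert v (insert u D)) := by
    intro x y hxy hx r hr
    by_contra hcon
    push Not at hcon
    obtain ⟨h1, h2, h3⟩ := hcon
    rw [mem_clos_iff hv1 hxy, hm1] at h3
    have hrD : r ∈ clos G D := by
      rcases h3 with (h | h) | h | h
      · exact h
      · exact absurd h h1
      · exact absurd h hr.ne'
      · exact absurd h h2
    have hxD : x ∉ clos G D := fun h => hx ((hm1 x).2 (Or.inl h))
    have hrb : r ∈ bdry G D := mem_bdry_of_adj hrD hr.symm hxD
    have hru : r ≠ u := by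
      rintro rfl
      exact hx ((hm1 x).2 (Or.inr (hu1 x hxD hr.symm)))
    have hrb1 : r ∈ bdry G (insert u D) := by
      rw [mem_bdry_insert hu]; exact Or.inl ⟨hrb, hru⟩
    have := hc.alive r (by rw [mem_bdry_insert hv1]; exact Or.inl ⟨hrb1, h1⟩)
      (Or.inr (Finset.ne_empty_of_mem (mem_outn.2 ⟨hr.symm, hx⟩)))
    obtain ⟨s, hs'⟩ := Finset.nonempty_iff_ne_empty.2 this
    rw [mem_outn, mem_clos_iff hv1 hxy, hm1] at hs'
    have := hstuck2 r hrb s x hs'.1 (fun h => hs'.2 (Or.inl (Or.inl h))) hr.symm hxD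
    exact hs'.2 (Or.inr (Or.inl this))
  refine extends_of_pair (hg1.add hv1) (by omega) (by linarith [hc.le])
    (Finset.mem_insert_self _ _) hc.ne ?_ ?_ ?_ hc.ha hc.hb ?_ ?_
  · rw [mem_bdry_insert hv1, hc.out]; simp
  · rw [mem_bdry_insert hv1, hc.out]; simp
  · intro t ht htx hty
    rw [mem_bdry_insert hv1, hc.out, mem_bdry_insert hu, huo] at ht
    have htb : t ∈ bdry G D := by
      simp only [Finset.mem_insert, Finset.mem_singleton] at ht
      rcases ht with ⟨h | h, h'⟩ | h | h
      · exact h.1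
      · exact absurd h h'
      · exact absurd h htx
      · exact absurd h hty
    refine le_trans (Finset.card_le_card ?_) (hst t htb)
    intro r hr
    rw [mem_outn] at hr ⊢
    exact ⟨hr.1, fun h => hr.2 ((hm2 r).2 (Or.inl ((hm1 r).2 (Or.inl h))))⟩
  · exact hN x y hc.out H.2.1
  · exact hN y x hc.symm.out H.2.2.2

/-- A connected graph without a connected dominating set of potential at least 10. -/
structure Bad (G : SimpleGraph V) : Prop where
  conn : G.Connected
  le : ∀ D, Grow G D → clos G D = Finset.univ → pot G D ≤ 9

lemma Bad.lt_nine (h : Bad G) {D : Finset V} (hD : Grow G D) (hs : clos G D ≠ Finset.univ) :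
    pot G D < 9 := by
  by_contra hp
  push Not at hp
  induction hn : Fintype.card V - D.card using Nat.strong_induction_on generalizing D with
  | _ n ih =>
    obtain ⟨D', h1, h2, h3, h4⟩ := extends_of_ne_univ h.conn hD hs
    have hle : D'.card ≤ Fintype.card V := Finset.card_le_univ _
    by_cases hs' : clos G D' = Finset.univ
    · have := h.le D' h1 hs'
      linarith [(h4 hs').1]
    · exact ih _ (by omega) h1 hs' (by linarith) rfl

lemma Bad.false_of_nine (h : Bad G) {D : Finset V} (hD : Grow G D) (h9 : 9 ≤ pot G D)
    (hs : clos G D = Finset.univ → 10 ≤ pot G D) : False := by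
  by_cases hc : clos G D = Finset.univ
  · linarith [h.le D hD hc, hs hc]
  · linarith [h.lt_nine hD hc]

lemma Bad.false_of_eight (h : Bad G) {D : Finset V} (hD : Grow G D) (h8 : 8 ≤ pot G D) {p : V}
    (hp : p ∈ bdry G D) (h2 : 2 ≤ (outn G D p).card) : False := by
  obtain ⟨D', h1, -, h3, h4⟩ := (improves hD hp h2).1
  exact h.false_of_nine h1 (by linarith) (fun hs => by linarith [h4 hs])

lemma mem_of_closed {W : Type*} {G : SimpleGraph W} (hG : G.Connected) {S : Set W} {a : W}
    (ha : a ∈ S) (h : ∀ x ∈ S, ∀ y, G.Adj x y → y ∈ S) (v : W) : v ∈ S := by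
  by_contra hv
  obtain ⟨p⟩ := hG.preconnected a v
  obtain ⟨d, -, h1, h2⟩ := p.exists_boundary_dart S ha hv
  exact h2 (h _ h1 _ d.adj)

lemma pot_single_of_spanning {v : V} (h : clos G {v} = Finset.univ) :
    5 * (G.degree v : ℤ) - wt G v - ∑ r ∈ G.neighborFinset v, wt G r ≤ pot G {v} := by
  have := pot_single v (G.neighborFinset v) (by
    intro y hy
    refine ⟨(SimpleGraph.mem_neighborFinset _ _ _).1 hy, fun r _ => ?_⟩
    rw [← mem_clos_single, h]; exact Finset.mem_univ r)
  rw [SimpleGraph.card_neighborFinset_eq_degree] at this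
  linarith

/-- In a bad graph with at least three vertices all degrees are at least 2. -/
lemma Bad.two_le_degree (h : Bad G) (hV : 3 ≤ Fintype.card V) (l : V) : 2 ≤ G.degree l := by
  by_contra hl
  obtain ⟨u, hlu⟩ : ∃ u, G.Adj l u := by
    by_contra hcon
    push Not at hcon
    have : ∀ v, v ∈ ({l} : Set V) := mem_of_closed h.conn rfl (by
      intro x hx y hxy
      rw [Set.mem_singleton_iff.1 hx] at hxy
      exact absurd hxy (hcon y))
    have h1 : (Finset.univ : Finset V) ⊆ {l} := fun v _ => by simpa using this v
    have := Finset.card_le_card h1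
    rw [Finset.card_univ, Finset.card_singleton] at this
    omega
  have hlN : ∀ r, G.Adj l r → r = u := by
    intro r hr
    have h1 : (G.neighborFinset l).card ≤ 1 := by
      rw [SimpleGraph.card_neighborFinset_eq_degree]; omega
    exact Finset.card_le_one.1 h1 r (by simpa) u (by simpa)
  have hwl : wt G l = 0 := by unfold wt; split_ifs <;> omega
  have hsum : ∑ r ∈ G.neighborFinset u, wt G r
      = ∑ r ∈ (G.neighborFinset u).erase l, wt G r := by
    rw [← Finset.add_sum_erase _ _ (show l ∈ G.neighborFinset u by simpa using hlu.symm), hwl,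
      zero_add]
  have hcard : ((G.neighborFinset u).erase l).card + 1 = G.degree u := by
    rw [Finset.card_erase_of_mem (by simpa using hlu.symm),
      SimpleGraph.card_neighborFinset_eq_degree]
    have := (G.degree_pos_iff_exists_adj (v := u)).2 ⟨l, hlu.symm⟩
    omega
  have hg := Grow.single (G := G) u
  have p1 := pot_single u {l} (by
    intro y hy
    rw [Finset.mem_singleton.1 hy]
    exact ⟨hlu.symm, fun r hr => Or.inl (hlN r hr)⟩)
  have p2 := pot_single_of_spanning (G := G) (v := u)
  rw [hsum] at p1 p2
  rw [Finset.card_singleton] at p1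
  have hmem : ∀ q, q ∈ (G.neighborFinset u).erase l ↔ q ≠ l ∧ G.Adj u q := by simp
  have hub : ∑ r ∈ (G.neighborFinset u).erase l, wt G r
      ≤ 2 * ((G.neighborFinset u).erase l).card := by
    rw [mul_comm, ← nsmul_eq_mul]
    exact Finset.sum_le_card_nsmul _ _ _ fun r _ => wt_le r
  have hwu := wt_le (G := G) u
  by_cases h4 : 4 ≤ G.degree u
  · exact h.false_of_nine hg (by omega) (fun hs => by have := p2 hs; omega)
  by_cases h3 : G.degree u = 3
  · have hwu : wt G u = 1 := by simp [wt, h3]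
    have p10 : clos G {u} = Finset.univ → 10 ≤ pot G {u} := fun hs => by
      have := p2 hs; omega
    have p8 : 8 ≤ pot G {u} := by omega
    obtain ⟨q, r, hqr, hqr'⟩ := Finset.card_eq_two.1 (show ((G.neighborFinset u).erase l).card = 2
      by omega)
    have hq := (hmem q).1 (by simp [hqr'])
    by_cases h2 : 2 ≤ (outn G {u} q).card
    · exact h.false_of_eight hg p8 (mem_bdry_single.2 hq.2) h2
    have hdq : G.degree q ≤ 3 := by
      rw [← SimpleGraph.card_neighborFinset_eq_degree]
      have : G.neighborFinset q ⊆ insert u (insert r (outn G {u} q)) := by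
        intro s hs
        rw [SimpleGraph.mem_neighborFinset] at hs
        simp only [Finset.mem_insert, mem_outn, mem_clos_single]
        by_cases hus : G.Adj u s
        · have hsl : s ≠ l := by
            rintro rfl
            exact hq.2.ne' (hlN q hs.symm)
          have h1 := (hmem s).2 ⟨hsl, hus⟩
          rw [hqr'] at h1
          simp only [Finset.mem_insert, Finset.mem_singleton] at h1
          have := hs.ne'
          tauto
        · tauto
      have := Finset.card_le_card this
      have e1 := Finset.card_insert_le u (insert r (outn G {u} q))
      have e2 := Finset.card_insert_le r (outn G {u} q)
      omega
    have hwq : wt G q ≤ 1 := by unfold wt; split_ifs <;> omega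
    have hwr := wt_le (G := G) r
    rw [hqr', Finset.sum_pair hqr] at p1
    exact h.false_of_nine hg (by omega) p10
  by_cases h2 : G.degree u = 2
  · have hwu : wt G u = 0 := by simp [wt, h2]
    obtain ⟨q, hq⟩ := Finset.card_eq_one.1 (show ((G.neighborFinset u).erase l).card = 1
      by omega)
    have hql := (hmem q).1 (by simp [hq])
    have hun : ∀ s, G.Adj u s → s = l ∨ s = q := fun s hs => by
      by_contra hcon
      push Not at hcon
      have := (hmem s).2 ⟨hcon.1, hs⟩
      rw [hq, Finset.mem_singleton] at this
      exact hcon.2 this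
    have hql' : ¬ G.Adj q l := fun hh => hql.2.ne' (hlN q hh.symm)
    rw [hq, Finset.sum_singleton] at p1 p2
    have p10 : clos G {u} = Finset.univ → 10 ≤ pot G {u} := fun hs => by
      have := p2 hs
      have hdq : G.degree q ≤ 1 := by
        rw [← SimpleGraph.card_neighborFinset_eq_degree, ← Finset.card_singleton u]
        apply Finset.card_le_card
        intro s hs'
        rw [SimpleGraph.mem_neighborFinset] at hs'
        have : s ∈ clos G {u} := by rw [hs]; exact Finset.mem_univ s
        rw [mem_clos_single] at this
        have := hun s
        have := hs'.ne'
        rw [Finset.mem_singleton]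
        grind
      have : wt G q = 0 := by unfold wt; split_ifs <;> omega
      omega
    have hout : G.degree q ≤ (outn G {u} q).card + 1 := by
      rw [← SimpleGraph.card_neighborFinset_eq_degree]
      have : G.neighborFinset q ⊆ insert u (outn G {u} q) := by
        intro s hs
        rw [SimpleGraph.mem_neighborFinset] at hs
        simp only [Finset.mem_insert, mem_outn, mem_clos_single]
        have := hun s
        have := hs.ne'
        grind
      exact (Finset.card_le_card this).trans (Finset.card_insert_le _ _)
    have hqb := mem_bdry_single.2 hql.2
    by_cases h5 : 4 ≤ G.degree q
    · have hne : outn G {u} q ≠ ∅ := by rintro h0; rw [h0, Finset.card_empty] at hout; omega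
      have g1 := pot_insert_le hqb ∅ hne (by simp)
      have g2 := fun hs => pot_insert_spanning hqb hne hs ∅ (by simp)
      rw [Finset.card_empty] at g1 g2
      have hwq := wt_le (G := G) q
      exact h.false_of_nine (hg.add hqb) (by omega) (fun hs => by have := g2 hs; omega)
    by_cases h6 : G.degree q = 3
    · have : wt G q = 1 := by simp [wt, h6]
      exact h.false_of_eight hg (by omega) hqb (by omega)
    · have : wt G q = 0 := by simp [wt, h5, h6]
      exact h.false_of_nine hg (by omega) p10
  · have hu1 : ∀ r, G.Adj u r → r = l := by
      intro r hr
      have h1 : (G.neighborFinset u).card ≤ 1 := by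
        rw [SimpleGraph.card_neighborFinset_eq_degree]; omega
      exact Finset.card_le_one.1 h1 r (by simpa) l (by simpa using hlu.symm)
    have : ∀ v, v ∈ ({l, u} : Set V) := mem_of_closed h.conn (Set.mem_insert _ _) (by
      rintro x (rfl | rfl) y hxy
      · exact Or.inr (hlN y hxy)
      · exact Or.inl (hu1 y hxy))
    have h1 : (Finset.univ : Finset V) ⊆ {l, u} := fun v _ => by simpa using this v
    have := Finset.card_le_card h1
    have h5 := Finset.card_le_two (a := l) (b := u)
    rw [Finset.card_univ] at this
    omega

lemma Bad.false_of_out (h : Bad G) (hd : ∀ v, 2 ≤ G.degree v) {D : Finset V} (hD : Grow G D)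
    (h8 : 8 ≤ pot G D) (hs : clos G D = Finset.univ → 10 ≤ pot G D) : False := by
  induction hn : Fintype.card V - D.card using Nat.strong_induction_on generalizing D with
  | _ n ih =>
    by_cases hc : clos G D = Finset.univ
    · linarith [h.le D hD hc, hs hc]
    obtain ⟨D', h1, h2, h3, h4⟩ := extends_of_ne_univ h.conn hD hc
    have hle : D'.card ≤ Fintype.card V := Finset.card_le_univ _
    refine ih _ (by omega) h1 (by linarith) (fun hs' => ?_) rfl
    rcases (h4 hs').2 hd with h5 | ⟨E, hE, hE', hE9⟩
    · linarith
    · exact absurd (h.lt_nine hE hE') (by linarith)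

lemma Bad.false_of_seven (h : Bad G) (hd : ∀ v, 2 ≤ G.degree v) {D : Finset V} (hD : Grow G D)
    (h7 : 7 ≤ pot G D) (h4 : 4 ≤ (live G D).card) {p : V}
    (hp : p ∈ bdry G D) (h2 : 2 ≤ (outn G D p).card) : False := by
  obtain ⟨D', h1, -, h3, h5⟩ := (improves hD hp h2).2 h4
  exact h.false_of_out hd h1 (by linarith) (fun hs => by linarith [h5 hs])

lemma ten_le_of_spanning (hd : ∀ v, 2 ≤ G.degree v) {v : V} (h : clos G {v} = Finset.univ) :
    10 ≤ pot G {v} := by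
  have hle : ∀ w, G.degree w ≤ G.degree v := by
    intro w
    have h1 : (clos G {v}).card = G.degree v + 1 := by
      rw [clos_single, Finset.card_insert_of_notMem (by simp),
        SimpleGraph.card_neighborFinset_eq_degree]
    rw [h, Finset.card_univ] at h1
    have := G.degree_lt_card_verts w
    omega
  have hw : ∀ w ∈ G.neighborFinset v, wt G w ≤ wt G v := by
    intro w _
    have := hle w
    unfold wt
    split_ifs <;> omega
  have h1 : ∑ r ∈ G.neighborFinset v, wt G r ≤ (G.neighborFinset v).card • wt G v :=
    Finset.sum_le_card_nsmul _ _ _ hw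
  rw [SimpleGraph.card_neighborFinset_eq_degree, nsmul_eq_mul] at h1
  have h2 := pot_single_of_spanning h
  have h3 := hd v
  by_cases h4 : 4 ≤ G.degree v
  · have : wt G v = 2 := wt_eq_two.2 h4
    rw [this] at h1 h2
    omega
  by_cases h5 : G.degree v = 3
  · have : wt G v = 1 := by simp [wt, h5]
    rw [this] at h1 h2
    omega
  · have : wt G v = 0 := by simp [wt, h4, h5]
    rw [this] at h1 h2
    omega

lemma Bad.pot_single_lt (h : Bad G) (hd : ∀ v, 2 ≤ G.degree v) (v : V) : pot G {v} < 8 := by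
  by_contra hcon
  push Not at hcon
  exact h.false_of_out hd (Grow.single v) hcon fun hs => ten_le_of_spanning hd hs

/-- The adjacency indicator. -/
noncomputable def ind {W : Type*} (G : SimpleGraph W) (x y : W) : ℕ := if G.Adj x y then 1 else 0

lemma ind_comm {W : Type*} {G : SimpleGraph W} (x y : W) : ind G x y = ind G y x := by
  simp [ind, G.adj_comm]

lemma degree_eq_of_star {v a b c d : V} (hN : G.neighborFinset v = {a, b, c, d})
    (hbc : b ≠ c) (hbd : b ≠ d) (hcd : c ≠ d) :
    G.degree a = 1 + (ind G a b + ind G a c + ind G a d) + (outn G {v} a).card := by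
  have hmem : ∀ r, G.Adj v r ↔ r = a ∨ r = b ∨ r = c ∨ r = d := by
    intro r
    rw [← SimpleGraph.mem_neighborFinset, hN]; simp
  have hva := (hmem a).2 (Or.inl rfl)
  have hvb := (hmem b).2 (by tauto)
  have hvc := (hmem c).2 (by tauto)
  have hvd := (hmem d).2 (by tauto)
  have hsplit : G.neighborFinset a = insert v
      ((({b, c, d} : Finset V).filter (G.Adj a ·)) ∪ outn G {v} a) := by
    ext r
    have := hmem r
    have := G.irrefl (v := a)
    simp only [SimpleGraph.mem_neighborFinset, Finset.mem_insert, Finset.mem_union,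
      Finset.mem_filter, Finset.mem_singleton, mem_outn, mem_clos_single]
    have := hva.symm
    grind
  have hcount : (({b, c, d} : Finset V).filter (G.Adj a ·)).card
      = ind G a b + ind G a c + ind G a d := by
    rw [Finset.card_filter, Finset.sum_insert (by simp [hbc, hbd]), Finset.sum_pair hcd]
    simp only [ind, add_assoc]
  rw [← SimpleGraph.card_neighborFinset_eq_degree, hsplit, Finset.card_insert_of_notMem,
    Finset.card_union_of_disjoint, hcount]
  · ring
  · rw [Finset.disjoint_left]
    intro r h1 h2
    rw [mem_outn, mem_clos_single] at h2
    simp only [Finset.mem_filter, Finset.mem_insert, Finset.mem_singleton] at h1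
    have := (hmem r).2 (by tauto)
    tauto
  · simp only [Finset.mem_union, Finset.mem_filter, Finset.mem_insert, Finset.mem_singleton,
      mem_outn, mem_clos_single]
    have := hvb.ne
    have := hvc.ne
    have := hvd.ne
    tauto

lemma even_degree_sum_of_star {v a b c d : V} (hN : G.neighborFinset v = {a, b, c, d})
    (hab : a ≠ b) (hac : a ≠ c) (had : a ≠ d) (hbc : b ≠ c) (hbd : b ≠ d) (hcd : c ≠ d)
    (hone : ∀ r, G.Adj v r → (outn G {v} r).card = 1) :
    Even (G.degree a + G.degree b + G.degree c + G.degree d) := by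
  have hmem : ∀ r, G.Adj v r ↔ r = a ∨ r = b ∨ r = c ∨ r = d := by
    intro r
    rw [← SimpleGraph.mem_neighborFinset, hN]; simp
  have d1 := degree_eq_of_star hN hbc hbd hcd
  have d2 := degree_eq_of_star (a := b) (b := a) (c := c) (d := d)
    (hN.trans (by ext; simp; tauto)) hac had hcd
  have d3 := degree_eq_of_star (a := c) (b := a) (c := b) (d := d)
    (hN.trans (by ext; simp; tauto)) hab had hbd
  have d4 := degree_eq_of_star (a := d) (b := a) (c := b) (d := c)
    (hN.trans (by ext; simp; tauto)) hab hac hbc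
  rw [hone a ((hmem a).2 (by simp))] at d1
  rw [hone b ((hmem b).2 (by simp)), ind_comm b a] at d2
  rw [hone c ((hmem c).2 (by simp)), ind_comm c a, ind_comm c b] at d3
  rw [hone d ((hmem d).2 (by simp)), ind_comm d a, ind_comm d b, ind_comm d c] at d4
  refine ⟨4 + ind G a b + ind G a c + ind G a d + ind G b c + ind G b d + ind G c d, ?_⟩
  omega

/-- A bad graph with at least three vertices is 4-regular. -/
lemma Bad.degree_eq_four (h : Bad G) (hV : 3 ≤ Fintype.card V) (w : V) : G.degree w = 4 := by
  have hd := h.two_le_degree hV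
  have hle : ∀ v, G.degree v ≤ 4 := by
    intro v
    by_contra hcon
    have h1 := h.pot_single_lt hd v
    have h2 := pot_single_ge (G := G) v ∅ (by simp)
    rw [Finset.card_empty] at h2
    omega
  have hclosed : ∀ v, G.degree v = 4 → ∀ q, G.Adj v q → G.degree q = 4 := by
    intro v hv q hvq
    by_contra hq
    have hq3 : G.degree q ≤ 3 := by have := hle q; omega
    have hcard : (G.neighborFinset v).card = 4 := by
      rw [SimpleGraph.card_neighborFinset_eq_degree, hv]
    have hqN : q ∈ G.neighborFinset v := by simpa using hvq
    obtain ⟨b, c, d, hbc, hbd, hcd, hbcd⟩ := Finset.card_eq_three.1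
      (show ((G.neighborFinset v).erase q).card = 3 by
        rw [Finset.card_erase_of_mem hqN, hcard])
    have hqb : q ≠ b ∧ q ≠ c ∧ q ≠ d := by
      have : q ∉ (G.neighborFinset v).erase q := by simp
      rw [hbcd] at this
      simpa using this
    have hN : G.neighborFinset v = {q, b, c, d} := by
      rw [← Finset.insert_erase hqN, hbcd]
    have hmem : ∀ r, G.Adj v r ↔ r = q ∨ r = b ∨ r = c ∨ r = d := by
      intro r
      rw [← SimpleGraph.mem_neighborFinset, hN]; simp
    have hlt := h.pot_single_lt hd v
    have hwv : wt G v = 2 := wt_eq_two.2 (by omega)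
    have hp := fun Y hY => pot_single (G := G) v Y hY
    rw [hN, Finset.sum_insert (by simp [hqb]), Finset.sum_insert (by simp [hbc, hbd]),
      Finset.sum_pair hcd, hv, hwv] at hp
    have hq1 : wt G q ≤ 1 := by unfold wt; split_ifs <;> omega
    have hlow : ∀ r, G.degree r ≠ 4 → wt G r ≤ 1 := by
      intro r hr
      have := hle r
      unfold wt; split_ifs <;> omega
    have h0 := hp ∅ (by simp)
    rw [Finset.card_empty] at h0
    have hw2 := fun r => wt_le (G := G) r
    have hb := hw2 b
    have hc := hw2 c
    have hdd := hw2 d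
    have hb4 : G.degree b = 4 := by
      by_contra hcon
      have := hlow b hcon
      omega
    have hc4 : G.degree c = 4 := by
      by_contra hcon
      have := hlow c hcon
      omega
    have hd4 : G.degree d = 4 := by
      by_contra hcon
      have := hlow d hcon
      omega
    have hq3' : G.degree q = 3 := by
      by_contra hcon
      have : wt G q = 0 := by unfold wt; split_ifs <;> omega
      omega
    have hlive : ∀ r, G.Adj v r → outn G {v} r ≠ ∅ := by
      intro r hr hcon
      have := hp {r} (by
        intro y hy
        rw [Finset.mem_singleton.1 hy]
        refine ⟨hr, fun s hs => ?_⟩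
        rw [← mem_clos_single]
        by_contra hns
        have : s ∈ outn G {v} r := mem_outn.2 ⟨hs, hns⟩
        simp [hcon] at this)
      rw [Finset.card_singleton] at this
      omega
    have hlc : 4 ≤ (live G {v}).card := by
      rw [← hcard]
      apply Finset.card_le_card
      intro r hr
      rw [SimpleGraph.mem_neighborFinset] at hr
      exact mem_live.2 ⟨mem_bdry_single.2 hr, hlive r hr⟩
    have hone : ∀ r, G.Adj v r → (outn G {v} r).card = 1 := by
      intro r hr
      have h1 := Finset.card_pos.2 (Finset.nonempty_iff_ne_empty.2 (hlive r hr))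
      by_contra hcon
      exact h.false_of_seven hd (Grow.single v) (by omega) hlc (mem_bdry_single.2 hr) (by omega)
    have := even_degree_sum_of_star hN hqb.1 hqb.2.1 hqb.2.2 hbc hbd hcd hone
    rw [hq3', hb4, hc4, hd4] at this
    exact absurd this (by decide)
  by_cases h4 : ∃ v, G.degree v = 4
  · obtain ⟨v, hv⟩ := h4
    exact mem_of_closed h.conn (S := {v | G.degree v = 4}) hv (fun x hx y => hclosed x hx y) w
  push Not at h4
  exfalso
  have hle3 : ∀ v, G.degree v ≤ 3 := fun v => by
    have := hle v; have := h4 v; omega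
  by_cases h3 : ∃ v, G.degree v = 3
  · obtain ⟨v, hv⟩ := h3
    have h1 := h.pot_single_lt hd v
    have h2 := pot_single (G := G) v ∅ (by simp)
    have hw : ∀ u ∈ G.neighborFinset v, wt G u ≤ 1 := by
      intro u _
      have := hle3 u
      unfold wt; split_ifs <;> omega
    have h5 : ∑ r ∈ G.neighborFinset v, wt G r ≤ (G.neighborFinset v).card • (1 : ℤ) :=
      Finset.sum_le_card_nsmul _ _ _ hw
    have : wt G v = 1 := by simp [wt, hv]
    rw [SimpleGraph.card_neighborFinset_eq_degree, nsmul_eq_mul, hv] at h5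
    rw [this, hv, Finset.card_empty] at h2
    omega
  · push Not at h3
    have hw0 : ∀ u, wt G u = 0 := by
      intro u
      simp [wt, h3 u, show ¬ 4 ≤ G.degree u by have := hle3 u; omega]
    have h1 := h.pot_single_lt hd w
    have h2 := pot_single (G := G) w ∅ (by simp)
    rw [Finset.sum_eq_zero (fun u _ => hw0 u), hw0 w, Finset.card_empty] at h2
    have := hd w
    omega

/-- A bad graph which is 4-regular. -/
structure Quartic (G : SimpleGraph V) : Prop extends Bad G where
  deg : ∀ v, G.degree v = 4

/-- The four distinct vertices `a`, `b`, `c`, `d` are the neighbours of `v`. -/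
structure Nbrs {W : Type*} (G : SimpleGraph W) (v a b c d : W) : Prop where
  iff : ∀ r, G.Adj v r ↔ r = a ∨ r = b ∨ r = c ∨ r = d
  ne : a ≠ b ∧ a ≠ c ∧ a ≠ d ∧ b ≠ c ∧ b ≠ d ∧ c ≠ d

lemma Quartic.nbrs (h : Quartic G) {v a b c d : V} (ha : G.Adj v a) (hb : G.Adj v b)
    (hc : G.Adj v c) (hd : G.Adj v d) (ne : a ≠ b ∧ a ≠ c ∧ a ≠ d ∧ b ≠ c ∧ b ≠ d ∧ c ≠ d) :
    Nbrs G v a b c d := by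
  refine ⟨fun r => ⟨fun hr => ?_, ?_⟩, ne⟩
  · by_contra hcon
    have h1 : ({r, a, b, c, d} : Finset V).card = 5 := by
      grind
    have h2 : ({r, a, b, c, d} : Finset V) ⊆ G.neighborFinset v := by
      intro x hx
      simp only [Finset.mem_insert, Finset.mem_singleton] at hx
      rw [SimpleGraph.mem_neighborFinset]
      rcases hx with rfl | rfl | rfl | rfl | rfl <;> assumption
    have h3 := Finset.card_le_card h2
    rw [SimpleGraph.card_neighborFinset_eq_degree, h.deg] at h3
    omega
  · rintro (rfl | rfl | rfl | rfl) <;> assumption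

lemma Quartic.exists_nbrs_three (h : Quartic G) {v a b c : V} (ha : G.Adj v a) (hb : G.Adj v b)
    (hc : G.Adj v c) (hab : a ≠ b) (hac : a ≠ c) (hbc : b ≠ c) : ∃ d, Nbrs G v a b c d := by
  obtain ⟨d, hd, hd'⟩ := exists_adj_notMem (G := G) (v := v) {a, b, c} (by
    rw [h.deg]; exact Nat.lt_succ_of_le Finset.card_le_three)
  exact ⟨d, h.nbrs ha hb hc hd (by grind)⟩

lemma Quartic.exists_nbrs_two (h : Quartic G) {v a b : V} (ha : G.Adj v a) (hb : G.Adj v b)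
    (hab : a ≠ b) : ∃ c d, Nbrs G v a b c d := by
  obtain ⟨c, hc, hc'⟩ := exists_adj_notMem (G := G) (v := v) {a, b} (by
    rw [h.deg]; exact lt_of_le_of_lt Finset.card_le_two (by norm_num))
  obtain ⟨d, hd⟩ := h.exists_nbrs_three ha hb hc hab (by grind) (by grind)
  exact ⟨c, d, hd⟩

lemma Quartic.exists_nbrs_one (h : Quartic G) {v a : V} (ha : G.Adj v a) :
    ∃ b c d, Nbrs G v a b c d := by
  obtain ⟨b, hb, hb'⟩ := exists_adj_notMem (G := G) (v := v) {a} (by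
    rw [h.deg, Finset.card_singleton]; norm_num)
  obtain ⟨c, d, hd⟩ := h.exists_nbrs_two ha hb (by grind)
  exact ⟨b, c, d, hd⟩

lemma Quartic.pot_eq (h : Quartic G) (D : Finset V) :
    pot G D = 2 * (bdry G D).card - 2 * D.card + (dead G D).card := by
  have h1 : ∑ v ∈ clos G D, wt G v = 2 * (clos G D).card := by
    rw [Finset.sum_congr rfl (fun v _ => wt_eq_two.2 (h.deg v).ge), Finset.sum_const]
    simp [mul_comm]
  have h2 : (clos G D).card = (bdry G D).card + D.card := by
    rw [bdry, Finset.card_sdiff_add_card_eq_card]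
    exact fun v hv => sub_clos hv
  unfold pot
  rw [h1, h2]
  push_cast
  ring

lemma mem_dead {D : Finset V} {y : V} :
    y ∈ dead G D ↔ y ∈ bdry G D ∧ ∀ r, G.Adj y r → r ∈ clos G D := by
  simp only [dead, Finset.mem_filter, Finset.eq_empty_iff_forall_notMem, mem_outn]
  grind

lemma Quartic.le_pot (h : Quartic G) {D B Y : Finset V} (hB : B ⊆ bdry G D)
    (hY : ∀ y ∈ Y, y ∈ bdry G D ∧ ∀ r, G.Adj y r → r ∈ clos G D) :
    2 * (B.card : ℤ) - 2 * D.card + Y.card ≤ pot G D := by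
  have h1 := Finset.card_le_card hB
  have h2 := Finset.card_le_card (show Y ⊆ dead G D from fun y hy => mem_dead.2 (hY y hy))
  rw [h.pot_eq]
  omega

lemma Quartic.le_pot_of_spanning (h : Quartic G) {D B : Finset V} (hB : B ⊆ bdry G D)
    (hs : clos G D = Finset.univ) : 3 * (B.card : ℤ) - 2 * D.card ≤ pot G D := by
  have := h.le_pot hB fun y hy => ⟨hB hy, fun r _ => hs ▸ Finset.mem_univ r⟩
  linarith

lemma Quartic.not_eight_le (h : Quartic G) {D : Finset V} (hD : Grow G D)
    (hs : clos G D = Finset.univ → 10 ≤ pot G D) : ¬ 8 ≤ pot G D := fun h8 =>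
  h.false_of_out (fun v => by rw [h.deg]; norm_num) hD h8 hs

lemma grow_pair {u v : V} (huv : G.Adj u v) : Grow G {u, v} :=
  (Grow.single v).add (mem_bdry_single.2 huv.symm)

lemma mem_clos_pair {u v x : V} : x ∈ clos G {u, v} ↔ x = u ∨ x = v ∨ G.Adj u x ∨ G.Adj v x := by
  simp only [mem_clos, Finset.mem_insert, Finset.mem_singleton, exists_eq_or_imp,
    exists_eq_left]
  tauto

lemma mem_bdry_pair {u v x : V} :
    x ∈ bdry G {u, v} ↔ x ≠ u ∧ x ≠ v ∧ (G.Adj u x ∨ G.Adj v x) := by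
  simp only [mem_bdry, Finset.mem_insert, Finset.mem_singleton, exists_eq_or_imp,
    exists_eq_left]
  tauto

/-- Every edge lies in a triangle. -/
lemma Quartic.exists_triangle (h : Quartic G) {u v : V} (huv : G.Adj u v) :
    ∃ w, G.Adj u w ∧ G.Adj v w := by
  by_contra hcon
  push Not at hcon
  obtain ⟨a, b, c, hu⟩ := h.exists_nbrs_one huv
  obtain ⟨a', b', c', hv⟩ := h.exists_nbrs_one huv.symm
  have hB : ({a, b, c, a', b', c'} : Finset V) ⊆ bdry G {u, v} := by
    intro x hx
    simp only [Finset.mem_insert, Finset.mem_singleton] at hx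
    rw [mem_bdry_pair, hu.iff, hv.iff]
    have := hu.iff u
    have := hv.iff v
    have := G.irrefl (v := u)
    have := G.irrefl (v := v)
    have := hu.ne
    have := hv.ne
    grind
  have hc : ({a, b, c, a', b', c'} : Finset V).card = 6 := by
    have := hu.ne
    have := hv.ne
    have h1 : ∀ x, x = a ∨ x = b ∨ x = c → ¬ (x = a' ∨ x = b' ∨ x = c') := fun x hx hx' =>
      hcon x ((hu.iff x).2 (by tauto)) ((hv.iff x).2 (by tauto))
    have := h1 a (by tauto)
    have := h1 b (by tauto)
    have := h1 c (by tauto)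
    grind
  have h2 : ({u, v} : Finset V).card = 2 := Finset.card_pair huv.ne
  have p1 := h.le_pot hB (Y := ∅) (by simp)
  have p2 := h.le_pot_of_spanning hB
  rw [hc, h2] at p1 p2
  exact h.not_eight_le (grow_pair huv) (fun hs => by have := p2 hs; omega) (by simpa using p1)

/-- A vertex with exactly one common neighbour with an adjacent vertex, where that common
neighbour is dead: every other neighbour has exactly one neighbour outside. -/
lemma Quartic.exists_unique_out (h : Quartic G) {v d a b c x y : V} (hv : Nbrs G v d a b c)
    (hd : Nbrs G d v a x y) (hbx : b ≠ x) (hby : b ≠ y) (hcx : c ≠ x) (hcy : c ≠ y)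
    (ha : ∀ r, G.Adj a r → r ∈ ({v, d, b, c, x, y} : Finset V)) {z : V}
    (hz : z ∈ ({b, c, x, y} : Finset V)) :
    ∃ o, G.Adj z o ∧ o ∉ ({v, d, a, b, c, x, y} : Finset V) ∧
      ∀ r, G.Adj z r → r ∈ ({v, d, a, b, c, x, y, o} : Finset V) := by
  have hvd : G.Adj v d := (hv.iff d).2 (Or.inl rfl)
  have hvv := mt (hv.iff v).2 G.irrefl
  have hdd := mt (hd.iff d).2 G.irrefl
  have hvn := hv.ne
  have hdn := hd.ne
  have hclos : ∀ r, r ∈ clos G {v, d} ↔ r ∈ ({v, d, a, b, c, x, y} : Finset V) := by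
    intro r
    rw [mem_clos_pair, hv.iff, hd.iff]
    simp only [Finset.mem_insert, Finset.mem_singleton]
    tauto
  have hB : ({a, b, c, x, y} : Finset V) ⊆ bdry G {v, d} := by
    intro r hr
    rw [mem_bdry_pair, hv.iff, hd.iff]
    simp only [Finset.mem_insert, Finset.mem_singleton] at hr
    grind
  have hc : ({a, b, c, x, y} : Finset V).card = 5 := by grind
  have h2 : ({v, d} : Finset V).card = 2 := Finset.card_pair hvd.ne
  have hg := grow_pair hvd
  have hda : ∀ r, G.Adj a r → r ∈ clos G {v, d} := by
    intro r hr
    have := ha r hr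
    rw [hclos]
    grind
  have haB : a ∈ bdry G {v, d} := hB (by simp)
  have p1 := h.le_pot hB (Y := {a}) (by
    intro r hr
    rw [Finset.mem_singleton.1 hr]
    exact ⟨haB, hda⟩)
  have p2 := h.le_pot_of_spanning hB
  rw [hc, h2] at p1 p2
  have hlive : ∀ w ∈ ({b, c, x, y} : Finset V), w ∈ bdry G {v, d} ∧ ∃ o, o ∈ outn G {v, d} w := by
    intro w hw
    have hwB : w ∈ bdry G {v, d} := hB (Finset.mem_insert_of_mem hw)
    refine ⟨hwB, ?_⟩
    by_contra hcon
    have p3 := h.le_pot hB (Y := {a, w}) (by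
      intro r hr
      rw [Finset.mem_insert, Finset.mem_singleton] at hr
      rcases hr with rfl | rfl
      · exact ⟨haB, hda⟩
      · refine ⟨hwB, fun s hs => ?_⟩
        by_contra hs'
        exact hcon ⟨s, mem_outn.2 ⟨hs, hs'⟩⟩)
    rw [hc, h2, Finset.card_pair (by grind)] at p3
    exact h.not_eight_le hg (fun hs => by have := p2 hs; omega) (by simpa using p3)
  have hlc : 4 ≤ (live G {v, d}).card := by
    have : ({b, c, x, y} : Finset V).card = 4 := by grind
    rw [← this]
    apply Finset.card_le_card
    intro w hw
    obtain ⟨h3, o, h4⟩ := hlive w hw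
    exact mem_live.2 ⟨h3, Finset.ne_empty_of_mem h4⟩
  obtain ⟨hzB, o, ho⟩ := hlive z hz
  have ho' := mem_outn.1 ho
  refine ⟨o, ho'.1, (hclos o).not.1 ho'.2, fun r hr => ?_⟩
  by_contra hcon
  have hr' : r ∈ outn G {v, d} z := by
    rw [mem_outn, hclos]
    grind
  refine h.false_of_seven (fun v => by rw [h.deg]; norm_num) hg (by simpa using p1) hlc hzB ?_
  exact Finset.one_lt_card.2 ⟨o, ho, r, hr', by grind⟩

lemma Quartic.not_clique_aux (h : Quartic G) {v a b c d : V} (hv : Nbrs G v a b c d)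
    (hab : G.Adj a b) (hac : G.Adj a c) (hbc : G.Adj b c) (had : G.Adj a d) : False := by
  have hmem := fun r => (hv.iff r).2
  have va := hmem a (by simp)
  have vb := hmem b (by simp)
  have vc := hmem c (by simp)
  have vd := hmem d (by simp)
  have hn := hv.ne
  have ha := h.nbrs va.symm hab hac had
    ⟨vb.ne, vc.ne, vd.ne, hn.2.2.2.1, hn.2.2.2.2.1, hn.2.2.2.2.2⟩
  have hdead : ∀ x y, x ≠ y → G.Adj v x → G.Adj v y →
      (∀ r, G.Adj x r → r = v ∨ G.Adj v r) → (∀ r, G.Adj y r → r = v ∨ G.Adj v r) → False := by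
    intro x y hxy hx hy hx' hy'
    have h1 := pot_single_ge (G := G) v {x, y} (by
      intro z hz
      rw [Finset.mem_insert, Finset.mem_singleton] at hz
      rcases hz with rfl | rfl
      · exact ⟨hx, hx'⟩
      · exact ⟨hy, hy'⟩)
    have h2 := h.pot_single_lt (fun v => by rw [h.deg]; norm_num) v
    rw [Finset.card_pair hxy, h.deg] at h1
    norm_num at h1
    linarith
  have hav : ∀ r, G.Adj a r → r = v ∨ G.Adj v r := by
    intro r hr
    rw [hv.iff]
    rcases (ha.iff r).1 hr with e | e | e | e <;> simp [e]
  have hbd : ¬ G.Adj b d := by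
    intro hbd
    have hb := h.nbrs vb.symm hab.symm hbc hbd
      ⟨va.ne, vc.ne, vd.ne, hn.2.1, hn.2.2.1, hn.2.2.2.2.2⟩
    refine hdead a b hn.1 va vb hav (fun r hr => ?_)
    rw [hv.iff]
    rcases (hb.iff r).1 hr with e | e | e | e <;> simp [e]
  have hcd : ¬ G.Adj c d := by
    intro hcd
    have hc := h.nbrs vc.symm hac.symm hbc.symm hcd
      ⟨va.ne, vb.ne, vd.ne, hn.1, hn.2.2.1, hn.2.2.2.2.1⟩
    refine hdead a c hn.2.1 va vc hav (fun r hr => ?_)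
    rw [hv.iff]
    rcases (hc.iff r).1 hr with e | e | e | e <;> simp [e]
  obtain ⟨x, y, hd⟩ := h.exists_nbrs_two vd.symm had.symm va.ne
  have dx := (hd.iff x).2 (by simp)
  have dy := (hd.iff y).2 (by simp)
  have hbx : b ≠ x := by rintro rfl; exact hbd dx.symm
  have hby : b ≠ y := by rintro rfl; exact hbd dy.symm
  have hcx : c ≠ x := by rintro rfl; exact hcd dx.symm
  have hcy : c ≠ y := by rintro rfl; exact hcd dy.symm
  have hvd : Nbrs G v d a b c := h.nbrs vd va vb vc
    ⟨hn.2.2.1.symm, hn.2.2.2.2.1.symm, hn.2.2.2.2.2.symm, hn.1, hn.2.1, hn.2.2.2.1⟩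
  have hout := fun z => h.exists_unique_out hvd hd hbx hby hcx hcy (fun r hr => by
    simp only [Finset.mem_insert, Finset.mem_singleton]
    rcases (ha.iff r).1 hr with e | e | e | e <;> simp [e]) (z := z)
  have hxo : ∀ z, G.Adj x z → z ∈ ({v, d, a, b, c, x, y} : Finset V) → z = d ∨ z = y := by
    intro z hxz hz
    obtain ⟨o, ho, ho', -⟩ := hout b (by simp)
    obtain ⟨o', ho1, ho1', -⟩ := hout c (by simp)
    simp only [Finset.mem_insert, Finset.mem_singleton] at hz ho' ho1'
    push Not at ho' ho1'
    have hb := h.nbrs vb.symm hab.symm hbc ho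
      ⟨va.ne, vc.ne, ho'.1.symm, hn.2.1, ho'.2.2.1.symm, ho'.2.2.2.2.1.symm⟩
    have hc := h.nbrs vc.symm hac.symm hbc.symm ho1
      ⟨va.ne, vb.ne, ho1'.1.symm, hn.1, ho1'.2.2.1.symm, ho1'.2.2.2.1.symm⟩
    have h1 := (hv.iff x).1
    have h2 := (ha.iff x).1
    have h3 := (hb.iff x).1
    have h4 := (hc.iff x).1
    have h5 := hd.ne
    have h6 := G.irrefl (v := x)
    have h7 := hxz.symm
    have h8 := dx.ne
    clear hout hdead hav hmem hvd ha hb hc hv hd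
    grind
  obtain ⟨w, hw, hw'⟩ := h.exists_triangle dx
  have hxy : G.Adj x y := by
    rcases hxo w hw' (by
      rcases (hd.iff w).1 hw with e | e | e | e <;> simp [e]) with rfl | rfl
    · exact absurd hw G.irrefl
    · exact hw'
  obtain ⟨x1, x2, hx⟩ := h.exists_nbrs_two dx.symm hxy dy.ne
  obtain ⟨o, ho, ho', ho2⟩ := hout x (by simp)
  have h1 := hxo x1 ((hx.iff _).2 (by simp))
  have h2 := hxo x2 ((hx.iff _).2 (by simp))
  have h3 := ho2 x1 ((hx.iff _).2 (by simp))
  have h4 := ho2 x2 ((hx.iff _).2 (by simp))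
  have h5 := hx.ne
  clear hout hdead hav hmem hvd ha hv hd hxo
  simp only [Finset.mem_insert, Finset.mem_singleton] at h1 h2 h3 h4
  grind

lemma Quartic.not_clique (h : Quartic G) {v a b c : V} (va : G.Adj v a) (vb : G.Adj v b)
    (vc : G.Adj v c) (hab : G.Adj a b) (hac : G.Adj a c) (hbc : G.Adj b c) : False := by
  obtain ⟨d, hv⟩ := h.exists_nbrs_three va vb vc hab.ne hac.ne hbc.ne
  have vd := (hv.iff d).2 (by tauto)
  obtain ⟨w, hw, hw'⟩ := h.exists_triangle vd
  have hn := hv.ne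
  rcases (hv.iff w).1 hw with rfl | rfl | rfl | rfl
  · exact h.not_clique_aux hv hab hac hbc hw'.symm
  · exact h.not_clique_aux (h.nbrs vb va vc vd (by grind)) hab.symm hbc hac hw'.symm
  · exact h.not_clique_aux (h.nbrs vc va vb vd (by grind)) hac.symm hbc.symm hab hw'.symm
  · exact G.irrefl hw'

lemma nonempty_iso_of_labels {U W : Type*} [Nonempty W] {G : SimpleGraph U} {H : SimpleGraph W}
    (hG : G.Connected)
    (f : W → U) (hf : Function.Injective f)
    (h : ∀ i r, G.Adj (f i) r ↔ ∃ j, H.Adj i j ∧ r = f j) : Nonempty (G ≃g H) := by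
  have hs : Function.Surjective f := by
    obtain ⟨i⟩ := ‹Nonempty W›
    exact mem_of_closed hG (S := Set.range f) ⟨i, rfl⟩ (by
      rintro _ ⟨j, rfl⟩ y hy
      obtain ⟨k, -, rfl⟩ := (h j y).1 hy
      exact ⟨k, rfl⟩)
  refine ⟨SimpleGraph.Iso.symm ⟨Equiv.ofBijective f ⟨hf, hs⟩, fun {a b} => ?_⟩⟩
  refine (h a (f b)).trans ?_
  exact ⟨fun ⟨j, h1, h2⟩ => hf h2 ▸ h1, fun h1 => ⟨b, h1, rfl⟩⟩

lemma Nbrs.fst {W : Type*} {G : SimpleGraph W} {v a b c d : W} (h : Nbrs G v a b c d) :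
    G.Adj v a := (h.iff a).2 (by simp)

lemma Nbrs.snd {W : Type*} {G : SimpleGraph W} {v a b c d : W} (h : Nbrs G v a b c d) :
    G.Adj v b := (h.iff b).2 (by simp)

lemma Nbrs.thd {W : Type*} {G : SimpleGraph W} {v a b c d : W} (h : Nbrs G v a b c d) :
    G.Adj v c := (h.iff c).2 (by simp)

lemma Nbrs.fth {W : Type*} {G : SimpleGraph W} {v a b c d : W} (h : Nbrs G v a b c d) :
    G.Adj v d := (h.iff d).2 (by simp)

/-- Two adjacent vertices with three pairwise nonadjacent common neighbours. -/
structure Claw {W : Type*} (G : SimpleGraph W) (v u r s t : W) : Prop where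
  fst : Nbrs G v u r s t
  snd : Nbrs G u v r s t
  rs : ¬ G.Adj r s
  rt : ¬ G.Adj r t
  st : ¬ G.Adj s t

lemma Claw.rot {W : Type*} {G : SimpleGraph W} {v u r s t : W} (h : Claw G v u r s t) :
    Claw G v u s t r where
  fst := by
    have := h.fst.ne
    refine ⟨fun x => (h.fst.iff x).trans (by tauto), by tauto⟩
  snd := by
    have := h.snd.ne
    refine ⟨fun x => (h.snd.iff x).trans (by tauto), by tauto⟩
  rs := h.st
  rt := fun h' => h.rs h'.symm
  st := fun h' => h.rt h'.symm

lemma Quartic.claw_step (h : Quartic G) {v u r s t : V} (hc : Claw G v u r s t) :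
    ∃ x y, Nbrs G r u v x y ∧ G.Adj x y ∧ G.Adj s x ∧ ¬ G.Adj s y ∧ G.Adj t y ∧ ¬ G.Adj t x := by
  obtain ⟨hv, hu, rs, rt, st⟩ := hc
  have vn := hv.ne
  have un := hu.ne
  obtain ⟨x, y, hr⟩ := h.exists_nbrs_two hu.snd.symm hv.snd.symm hv.fst.ne'
  have rn := hr.ne
  have hsx : s ≠ x := by rintro rfl; exact rs hr.thd
  have hsy : s ≠ y := by rintro rfl; exact rs hr.fth
  have htx : t ≠ x := by rintro rfl; exact rt hr.thd
  have hty : t ≠ y := by rintro rfl; exact rt hr.fth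
  have hv' : Nbrs G v r u s t := h.nbrs hv.snd hv.fst hv.thd hv.fth
    ⟨vn.1.symm, vn.2.2.2.1, vn.2.2.2.2.1, vn.2.1, vn.2.2.1, vn.2.2.2.2.2⟩
  have hr' : Nbrs G r v u x y := h.nbrs hr.snd hr.fst hr.thd hr.fth
    ⟨rn.1.symm, rn.2.2.2.1, rn.2.2.2.2.1, rn.2.1, rn.2.2.1, rn.2.2.2.2.2⟩
  have hout := fun z => h.exists_unique_out hv' hr' hsx hsy htx hty (fun w hw => by
    simp only [Finset.mem_insert, Finset.mem_singleton]
    rcases (hu.iff w).1 hw with e | e | e | e <;> simp [e]) (z := z)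
  simp only [Finset.mem_insert, Finset.mem_singleton] at hout
  have hs : (G.Adj s x ∧ ¬ G.Adj s y) ∨ (G.Adj s y ∧ ¬ G.Adj s x) := by
    obtain ⟨o, ho, ho', ho2⟩ := hout s (by simp)
    push Not at ho'
    obtain ⟨w, hw⟩ := h.exists_nbrs_three hu.thd.symm hv.thd.symm ho hv.fst.ne' ho'.2.2.1.symm
      ho'.1.symm
    have h1 := ho2 w hw.fth
    have h2 := hw.fth
    have h3 := hw.ne
    have h4 := G.irrefl (v := s)
    have h5 := (hw.iff x).1
    have h6 := (hw.iff y).1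
    have h7 := h2.symm
    clear hout hv' hr' hv hu hr hw ho2
    grind
  have ht : (G.Adj t x ∧ ¬ G.Adj t y) ∨ (G.Adj t y ∧ ¬ G.Adj t x) := by
    obtain ⟨o, ho, ho', ho2⟩ := hout t (by simp)
    push Not at ho'
    obtain ⟨w, hw⟩ := h.exists_nbrs_three hu.fth.symm hv.fth.symm ho hv.fst.ne' ho'.2.2.1.symm
      ho'.1.symm
    have h1 := ho2 w hw.fth
    have h2 := hw.fth
    have h3 := hw.ne
    have h4 := G.irrefl (v := t)
    have h5 := (hw.iff x).1
    have h6 := (hw.iff y).1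
    have h7 := h2.symm
    clear hout hv' hr' hv hu hr hw ho2
    grind
  have hxu : ¬ G.Adj x u := fun h' => by
    rcases (hu.iff x).1 h'.symm with e | e | e | e
    · exact rn.2.2.2.1 e.symm
    · exact hr.thd.ne e.symm
    · exact hsx e.symm
    · exact htx e.symm
  have hxv : ¬ G.Adj x v := fun h' => by
    rcases (hv.iff x).1 h'.symm with e | e | e | e
    · exact rn.2.1 e.symm
    · exact hr.thd.ne e.symm
    · exact hsx e.symm
    · exact htx e.symm
  have hyu : ¬ G.Adj y u := fun h' => by
    rcases (hu.iff y).1 h'.symm with e | e | e | e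
    · exact rn.2.2.2.2.1 e.symm
    · exact hr.fth.ne e.symm
    · exact hsy e.symm
    · exact hty e.symm
  have hyv : ¬ G.Adj y v := fun h' => by
    rcases (hv.iff y).1 h'.symm with e | e | e | e
    · exact rn.2.2.1 e.symm
    · exact hr.fth.ne e.symm
    · exact hsy e.symm
    · exact hty e.symm
  have hxy : G.Adj x y := by
    obtain ⟨w, hw, hw'⟩ := h.exists_triangle hr.thd
    rcases (hr.iff w).1 hw with rfl | rfl | rfl | rfl
    · exact absurd hw' hxu
    · exact absurd hw' hxv
    · exact absurd hw' G.irrefl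
    · exact hw'
  have hx : G.Adj s x ∨ G.Adj t x := by
    obtain ⟨o, ho, ho', ho2⟩ := hout x (by simp)
    push Not at ho'
    obtain ⟨w, hw⟩ := h.exists_nbrs_three hr.thd.symm hxy ho hr.fth.ne ho'.2.1.symm
      ho'.2.2.2.2.2.2.symm
    have h1 := ho2 w hw.fth
    have h2 := hw.fth
    have h3 := hw.ne
    have h4 := G.irrefl (v := x)
    have h7 := h2.symm
    clear hout hv' hr' hv hu hr hw ho2
    grind
  have hy : G.Adj s y ∨ G.Adj t y := by
    obtain ⟨o, ho, ho', ho2⟩ := hout y (by simp)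
    push Not at ho'
    obtain ⟨w, hw⟩ := h.exists_nbrs_three hr.fth.symm hxy.symm ho hr.thd.ne ho'.2.1.symm
      ho'.2.2.2.2.2.1.symm
    have h1 := ho2 w hw.fth
    have h2 := hw.fth
    have h3 := hw.ne
    have h4 := G.irrefl (v := y)
    have h7 := h2.symm
    clear hout hv' hr' hv hu hr hw ho2
    grind
  by_cases hsx : G.Adj s x
  · exact ⟨x, y, hr, hxy, hsx, by tauto⟩
  · refine ⟨y, x, h.nbrs hr.fst hr.snd hr.fth hr.thd (by tauto), hxy.symm, by tauto⟩

lemma nonempty_iso_of_nbrs {U W : Type*} [Nonempty W] {G : SimpleGraph U} {H : SimpleGraph W}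
    (hG : G.Connected) (f : W → U) (hf : Function.Injective f)
    (h : ∀ i, ∃ a b c d, Nbrs G (f i) (f a) (f b) (f c) (f d) ∧
      ∀ j, H.Adj i j ↔ j = a ∨ j = b ∨ j = c ∨ j = d) : Nonempty (G ≃g H) := by
  refine nonempty_iso_of_labels hG f hf fun i r => ?_
  obtain ⟨a, b, c, d, h1, h2⟩ := h i
  simp only [h1.iff, h2, or_and_right, exists_or, exists_eq_left]

lemma Quartic.nonempty_iso_of_claw (h : Quartic G) {v u r s t : V} (hc : Claw G v u r s t) :
    Nonempty (G ≃g G8) := by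
  obtain ⟨x, y, hr, xy, sx, sy, ty, tx⟩ := h.claw_step hc
  obtain ⟨z, x', hs, zx, tz, -, rx', rz⟩ := h.claw_step hc.rot
  obtain rfl : x' = x := by
    rcases (hr.iff x').1 rx' with e | e | e | e
    · exact absurd e.symm hs.ne.2.2.1
    · exact absurd e.symm hs.ne.2.2.2.2.1
    · exact e
    · exact absurd (e ▸ hs.fth) sy
  obtain ⟨y', z', ht, yz, ry', rz', sz', sy'⟩ := h.claw_step hc.rot.rot
  obtain rfl : y' = y := by
    rcases (hr.iff y').1 ry' with e | e | e | e
    · exact absurd e.symm ht.ne.2.1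
    · exact absurd e.symm ht.ne.2.2.2.1
    · exact absurd (e ▸ sx) sy'
    · exact e
  obtain rfl : z' = z := by
    rcases (hs.iff z').1 sz' with e | e | e | e
    · exact absurd e.symm ht.ne.2.2.1
    · exact absurd e.symm ht.ne.2.2.2.2.1
    · exact e
    · exact absurd (e ▸ hr.thd) rz'
  obtain ⟨hv, hu, rs, rt, st⟩ := hc
  have vn := hv.ne
  have rn := hr.ne
  have sn := hs.ne
  have tn := ht.ne
  have rz : r ≠ z' := fun e => rs (e ▸ sz'.symm)
  have sy : s ≠ y' := fun e => st (e ▸ ty.symm)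
  have tx : t ≠ x' := fun e => st (e ▸ sx)
  have hx := h.nbrs hr.thd.symm sx.symm xy zx.symm
    ⟨vn.2.2.2.1, hr.fth.ne, rz, sy, hs.thd.ne, tn.2.2.2.2.2⟩
  have hy := h.nbrs hr.fth.symm ht.thd.symm xy.symm yz
    ⟨vn.2.2.2.2.1, hr.thd.ne, rz, tx, ht.fth.ne, zx.ne'⟩
  have hz := h.nbrs hs.thd.symm ht.fth.symm zx yz.symm
    ⟨vn.2.2.2.2.2, hs.fth.ne, sy, tx, ht.thd.ne, xy.ne⟩
  have key : [v, u, z', y', x', r, s, t].Nodup := by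
    simp only [List.nodup_cons, List.mem_cons, List.not_mem_nil, or_false, not_or,
      not_false_eq_true, List.nodup_nil, and_true]
    exact ⟨⟨hv.fst.ne, sn.2.2.2.1, rn.2.2.2.2.1, rn.2.2.2.1, hv.snd.ne, hv.thd.ne, hv.fth.ne⟩,
      ⟨sn.2.1, rn.2.2.1, rn.2.1, vn.1, vn.2.1, vn.2.2.1⟩,
      ⟨yz.ne', zx.ne, rz.symm, sz'.ne', ht.fth.ne'⟩, ⟨xy.ne', hr.fth.ne', sy.symm, ty.ne'⟩,
      ⟨hr.thd.ne', sx.ne', tx.symm⟩, ⟨vn.2.2.2.1, vn.2.2.2.2.1⟩, vn.2.2.2.2.2⟩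
  refine nonempty_iso_of_nbrs h.conn ![v, u, z', y', x', r, s, t]
    (List.nodup_ofFn.1 (by simpa [List.ofFn_succ] using key)) fun i => ?_
  fin_cases i
  · exact ⟨1, 5, 6, 7, hv, fun j => by fin_cases j <;> simp [G8]⟩
  · exact ⟨0, 5, 6, 7, hu, fun j => by fin_cases j <;> simp [G8]⟩
  · exact ⟨6, 7, 4, 3, hz, fun j => by fin_cases j <;> simp [G8]⟩
  · exact ⟨5, 7, 4, 2, hy, fun j => by fin_cases j <;> simp [G8]⟩
  · exact ⟨5, 6, 3, 2, hx, fun j => by fin_cases j <;> simp [G8]⟩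
  · exact ⟨1, 0, 4, 3, hr, fun j => by fin_cases j <;> simp [G8]⟩
  · exact ⟨1, 0, 2, 4, hs, fun j => by fin_cases j <;> simp [G8]⟩
  · exact ⟨1, 0, 3, 2, ht, fun j => by fin_cases j <;> simp [G8]⟩

lemma Quartic.eq_of_wheel (h : Quartic G) {v a b c d p q : V} (hv : Nbrs G v a b c d)
    (ha : Nbrs G a v b d p) (hb : Nbrs G b v a c p) (hc : Nbrs G c v b d q)
    (hd : Nbrs G d v a c q) : p = q := by
  by_contra hpq
  have vn := hv.ne
  have an := ha.ne
  have bn := hb.ne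
  have cn := hc.ne
  have dn := hd.ne
  have hclos : ∀ r, r = v ∨ r = a ∨ r = b ∨ r = c ∨ r = d ∨ r = p ∨ r = q →
      r ∈ clos G {a, d} := by
    intro r hr
    rw [mem_clos_pair, ha.iff, hd.iff]
    grind
  have hB : ({v, b, c, p, q} : Finset V) ⊆ bdry G {a, d} := by
    intro r hr
    have h1 := ha.fth.ne
    have h2 := hd.fth.ne
    rw [mem_bdry_pair, ha.iff, hd.iff]
    simp only [Finset.mem_insert, Finset.mem_singleton] at hr
    grind
  have hB5 : ({v, b, c, p, q} : Finset V).card = 5 := by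
    have h1 := hb.fth.ne
    have h2 := hc.fth.ne
    grind
  have hY : ({v, b, c} : Finset V).card = 3 := by grind
  have h2 : ({a, d} : Finset V).card = 2 := Finset.card_pair vn.2.2.1
  have p1 := h.le_pot hB (Y := {v, b, c}) (by
    intro y hy
    refine ⟨hB (by grind), fun r hr => hclos r ?_⟩
    simp only [Finset.mem_insert, Finset.mem_singleton] at hy
    rcases hy with rfl | rfl | rfl
    · have := (hv.iff r).1 hr
      grind
    · have := (hb.iff r).1 hr
      grind
    · have := (hc.iff r).1 hr
      grind)
  have p2 := h.le_pot_of_spanning hB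
  rw [h2, hB5] at p1 p2
  rw [hY] at p1
  exact h.not_eight_le (grow_pair ha.thd) (fun hs => by have := p2 hs; omega) (by omega)

lemma Quartic.eq_or_eq_of_wheel (h : Quartic G) {v a b c d w x y : V} (hv : Nbrs G v a b c d)
    (ha : Nbrs G a v b d w) (hb : Nbrs G b v a c x) (hd : Nbrs G d v a c y) (ac : ¬ G.Adj a c) :
    w = x ∨ w = y := by
  obtain ⟨s, hs, hs'⟩ := h.exists_triangle ha.fth
  have an := ha.ne
  have haw := ha.fth.ne
  have hcw : c ≠ w := by rintro rfl; exact ac ha.fth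
  rcases (ha.iff s).1 hs with rfl | rfl | rfl | rfl
  · rcases (hv.iff w).1 hs'.symm with e | e | e | e <;> grind
  · rcases (hb.iff w).1 hs'.symm with e | e | e | e <;> grind
  · rcases (hd.iff w).1 hs'.symm with e | e | e | e <;> grind
  · exact absurd hs' G.irrefl

lemma Quartic.nonempty_iso_of_wheel (h : Quartic G) {v a b c d : V} (hv : Nbrs G v a b c d)
    (ab : G.Adj a b) (bc : G.Adj b c) (cd : G.Adj c d) (da : G.Adj d a) (ac : ¬ G.Adj a c)
    (bd : ¬ G.Adj b d) : Nonempty (G ≃g cycleSq 6) := by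
  have vn := hv.ne
  obtain ⟨w, ha⟩ := h.exists_nbrs_three hv.fst.symm ab da.symm hv.snd.ne hv.fth.ne vn.2.2.2.2.1
  obtain ⟨x, hb⟩ := h.exists_nbrs_three hv.snd.symm ab.symm bc hv.fst.ne hv.thd.ne vn.2.1
  obtain ⟨y, hc⟩ := h.exists_nbrs_three hv.thd.symm bc.symm cd hv.snd.ne hv.fth.ne vn.2.2.2.2.1
  obtain ⟨z, hd⟩ := h.exists_nbrs_three hv.fth.symm da cd.symm hv.fst.ne hv.thd.ne vn.2.1
  have hv2 : Nbrs G v b c d a := h.nbrs hv.snd hv.thd hv.fth hv.fst (by tauto)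
  have hv3 : Nbrs G v c d a b := h.nbrs hv.thd hv.fth hv.fst hv.snd (by tauto)
  have hv4 : Nbrs G v d a b c := h.nbrs hv.fth hv.fst hv.snd hv.thd (by tauto)
  have swap : ∀ {i j k l m : V}, Nbrs G i j k l m → Nbrs G i j l k m := fun hi =>
    h.nbrs hi.fst hi.thd hi.snd hi.fth (by have := hi.ne; tauto)
  have e1 := h.eq_or_eq_of_wheel hv ha hb hd ac
  have e2 := h.eq_or_eq_of_wheel hv2 (swap hb) hc ha bd
  have e3 := h.eq_or_eq_of_wheel hv3 (swap hc) (swap hd) (swap hb) (fun h' => ac h'.symm)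
  have e4 := h.eq_or_eq_of_wheel hv4 hd (swap ha) (swap hc) (fun h' => bd h'.symm)
  have hall : w = x ∧ x = y ∧ y = z := by
    have f1 : w = x → y = z → w = y := by
      rintro rfl rfl
      exact h.eq_of_wheel hv ha hb hc hd
    have f2 : x = y → z = w → x = z := by
      rintro rfl rfl
      exact h.eq_of_wheel hv2 (swap hb) hc (swap hd) ha
    grind
  obtain ⟨rfl, rfl, rfl⟩ := hall
  have hw := h.nbrs ha.fth.symm hb.fth.symm hc.fth.symm hd.fth.symm vn
  have aw : c ≠ w := hc.fth.ne
  have key : [v, a, b, w, c, d].Nodup := by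
    simp only [List.nodup_cons, List.mem_cons, List.not_mem_nil, or_false, not_or,
      not_false_eq_true, List.nodup_nil, and_true]
    exact ⟨⟨hv.fst.ne, hv.snd.ne, ha.ne.2.2.1, hv.thd.ne, hv.fth.ne⟩,
      ⟨vn.1, ha.fth.ne, vn.2.1, vn.2.2.1⟩, ⟨hb.fth.ne, vn.2.2.2.1, vn.2.2.2.2.1⟩,
      ⟨hc.fth.ne', hd.fth.ne'⟩, vn.2.2.2.2.2⟩
  have hadj : ∀ i j : Fin 6, (cycleSq 6).Adj i j ↔
      i ≠ j ∧ ((i - j = 1 ∨ i - j = 2) ∨ (j - i = 1 ∨ j - i = 2)) := fun i j => Iff.rfl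
  refine nonempty_iso_of_nbrs (W := Fin 6) h.conn ![v, a, b, w, c, d]
    (List.nodup_ofFn.1 (by simpa [List.ofFn_succ] using key)) fun i => ?_
  fin_cases i
  · exact ⟨1, 2, 4, 5, hv, fun j => (hadj _ j).trans (by revert j; decide)⟩
  · exact ⟨0, 2, 5, 3, ha, fun j => (hadj _ j).trans (by revert j; decide)⟩
  · exact ⟨0, 1, 4, 3, hb, fun j => (hadj _ j).trans (by revert j; decide)⟩
  · exact ⟨1, 2, 4, 5, hw, fun j => (hadj _ j).trans (by revert j; decide)⟩
  · exact ⟨0, 2, 5, 3, hc, fun j => (hadj _ j).trans (by revert j; decide)⟩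
  · exact ⟨0, 1, 4, 3, hd, fun j => (hadj _ j).trans (by revert j; decide)⟩

/-- A quartic graph whose neighbourhoods are claw-free and contain no 4-cycle. -/
structure Tame (G : SimpleGraph V) : Prop extends Quartic G where
  cf : ∀ ⦃v a b c⦄, G.Adj v a → G.Adj v b → G.Adj v c → a ≠ b → a ≠ c → b ≠ c →
    G.Adj a b ∨ G.Adj a c ∨ G.Adj b c
  c4 : ∀ ⦃v a b c d⦄, Nbrs G v a b c d → G.Adj a b → G.Adj b c → G.Adj c d → ¬ G.Adj d a

lemma Quartic.tame (h : Quartic G) (h6 : IsEmpty (G ≃g cycleSq 6)) (h8 : IsEmpty (G ≃g G8)) :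
    Tame G where
  toQuartic := h
  cf := by
    intro v a b c va vb vc ab ac bc
    by_contra! hn
    obtain ⟨u, hv⟩ := h.exists_nbrs_three va vb vc ab ac bc
    have hu : ∀ r, (r = a ∨ r = b ∨ r = c) → G.Adj u r := by
      intro r hr
      obtain ⟨s, hs, hs'⟩ := h.exists_triangle ((hv.iff r).2 (by tauto))
      rcases (hv.iff s).1 hs with rfl | rfl | rfl | rfl
      · rcases hr with rfl | rfl | rfl
        · exact absurd hs' G.irrefl
        · exact absurd hs'.symm hn.1
        · exact absurd hs'.symm hn.2.1
      · rcases hr with rfl | rfl | rfl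
        · exact absurd hs' hn.1
        · exact absurd hs' G.irrefl
        · exact absurd hs'.symm hn.2.2
      · rcases hr with rfl | rfl | rfl
        · exact absurd hs' hn.2.1
        · exact absurd hs' hn.2.2
        · exact absurd hs' G.irrefl
      · exact hs'.symm
    have vn := hv.ne
    have hv' : Nbrs G v u a b c := h.nbrs hv.fth hv.fst hv.snd hv.thd
      ⟨vn.2.2.1.symm, vn.2.2.2.2.1.symm, vn.2.2.2.2.2.symm, ab, ac, bc⟩
    have hu' : Nbrs G u v a b c := h.nbrs hv.fth.symm (hu a (by simp)) (hu b (by simp))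
      (hu c (by simp)) ⟨va.ne, vb.ne, vc.ne, ab, ac, bc⟩
    exact h8.false (h.nonempty_iso_of_claw ⟨hv', hu', hn.1, hn.2.1, hn.2.2⟩).some
  c4 := by
    intro v a b c d hv ab bc cd da
    refine h6.false (h.nonempty_iso_of_wheel hv ab bc cd da (fun ac => ?_) fun bd => ?_).some
    · exact h.not_clique hv.fst hv.snd hv.thd ab ac bc
    · exact h.not_clique hv.snd hv.thd hv.fth bc bd cd

lemma Quartic.adj_of_nbrs (h : Quartic G) {v a b c d : V} (hv : Nbrs G v a b c d)
    (ad : ¬ G.Adj a d) (bd : ¬ G.Adj b d) : G.Adj c d := by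
  obtain ⟨s, hs, hs'⟩ := h.exists_triangle hv.fth
  rcases (hv.iff s).1 hs with rfl | rfl | rfl | rfl
  · exact absurd hs'.symm ad
  · exact absurd hs'.symm bd
  · exact hs'.symm
  · exact absurd hs' G.irrefl

lemma Quartic.exists_strip_end (h : Quartic G) {a b p w y g : V} (ha : Nbrs G a y p b w)
    (hb : Nbrs G b p a w g) (yp : G.Adj y p) (yb : ¬ G.Adj y b)
    (yw : ¬ G.Adj y w) (pw : ¬ G.Adj p w) (pg : ¬ G.Adj p g) :
    ∃ d f, Nbrs G p y a b d ∧ Nbrs G y p a d f ∧ G.Adj d f := by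
  have an := ha.ne
  obtain ⟨d, hp⟩ := h.exists_nbrs_three yp.symm ha.snd.symm hb.fst.symm ha.fst.ne' an.2.1
    hb.snd.ne'
  have pn := hp.ne
  have dy : G.Adj y d := by
    refine h.adj_of_nbrs (h.nbrs hp.snd hp.thd hp.fst hp.fth
      ⟨pn.2.2.2.1, pn.1.symm, pn.2.2.2.2.1, pn.2.1.symm, pn.2.2.2.2.2, pn.2.2.1⟩) ?_ ?_
    · intro h'
      rcases (ha.iff d).1 h' with rfl | rfl | rfl | rfl
      · exact pn.2.2.1 rfl
      · exact hp.fth.ne rfl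
      · exact pn.2.2.2.2.2 rfl
      · exact pw hp.fth
    · intro h'
      rcases (hb.iff d).1 h' with rfl | rfl | rfl | rfl
      · exact hp.fth.ne rfl
      · exact pn.2.2.2.2.1 rfl
      · exact pw hp.fth
      · exact pg hp.fth
  obtain ⟨f, hy⟩ := h.exists_nbrs_three yp ha.fst.symm dy ha.snd.ne' hp.fth.ne pn.2.2.2.2.1
  have yn := hy.ne
  refine ⟨d, f, hp, hy, h.adj_of_nbrs hy ?_ ?_⟩
  · intro h'
    rcases (hp.iff f).1 h' with rfl | rfl | rfl | rfl
    · exact hy.fth.ne rfl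
    · exact yn.2.2.2.2.1 rfl
    · exact yb hy.fth
    · exact yn.2.2.2.2.2 rfl
  · intro h'
    rcases (ha.iff f).1 h' with rfl | rfl | rfl | rfl
    · exact hy.fth.ne rfl
    · exact yn.2.2.1 rfl
    · exact yb hy.fth
    · exact yw hy.fth

lemma Quartic.nonempty_iso_of_strip (h : Quartic G) {a b p w y g : V} (ha : Nbrs G a y p b w)
    (hb : Nbrs G b p a w g) (yp : G.Adj y p) (wg : G.Adj w g) (yb : ¬ G.Adj y b)
    (yw : ¬ G.Adj y w) (pw : ¬ G.Adj p w) (pg : ¬ G.Adj p g) (ga : ¬ G.Adj g a) :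
    Nonempty (G ≃g cycleSq 8) := by
  have an := ha.ne
  have bn := hb.ne
  have yg : y ≠ g := by rintro rfl; exact pg yp.symm
  have ha' : Nbrs G b g w a p := h.nbrs hb.fth hb.thd hb.snd hb.fst
    ⟨bn.2.2.2.2.2.symm, bn.2.2.2.2.1.symm, bn.2.2.1.symm, bn.2.2.2.1.symm, bn.2.1.symm, bn.1.symm⟩
  have hb' : Nbrs G a w b p y := h.nbrs ha.fth ha.thd ha.snd ha.fst
    ⟨an.2.2.2.2.2.symm, an.2.2.2.2.1.symm, an.2.2.1.symm, an.2.2.2.1.symm, an.2.1.symm, an.1.symm⟩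
  obtain ⟨d, f, hp, hy, df⟩ := h.exists_strip_end ha hb yp yb yw pw pg
  obtain ⟨t, i, hw, hg, ti⟩ := h.exists_strip_end ha' hb' wg.symm ga
    (fun h' => pg h'.symm) (fun h' => pw h'.symm) (fun h' => yw h'.symm)
  have pn := hp.ne
  have hv : Nbrs G p b a y d := h.nbrs hp.thd hp.snd hp.fst hp.fth
    ⟨pn.2.2.2.1.symm, pn.2.1.symm, pn.2.2.2.2.2, pn.1.symm, pn.2.2.2.2.1, pn.2.2.1⟩
  have dw : d ≠ w := by rintro rfl; exact pw hp.fth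
  have dg : d ≠ g := by rintro rfl; exact pg hp.fth
  have hout := fun z => h.exists_unique_out hv hb an.2.2.1 yg dw dg (z := z) (by
    intro r hr
    simp only [Finset.mem_insert, Finset.mem_singleton]
    rcases (ha.iff r).1 hr with e | e | e | e <;> simp [e])
  simp only [Finset.mem_insert, Finset.mem_singleton] at hout
  have hf : f ≠ w ∧ f ≠ g := by
    obtain ⟨o, ho, ho', -⟩ := hout y (by simp)
    rcases (hy.iff o).1 ho with rfl | rfl | rfl | rfl <;> simp at ho' ⊢
    exact ⟨ho'.2.2.2.2.2.1, ho'.2.2.2.2.2.2⟩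
  have ht : t ≠ y ∧ t ≠ d := by
    obtain ⟨o, ho, ho', -⟩ := hout w (by simp)
    rcases (hw.iff o).1 ho with rfl | rfl | rfl | rfl <;> simp at ho' ⊢
    exact ⟨ho'.2.2.2.1, ho'.2.2.2.2.1⟩
  have fpab : f ≠ p ∧ f ≠ a ∧ f ≠ b ∧ f ≠ y := by
    refine ⟨hy.ne.2.2.1.symm, hy.ne.2.2.2.2.1.symm, ?_, hy.fth.ne'⟩
    rintro rfl
    exact yb hy.fth
  obtain ⟨e, hd⟩ := h.exists_nbrs_three hp.fth.symm hy.thd.symm df hy.fst.ne' fpab.1.symm hy.fth.ne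
  have he : e = g := by
    obtain ⟨o, ho, ho', ho2⟩ := hout d (by simp)
    have hof : f = o := by
      have := ho2 f df
      have := df.ne
      tauto
    subst hof
    have dn := hd.ne
    rcases ho2 e hd.fth with rfl | rfl | rfl | rfl | rfl | rfl | rfl | rfl
    · exact absurd rfl dn.2.2.1
    · rcases (hb.iff d).1 hd.fth.symm with rfl | rfl | rfl | rfl
      · exact absurd rfl hp.fth.ne
      · exact absurd rfl pn.2.2.2.2.1
      · exact absurd rfl dw
      · exact absurd rfl dg
    · rcases (ha.iff d).1 hd.fth.symm with rfl | rfl | rfl | rfl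
      · exact absurd rfl pn.2.2.1
      · exact absurd rfl hp.fth.ne
      · exact absurd rfl pn.2.2.2.2.2
      · exact absurd rfl dw
    · exact absurd rfl dn.2.2.2.2.1
    · exact absurd hd.fth G.irrefl
    · rcases (hw.iff d).1 hd.fth.symm with rfl | rfl | rfl | rfl
      · exact absurd rfl dg
      · exact absurd rfl pn.2.2.2.2.2
      · exact absurd rfl pn.2.2.2.2.1
      · exact absurd rfl ht.2
    · rfl
    · exact absurd rfl dn.2.2.2.2.2
  subst he
  have hi : d = i := by
    rcases (hg.iff d).1 hd.fth.symm with rfl | rfl | rfl | rfl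
    · exact absurd rfl dw
    · exact absurd rfl pn.2.2.2.2.2
    · exact absurd rfl ht.2
    · rfl
  subst hi
  have htf : f = t := by
    rcases (hd.iff t).1 ti.symm with rfl | rfl | rfl | rfl
    · exact absurd hw.fth.symm pw
    · exact absurd rfl ht.1
    · rfl
    · exact absurd rfl hg.thd.ne
  subst htf
  have hft : Nbrs G f d y w e := h.nbrs df.symm hy.fth.symm hw.fth.symm hg.thd.symm
    ⟨hy.thd.ne', dw, dg, an.2.2.1, yg, wg.ne⟩
  have key : [f, d, y, p, a, b, w, e].Nodup := by
    simp only [List.nodup_cons, List.mem_cons, List.not_mem_nil, or_false, not_or,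
      not_false_eq_true, List.nodup_nil, and_true]
    exact ⟨⟨df.ne', fpab.2.2.2, fpab.1, fpab.2.1, fpab.2.2.1, hf.1, hf.2⟩,
      ⟨hy.thd.ne', hp.fth.ne', pn.2.2.2.2.1.symm, pn.2.2.2.2.2.symm, dw, dg⟩,
      ⟨yp.ne, ha.fst.ne', an.2.1, an.2.2.1, yg⟩,
      ⟨hp.snd.ne, hp.thd.ne, bn.2.1, bn.2.2.1⟩, ⟨ha.thd.ne, ha.fth.ne, bn.2.2.2.2.1⟩,
      ⟨hb.thd.ne, hb.fth.ne⟩, wg.ne⟩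
  have hadj : ∀ i j : Fin 8, (cycleSq 8).Adj i j ↔
      i ≠ j ∧ ((i - j = 1 ∨ i - j = 2) ∨ (j - i = 1 ∨ j - i = 2)) := fun i j => Iff.rfl
  refine nonempty_iso_of_nbrs (W := Fin 8) h.conn ![f, d, y, p, a, b, w, e]
    (List.nodup_ofFn.1 (by simpa [List.ofFn_succ] using key)) fun i => ?_
  fin_cases i
  · exact ⟨1, 2, 6, 7, hft, fun j => (hadj _ j).trans (by revert j; decide)⟩
  · exact ⟨3, 2, 0, 7, hd, fun j => (hadj _ j).trans (by revert j; decide)⟩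
  · exact ⟨3, 4, 1, 0, hy, fun j => (hadj _ j).trans (by revert j; decide)⟩
  · exact ⟨2, 4, 5, 1, hp, fun j => (hadj _ j).trans (by revert j; decide)⟩
  · exact ⟨2, 3, 5, 6, ha, fun j => (hadj _ j).trans (by revert j; decide)⟩
  · exact ⟨3, 4, 6, 7, hb, fun j => (hadj _ j).trans (by revert j; decide)⟩
  · exact ⟨7, 5, 4, 0, hw, fun j => (hadj _ j).trans (by revert j; decide)⟩
  · exact ⟨6, 5, 0, 1, hg, fun j => (hadj _ j).trans (by revert j; decide)⟩

lemma Tame.adj_of_outer (h : Tame G) {D : Finset V} {y r s : V} (hy : y ∈ bdry G D)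
    (yr : G.Adj y r) (hr : r ∉ clos G D) (ys : G.Adj y s) (hs : s ∉ clos G D) (rs : r ≠ s) :
    G.Adj r s := by
  obtain ⟨d, hd, hdy⟩ := (mem_bdry.1 hy).2
  rcases h.cf hdy.symm yr ys (fun e => hr (e ▸ sub_clos hd)) (fun e => hs (e ▸ sub_clos hd)) rs
    with h1 | h1 | h1
  · exact absurd (adj_mem_clos hd h1) hr
  · exact absurd (adj_mem_clos hd h1) hs
  · exact h1

lemma Tame.eq_or_eq_of_outer (h : Tame G) {D : Finset V} {y r s t : V} (hy : y ∈ bdry G D)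
    (yr : G.Adj y r) (hr : r ∉ clos G D) (ys : G.Adj y s) (hs : s ∉ clos G D) (rs : r ≠ s)
    (yt : G.Adj y t) (ht : t ∉ clos G D) : t = r ∨ t = s := by
  by_contra! hn
  exact h.not_clique yr ys yt (h.adj_of_outer hy yr hr ys hs rs)
    (h.adj_of_outer hy yr hr yt ht hn.1.symm) (h.adj_of_outer hy ys hs yt ht hn.2.symm)

/-- A boundary vertex `p` of `D` with outer neighbours `a` and `b`. -/
structure Fork {W : Type*} [Fintype W] (G : SimpleGraph W) (D : Finset W) (p d e a b : W) :
    Prop where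
  mem : d ∈ D
  nbrs : Nbrs G p d e a b
  de : G.Adj d e
  ha : a ∉ clos G D
  hb : b ∉ clos G D
  ab : G.Adj a b
  bdry : p ∈ bdry G D

lemma Fork.symm {D : Finset V} {p d e a b : V} (h : Fork G D p d e a b) :
    Fork G D p d e b a where
  mem := h.mem
  nbrs := by
    have := h.nbrs.ne
    exact ⟨fun r => (h.nbrs.iff r).trans (by tauto), by tauto⟩
  de := h.de
  ha := h.hb
  hb := h.ha
  ab := h.ab.symm
  bdry := h.bdry

lemma Fork.he {D : Finset V} {p d e a b : V} (h : Fork G D p d e a b) : e ∈ clos G D :=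
  adj_mem_clos h.mem h.de

lemma Fork.mem_outn_iff {D : Finset V} {p d e a b : V} (h : Fork G D p d e a b) (r : V) :
    r ∈ outn G D p ↔ r = a ∨ r = b := by
  rw [mem_outn, h.nbrs.iff]
  have h1 := sub_clos (G := G) h.mem
  have h2 := h.he
  have h3 := h.ha
  have h4 := h.hb
  constructor
  · rintro ⟨rfl | rfl | h5, h6⟩
    · exact absurd h1 h6
    · exact absurd h2 h6
    · exact h5
  · rintro (rfl | rfl)
    · exact ⟨by simp, h3⟩
    · exact ⟨by simp, h4⟩

lemma Fork.outn_eq {D : Finset V} {p d e a b : V} (h : Fork G D p d e a b) :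
    outn G D p = {a, b} := by
  ext r
  rw [h.mem_outn_iff]; simp

lemma Fork.card {D : Finset V} {p d e a b : V} (h : Fork G D p d e a b) :
    (outn G D p).card = 2 := by
  rw [h.outn_eq]; exact Finset.card_pair h.ab.ne

lemma Fork.out_ne {D : Finset V} {p d e a b : V} (h : Fork G D p d e a b) : outn G D p ≠ ∅ := by
  rw [h.outn_eq]; simp

lemma Fork.mem_clos_insert {D : Finset V} {p d e a b : V} (h : Fork G D p d e a b) (r : V) :
    r ∈ clos G (insert p D) ↔ r ∈ clos G D ∨ r = a ∨ r = b := by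
  rw [clos_insert h.bdry, Finset.mem_union, h.mem_outn_iff]

lemma Tame.exists_fork (h : Tame G) {D : Finset V} {p : V} (hp : p ∈ bdry G D)
    (h2 : 2 ≤ (outn G D p).card) : ∃ d e a b, Fork G D p d e a b := by
  obtain ⟨a, ha, b, hb, ab⟩ := Finset.one_lt_card.1 h2
  rw [mem_outn] at ha hb
  obtain ⟨d, hd, hdp⟩ := (mem_bdry.1 hp).2
  obtain ⟨e, hde, hpe⟩ := h.exists_triangle hdp
  have he := adj_mem_clos hd hde
  have hd' := sub_clos (G := G) hd
  refine ⟨d, e, a, b, hd, h.nbrs hdp.symm hpe ha.1 hb.1 ⟨hde.ne, ?_, ?_, ?_, ?_, ab⟩, hde, ha.2,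
    hb.2, h.adj_of_outer hp ha.1 ha.2 hb.1 hb.2 ab, hp⟩
  · rintro rfl; exact ha.2 hd'
  · rintro rfl; exact hb.2 hd'
  · rintro rfl; exact ha.2 he
  · rintro rfl; exact hb.2 he

lemma Tame.exists_outer (h : Tame G) {D : Finset V} (hD : Grow G D) (h6 : 6 ≤ pot G D)
    {p d e a b : V} (hf : Fork G D p d e a b) : ∃ w, G.Adj a w ∧ w ∉ clos G D ∧ ¬ G.Adj p w := by
  by_contra! hno
  have pa := hf.nbrs.thd
  obtain ⟨y, z, ha⟩ := h.exists_nbrs_two pa.symm hf.ab hf.nbrs.fth.ne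
  have an := ha.ne
  have key : ∀ y, G.Adj a y → y ≠ p → y ≠ b → y ∈ bdry G D ∧ ∀ r, G.Adj y r →
      r ∈ clos G D ∨ G.Adj p r := by
    intro y ay yp yb
    have hy : y ∈ clos G D := by
      by_contra hy
      have := hno y ay hy
      rcases (hf.mem_outn_iff y).1 (mem_outn.2 ⟨this, hy⟩) with rfl | rfl
      · exact G.irrefl ay
      · exact yb rfl
    have hyb := mem_bdry_of_adj hy ay.symm hf.ha
    refine ⟨hyb, fun r yr => ?_⟩
    by_cases hr : r ∈ clos G D
    · exact Or.inl hr
    · right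
      by_cases hra : r = a
      · rw [hra]; exact pa
      · exact hno r (h.adj_of_outer hyb ay.symm hf.ha yr hr (Ne.symm hra)) hr
  have hy := key y ha.thd an.2.1.symm an.2.2.2.1.symm
  have hz := key z ha.fth an.2.2.1.symm an.2.2.2.2.1.symm
  have hy0 : outn G D y ≠ ∅ := Finset.ne_empty_of_mem (mem_outn.2 ⟨ha.thd.symm, hf.ha⟩)
  have hz0 : outn G D z ≠ ∅ := Finset.ne_empty_of_mem (mem_outn.2 ⟨ha.fth.symm, hf.ha⟩)
  have hayz : ({a, y, z} : Finset V).card = 3 :=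
    Finset.card_eq_three.2 ⟨a, y, z, ha.thd.ne, ha.fth.ne, an.2.2.2.2.2, rfl⟩
  have p1 := pot_insert_le hf.bdry {a, y, z} hf.out_ne (by
    intro x hx
    simp only [Finset.mem_insert, Finset.mem_singleton] at hx
    rcases hx with rfl | rfl | rfl
    · refine ⟨pa.ne', Or.inl (mem_outn.2 ⟨pa, hf.ha⟩), fun r hr => ?_⟩
      by_cases hr' : r ∈ clos G D
      · exact Or.inl hr'
      · exact Or.inr (hno r hr hr')
    · exact ⟨an.2.1.symm, Or.inr ⟨hy.1, hy0⟩, hy.2⟩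
    · exact ⟨an.2.2.1.symm, Or.inr ⟨hz.1, hz0⟩, hz.2⟩)
  refine h.false_of_nine (hD.add hf.bdry) ?_ fun hs => ?_
  · rw [hf.card, hayz] at p1
    omega
  · have p2 := pot_insert_spanning hf.bdry hf.out_ne hs {y, z} (by
      intro x hx
      simp only [Finset.mem_insert, Finset.mem_singleton] at hx
      rcases hx with rfl | rfl
      · exact ⟨an.2.1.symm, hy.1, hy0⟩
      · exact ⟨an.2.2.1.symm, hz.1, hz0⟩)
    rw [hf.card, Finset.card_pair an.2.2.2.2.2] at p2
    omega

lemma Tame.false_of_fan (h : Tame G) (h8 : IsEmpty (G ≃g cycleSq 8)) {a p b y w d : V}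
    (ha : Nbrs G a y p b w) (hp : Nbrs G p d y a b) (db : ¬ G.Adj d b) (pw : ¬ G.Adj p w)
    (yw : ¬ G.Adj y w) : False := by
  have an := ha.ne
  have pn := hp.ne
  have yb : ¬ G.Adj y b := fun yb =>
    h.not_clique ha.fst ha.snd ha.thd hp.snd.symm yb hp.fth
  have bw : G.Adj b w := h.adj_of_nbrs ha yw pw
  obtain ⟨g, hb⟩ := h.exists_nbrs_three hp.fth.symm ha.thd.symm bw ha.snd.ne' an.2.2.2.2.1
    ha.fth.ne
  have bn := hb.ne
  have pg : ¬ G.Adj p g := by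
    intro h'
    rcases (hp.iff g).1 h' with rfl | rfl | rfl | rfl
    · exact db hb.fth.symm
    · exact yb hb.fth.symm
    · exact bn.2.2.2.2.1 rfl
    · exact hb.fth.ne rfl
  have ag : ¬ G.Adj a g := by
    intro h'
    rcases (ha.iff g).1 h' with rfl | rfl | rfl | rfl
    · exact yb hb.fth.symm
    · exact bn.2.2.1 rfl
    · exact hb.fth.ne rfl
    · exact bn.2.2.2.2.2 rfl
  exact h8.false (h.nonempty_iso_of_strip ha hb hp.snd.symm (h.adj_of_nbrs hb pg ag) yb yw pw pg
    fun h' => ag h'.symm).some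

lemma Tame.exists_outer_of_adj (h : Tame G) (h8 : IsEmpty (G ≃g cycleSq 8)) {D : Finset V}
    (hD : Grow G D) (h6 : 6 ≤ pot G D) {p d e a b y : V} (hf : Fork G D p d e a b)
    (hy : y ∈ bdry G D) (yp : y ≠ p) (ya : G.Adj y a) :
    ∃ r, G.Adj y r ∧ r ∉ clos G D ∧ ¬ G.Adj p r := by
  by_contra! hno
  obtain ⟨w, aw, hw, pw⟩ := h.exists_outer hD h6 hf
  have pa := hf.nbrs.thd
  have pb := hf.nbrs.fth
  have yw : ¬ G.Adj y w := fun yw => pw (hno w yw hw)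
  have hyc := bdry_sub hy
  have wp : p ≠ w := by rintro rfl; exact hw (bdry_sub hf.bdry)
  have wy : y ≠ w := by rintro rfl; exact hw hyc
  have bw : b ≠ w := by rintro rfl; exact pw pb
  have yb : y ≠ b := by rintro rfl; exact hf.hb hyc
  have py : G.Adj p y := by
    rcases h.cf pa.symm ya.symm aw yp.symm wp wy with h1 | h1 | h1
    · exact h1
    · exact absurd h1 pw
    · exact absurd h1 yw
  have hey : e = y := by
    rcases (hf.nbrs.iff y).1 py with rfl | rfl | rfl | rfl
    · exact absurd hf.mem (not_mem_of_bdry hy)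
    · rfl
    · exact absurd rfl ya.ne
    · exact absurd rfl yb
  subst hey
  exact h.false_of_fan h8 (h.nbrs ya.symm pa.symm hf.ab aw ⟨yp, yb, wy, pb.ne, wp, bw⟩) hf.nbrs
    (fun h' => hf.hb (adj_mem_clos hf.mem h')) pw yw

lemma Tame.exists_third (h : Tame G) (h8 : IsEmpty (G ≃g cycleSq 8)) {D : Finset V}
    (hD : Grow G D) (h6 : 6 ≤ pot G D) {p d e a b : V} (hf : Fork G D p d e a b)
    (hs : Stuck G (insert p D)) : ∃ o x, Nbrs G a p b o x ∧ o ∉ clos G D ∧ ¬ G.Adj p o ∧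
      x ∈ bdry G D ∧ G.Adj x o := by
  obtain ⟨o, ao, ho, po⟩ := h.exists_outer hD h6 hf
  have pa := hf.nbrs.thd
  have pb := hf.nbrs.fth
  have op : p ≠ o := by rintro rfl; exact ho (bdry_sub hf.bdry)
  have bo : b ≠ o := by rintro rfl; exact po pb
  obtain ⟨x, ha⟩ := h.exists_nbrs_three pa.symm hf.ab ao pb.ne op bo
  have an := ha.ne
  have hac : a ∈ clos G (insert p D) := (hf.mem_clos_insert a).2 (by simp)
  have ho' : o ∉ clos G (insert p D) := by
    rw [hf.mem_clos_insert]
    rintro (h1 | h1 | h1)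
    · exact ho h1
    · exact ao.ne' h1
    · exact bo h1.symm
  have hx : x ∈ clos G D := by
    by_contra hx
    refine an.2.2.2.2.2 (hs.eq hac ao ho' ha.fth ?_)
    rw [hf.mem_clos_insert]
    rintro (h1 | h1 | h1)
    · exact hx h1
    · exact ha.fth.ne' h1
    · exact an.2.2.2.2.1 h1.symm
  have hxb := mem_bdry_of_adj hx ha.fth.symm hf.ha
  obtain ⟨r, xr, hr, pr⟩ := h.exists_outer_of_adj h8 hD h6 hf hxb an.2.2.1.symm ha.fth.symm
  have ra : a ≠ r := by rintro rfl; exact pr pa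
  have ar := h.adj_of_outer hxb ha.fth.symm hf.ha xr hr ra
  refine ⟨o, x, ha, ho, po, hxb, ?_⟩
  rcases (ha.iff r).1 ar with rfl | rfl | rfl | rfl
  · exact absurd (bdry_sub hf.bdry) hr
  · exact absurd pb pr
  · exact xr
  · exact absurd hx hr

lemma Tame.false_of_stuck (h : Tame G) (h8 : IsEmpty (G ≃g cycleSq 8)) {D : Finset V}
    (hD : Grow G D) (h6 : 6 ≤ pot G D) {p d e a b : V} (hf : Fork G D p d e a b)
    (hst : Stuck G (insert p D)) {u v : V} (hu : u ∈ live G D) (hv : v ∈ live G D)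
    (uv : G.Adj u v) : False := by
  obtain ⟨o, x, ha, ho, po, hx, xo⟩ := h.exists_third h8 hD h6 hf hst
  obtain ⟨o', x', hb, ho', po', hx', xo'⟩ := h.exists_third h8 hD h6 hf.symm hst
  have an := ha.ne
  have bn := hb.ne
  have xb : ¬ G.Adj x b := fun xb => by
    rcases h.eq_or_eq_of_outer hx ha.fth.symm hf.ha xo ho ha.thd.ne xb hf.hb with h1 | h1
    · exact hf.ab.ne' h1
    · exact an.2.2.2.1 h1
  have xa' : ¬ G.Adj x' a := fun xa => by
    rcases h.eq_or_eq_of_outer hx' hb.fth.symm hf.hb xo' ho' hb.thd.ne xa hf.ha with h1 | h1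
    · exact hf.ab.ne h1
    · exact bn.2.2.2.1 h1
  have xx' : x ≠ x' := by rintro rfl; exact xb hb.fth.symm
  have hgrow := hD.add hf.bdry
  by_cases hoo : o = o'
  · subst hoo
    have hpot := pot_insert_ge hf.bdry hf.card.ge
    have hx1 : x ∈ bdry G (insert p D) := (mem_bdry_insert hf.bdry).2 (Or.inl ⟨hx, an.2.2.1.symm⟩)
    have hx1' : x' ∈ bdry G (insert p D) :=
      (mem_bdry_insert hf.bdry).2 (Or.inl ⟨hx', bn.2.2.1.symm⟩)
    have ha1 : a ∈ bdry G (insert p D) :=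
      (mem_bdry_insert hf.bdry).2 (Or.inr ((hf.mem_outn_iff a).2 (by simp)))
    have hb1 : b ∈ bdry G (insert p D) :=
      (mem_bdry_insert hf.bdry).2 (Or.inr ((hf.mem_outn_iff b).2 (by simp)))
    have ho1 : o ∉ clos G (insert p D) := by
      rw [hf.mem_clos_insert]
      rintro (h1 | h1 | h1)
      · exact ho h1
      · exact ha.thd.ne' h1
      · exact hb.thd.ne' h1
    have hout : ∀ y, G.Adj y o → outn G (insert p D) y ≠ ∅ := fun y hy =>
      Finset.ne_empty_of_mem (mem_outn.2 ⟨hy, ho1⟩)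
    have hox : outn G (insert p D) x = {o} := by
      refine Finset.eq_singleton_iff_unique_mem.2 ⟨mem_outn.2 ⟨xo, ho1⟩, fun r hr => ?_⟩
      rw [mem_outn] at hr
      exact hst.eq (bdry_sub hx1) hr.1 hr.2 xo ho1
    have hN : Nbrs G o a b x x' := h.nbrs ha.thd.symm hb.thd.symm xo.symm xo'.symm
      ⟨hf.ab.ne, ha.fth.ne, bn.2.2.2.2.1, an.2.2.2.2.1, hb.fth.ne, xx'⟩
    have on := hN.ne
    have hc4 : ({a, b, x', o} : Finset V).card = 4 :=
      Finset.card_eq_succ.2 ⟨a, {b, x', o}, by simp [on.1, on.2.2.1, ha.thd.ne], rfl,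
        Finset.card_eq_three.2 ⟨b, x', o, hb.fth.ne, hb.thd.ne, xo'.ne, rfl⟩⟩
    have p1 := pot_insert_le hx1 {a, b, x', o} (hout x xo) (by
      intro y hy
      simp only [Finset.mem_insert, Finset.mem_singleton] at hy
      have hpc : p ∈ clos G (insert p D) := sub_clos (by simp)
      rcases hy with rfl | rfl | rfl | rfl
      · refine ⟨ha.fth.ne, Or.inr ⟨ha1, hout _ ha.thd⟩, fun r hr => ?_⟩
        rcases (ha.iff r).1 hr with rfl | rfl | rfl | rfl
        · exact Or.inl hpc
        · exact Or.inl (bdry_sub hb1)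
        · exact Or.inr xo
        · exact Or.inl (bdry_sub hx1)
      · refine ⟨an.2.2.2.2.1, Or.inr ⟨hb1, hout _ hb.thd⟩, fun r hr => ?_⟩
        rcases (hb.iff r).1 hr with rfl | rfl | rfl | rfl
        · exact Or.inl hpc
        · exact Or.inl (bdry_sub ha1)
        · exact Or.inr xo
        · exact Or.inl (bdry_sub hx1')
      · refine ⟨xx'.symm, Or.inr ⟨hx1', hout _ xo'⟩, fun r hr => ?_⟩
        by_cases hr1 : r ∈ clos G (insert p D)
        · exact Or.inl hr1
        · rw [hst.eq (bdry_sub hx1') hr hr1 xo' ho1]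
          exact Or.inr xo
      · refine ⟨xo.ne', Or.inl (mem_outn.2 ⟨xo, ho1⟩), fun r hr => Or.inl ?_⟩
        rcases (hN.iff r).1 hr with rfl | rfl | rfl | rfl
        · exact bdry_sub ha1
        · exact bdry_sub hb1
        · exact bdry_sub hx1
        · exact bdry_sub hx1')
    rw [hox, Finset.card_singleton, hc4] at p1
    refine h.not_eight_le (hgrow.add hx1) (fun hs => ?_) (by omega)
    exfalso
    have hlive : ∀ z, z ∈ live G D → z = p ∨ z = x ∨ z = x' := by
      intro z hz
      rw [mem_live] at hz
      by_contra! hn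
      have hzp : ∃ r, G.Adj z r ∧ r ∉ clos G D ∧ ¬ G.Adj p r := by
        obtain ⟨r, hr⟩ := Finset.nonempty_iff_ne_empty.2 hz.2
        rw [mem_outn] at hr
        by_cases hpr : G.Adj p r
        · rcases (hf.mem_outn_iff r).1 (mem_outn.2 ⟨hpr, hr.2⟩) with rfl | rfl
          · exact h.exists_outer_of_adj h8 hD h6 hf hz.1 hn.1 hr.1
          · exact h.exists_outer_of_adj h8 hD h6 hf.symm hz.1 hn.1 hr.1
        · exact ⟨r, hr.1, hr.2, hpr⟩
      obtain ⟨r, zr, hr, pr⟩ := hzp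
      have hr1 : r ∉ clos G (insert p D) := by
        rw [mem_clos_insert hf.bdry]; tauto
      have hr2 : r ∈ clos G (insert x (insert p D)) := hs ▸ Finset.mem_univ r
      rw [clos_insert hx1, Finset.mem_union, hox, Finset.mem_singleton] at hr2
      obtain rfl := hr2.resolve_left hr1
      rcases (hN.iff z).1 zr.symm with rfl | rfl | rfl | rfl
      · exact hf.ha (bdry_sub hz.1)
      · exact hf.hb (bdry_sub hz.1)
      · exact hn.2.1 rfl
      · exact hn.2.2 rfl
    have hpx : ¬ G.Adj p x := fun hpx => h.c4 ha hf.nbrs.fth hb.thd xo.symm hpx.symm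
    have hpx' : ¬ G.Adj p x' := fun hpx => h.c4 hb hf.nbrs.thd ha.thd xo'.symm hpx.symm
    have hxx : ¬ G.Adj x x' := fun hxx =>
      h.c4 (h.nbrs hN.fst hN.snd hN.fth hN.thd
        ⟨on.1, on.2.2.1, on.2.1, on.2.2.2.2.1, on.2.2.2.1, xx'.symm⟩) hf.ab hb.fth hxx.symm
        ha.fth.symm
    rcases hlive u hu with rfl | rfl | rfl <;> rcases hlive v hv with rfl | rfl | rfl
    · exact G.irrefl uv
    · exact hpx uv
    · exact hpx' uv
    · exact hpx uv.symm
    · exact G.irrefl uv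
    · exact hxx uv
    · exact hpx' uv.symm
    · exact hxx uv.symm
    · exact G.irrefl uv
  · have hxo' : ¬ G.Adj x o' := fun hxo => by
      rcases h.eq_or_eq_of_outer hx ha.fth.symm hf.ha xo ho ha.thd.ne hxo ho' with h1 | h1
      · exact bn.2.2.2.1 h1.symm
      · exact hoo h1.symm
    have q1 : 2 ≤ (outn G D x).card := Finset.one_lt_card.2
      ⟨a, mem_outn.2 ⟨ha.fth.symm, hf.ha⟩, o, mem_outn.2 ⟨xo, ho⟩, ha.thd.ne⟩
    have hpot := pot_insert_ge hx q1
    have hx2 : x' ∈ bdry G (insert x D) := (mem_bdry_insert hx).2 (Or.inl ⟨hx', xx'.symm⟩)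
    have hbo : b ∈ outn G (insert x D) x' := (mem_outn_insert hx).2 ⟨hb.fth.symm, hf.hb, xb⟩
    have hoo' : o' ∈ outn G (insert x D) x' := (mem_outn_insert hx).2 ⟨xo', ho', hxo'⟩
    have q2 : 2 ≤ (outn G (insert x D) x').card := Finset.one_lt_card.2
      ⟨b, hbo, o', hoo', hb.thd.ne⟩
    have hne : outn G (insert x D) x' ≠ ∅ := Finset.ne_empty_of_mem hbo
    have hpl : p ≠ x' ∧ p ∈ bdry G (insert x D) ∧ outn G (insert x D) p ≠ ∅ :=
      ⟨bn.2.2.1, (mem_bdry_insert hx).2 (Or.inl ⟨hf.bdry, an.2.2.1⟩),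
        Finset.ne_empty_of_mem ((mem_outn_insert hx).2 ⟨hf.nbrs.fth, hf.hb, xb⟩)⟩
    have hal : a ≠ x' ∧ a ∈ bdry G (insert x D) ∧ outn G (insert x D) a ≠ ∅ :=
      ⟨bn.2.2.2.2.1, (mem_bdry_insert hx).2 (Or.inr (mem_outn.2 ⟨ha.fth.symm, hf.ha⟩)),
        Finset.ne_empty_of_mem ((mem_outn_insert hx).2 ⟨hf.ab, hf.hb, xb⟩)⟩
    have hclos : ∀ r, r ∈ clos G D ∨ G.Adj x r ∨ G.Adj x' r →
        r ∈ clos G (insert x D) ∨ G.Adj x' r := by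
      intro r hr
      rw [mem_clos_insert hx]; tauto
    have hc3 : ({p, a, b} : Finset V).card = 3 :=
      Finset.card_eq_three.2 ⟨p, a, b, ha.fst.ne', hb.fst.ne', hf.ab.ne, rfl⟩
    have p1 := pot_insert_le hx2 {p, a, b} hne (by
      intro y hy
      simp only [Finset.mem_insert, Finset.mem_singleton] at hy
      rcases hy with rfl | rfl | rfl
      · refine ⟨hpl.1, Or.inr hpl.2, fun r hr => hclos r ?_⟩
        rcases (hf.nbrs.iff r).1 hr with rfl | rfl | rfl | rfl
        · exact Or.inl (sub_clos hf.mem)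
        · exact Or.inl hf.he
        · exact Or.inr (Or.inl ha.fth.symm)
        · exact Or.inr (Or.inr hb.fth.symm)
      · refine ⟨hal.1, Or.inr hal.2, fun r hr => hclos r ?_⟩
        rcases (ha.iff r).1 hr with rfl | rfl | rfl | rfl
        · exact Or.inl (bdry_sub hf.bdry)
        · exact Or.inr (Or.inr hb.fth.symm)
        · exact Or.inr (Or.inl xo)
        · exact Or.inl (bdry_sub hx)
      · refine ⟨hb.fth.ne, Or.inl hbo, fun r hr => hclos r ?_⟩
        rcases (hb.iff r).1 hr with rfl | rfl | rfl | rfl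
        · exact Or.inl (bdry_sub hf.bdry)
        · exact Or.inr (Or.inl ha.fth.symm)
        · exact Or.inr (Or.inr xo')
        · exact Or.inl (bdry_sub hx'))
    rw [hc3] at p1
    refine h.false_of_nine ((hD.add hx).add hx2) (by omega) fun hs => ?_
    have p2 := pot_insert_spanning hx2 hne hs {p, a} (by
      intro y hy
      simp only [Finset.mem_insert, Finset.mem_singleton] at hy
      rcases hy with rfl | rfl
      · exact hpl
      · exact hal)
    rw [Finset.card_pair ha.fst.ne'] at p2
    omega

lemma Tame.false_of_live (h : Tame G) (h8 : IsEmpty (G ≃g cycleSq 8)) {D : Finset V}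
    (hD : Grow G D) (h6 : 6 ≤ pot G D) {u v p : V} (hu : u ∈ live G D) (hv : v ∈ live G D)
    (uv : G.Adj u v) (hp : p ∈ bdry G D) (h2 : 2 ≤ (outn G D p).card) : False := by
  induction hn : Fintype.card V - D.card using Nat.strong_induction_on generalizing D u v p with
  | _ n ih =>
    obtain ⟨d, e, a, b, hf⟩ := h.exists_fork hp h2
    by_cases hst : Stuck G (insert p D)
    · exact h.false_of_stuck h8 hD h6 hf hst hu hv uv
    obtain ⟨q, hq, hq2⟩ := Stuck.exists_of_not hst
    have hle := Finset.card_le_univ (insert p D)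
    have hc := card_insert_bdry hp
    have hlive : ∀ {d e a b}, Fork G D p d e a b → a ∈ live G (insert p D) := by
      intro d e a b hf
      obtain ⟨w, aw, hw, pw⟩ := h.exists_outer hD h6 hf
      exact mem_live.2 ⟨(mem_bdry_insert hp).2 (Or.inr ((hf.mem_outn_iff a).2 (by simp))),
        Finset.ne_empty_of_mem ((mem_outn_insert hp).2 ⟨aw, hw, pw⟩)⟩
    exact ih _ (by omega) (hD.add hp) (h6.trans (pot_insert_ge hp h2)) (hlive hf) (hlive hf.symm)
      hf.ab hq hq2 rfl

lemma Quartic.mem_live_single (h : Quartic G) {v x y m : V} (vx : G.Adj v x)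
    (hx : ∀ r, G.Adj v r → G.Adj x r → r = y ∨ r = m) : x ∈ live G {v} := by
  obtain ⟨r, xr, hr⟩ := exists_adj_notMem ({v, y, m} : Finset V)
    (Finset.card_le_three.trans_lt (by rw [h.deg x]; norm_num))
  simp only [Finset.mem_insert, Finset.mem_singleton, not_or] at hr
  refine mem_live.2 ⟨mem_bdry_single.2 vx, Finset.ne_empty_of_mem (mem_outn.2 ⟨xr, ?_⟩)⟩
  rw [mem_clos_single]
  rintro (e | e)
  · exact hr.1 e
  · rcases hx r e xr with e | e
    · exact hr.2.1 e
    · exact hr.2.2 e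

lemma Quartic.two_le_outn_single (h : Quartic G) {v x m : V}
    (hx : ∀ r, G.Adj v r → G.Adj x r → r = m) : 2 ≤ (outn G {v} x).card := by
  by_contra! hlt
  have h4 : G.neighborFinset x ⊆ {v, m} ∪ outn G {v} x := by
    intro r hr
    rw [SimpleGraph.mem_neighborFinset] at hr
    rw [Finset.mem_union, mem_outn, mem_clos_single, Finset.mem_insert, Finset.mem_singleton]
    by_cases hv : G.Adj v r
    · exact Or.inl (Or.inr (hx r hv hr))
    · tauto
  have h5 := (Finset.card_le_card h4).trans (Finset.card_union_le _ _)
  rw [SimpleGraph.card_neighborFinset_eq_degree, h.deg] at h5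
  have h6 : ({v, m} : Finset V).card ≤ 2 := Finset.card_le_two
  omega

lemma Tame.exists_one_neighbor (h : Tame G) {v a b c d : V} (hv : Nbrs G v a b c d)
    (ab : G.Adj a b) : ∃ k m, G.Adj v k ∧ ∀ r, G.Adj v r → G.Adj k r → r = m := by
  have vn := hv.ne
  have abc : ¬ (G.Adj a c ∧ G.Adj b c) := fun e =>
    h.not_clique hv.fst hv.snd hv.thd ab e.1 e.2
  have abd : ¬ (G.Adj a d ∧ G.Adj b d) := fun e =>
    h.not_clique hv.fst hv.snd hv.fth ab e.1 e.2
  by_cases ha : ¬ G.Adj a c ∧ ¬ G.Adj a d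
  · refine ⟨a, b, hv.fst, fun r vr hr => ?_⟩
    rcases (hv.iff r).1 vr with rfl | rfl | rfl | rfl
    · exact absurd hr G.irrefl
    · rfl
    · exact absurd hr ha.1
    · exact absurd hr ha.2
  by_cases hb : ¬ G.Adj b c ∧ ¬ G.Adj b d
  · refine ⟨b, a, hv.snd, fun r vr hr => ?_⟩
    rcases (hv.iff r).1 vr with rfl | rfl | rfl | rfl
    · rfl
    · exact absurd hr G.irrefl
    · exact absurd hr hb.1
    · exact absurd hr hb.2
  refine ⟨c, if G.Adj a c then a else b, hv.thd, fun r vr hr => ?_⟩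
  have cd : ¬ G.Adj c d := by
    intro cd
    by_cases ac : G.Adj a c
    · have bd : G.Adj b d := by tauto
      exact h.c4 (h.nbrs hv.fst hv.thd hv.fth hv.snd
        ⟨vn.2.1, vn.2.2.1, vn.1, vn.2.2.2.2.2, vn.2.2.2.1.symm, vn.2.2.2.2.1.symm⟩) ac cd bd.symm
        ab.symm
    · have ad : G.Adj a d := by tauto
      have bc : G.Adj b c := by tauto
      exact h.c4 (h.nbrs hv.fst hv.fth hv.thd hv.snd
        ⟨vn.2.2.1, vn.2.1, vn.1, vn.2.2.2.2.2.symm, vn.2.2.2.2.1.symm, vn.2.2.2.1.symm⟩) ad cd.symm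
        bc.symm ab.symm
  rcases (hv.iff r).1 vr with rfl | rfl | rfl | rfl
  · rw [if_pos hr.symm]
  · rw [if_neg fun e => abc ⟨e, hr.symm⟩]
  · exact absurd hr G.irrefl
  · exact absurd hr cd

lemma Tame.false_of_nonempty (h : Tame G) (h8 : IsEmpty (G ≃g cycleSq 8)) (v : V) : False := by
  obtain ⟨a, va, -⟩ := exists_adj_notMem (∅ : Finset V) (by rw [h.deg v]; simp)
  obtain ⟨b, hvb, ab⟩ := h.exists_triangle va
  obtain ⟨c, d, hv⟩ := h.exists_nbrs_two va hvb ab.ne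
  have vn := hv.ne
  have hlive : ∀ {a b c d}, Nbrs G v a b c d → G.Adj a b → a ∈ live G {v} := by
    intro a b c d hv ab
    have vn := hv.ne
    by_cases ac : G.Adj a c
    · refine h.mem_live_single (y := b) (m := c) hv.fst fun r vr hr => ?_
      rcases (hv.iff r).1 vr with rfl | rfl | rfl | rfl
      · exact absurd hr G.irrefl
      · exact Or.inl rfl
      · exact Or.inr rfl
      · rcases h.cf hv.snd hv.thd hv.fth vn.2.2.2.1 vn.2.2.2.2.1 vn.2.2.2.2.2 with e | e | e
        · exact (h.not_clique hv.fst hv.snd hv.thd ab ac e).elim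
        · exact (h.not_clique hv.fst hv.snd hv.fth ab hr e).elim
        · exact (h.not_clique hv.fst hv.thd hv.fth ac hr e).elim
    · refine h.mem_live_single (y := b) (m := d) hv.fst fun r vr hr => ?_
      rcases (hv.iff r).1 vr with rfl | rfl | rfl | rfl
      · exact absurd hr G.irrefl
      · exact Or.inl rfl
      · exact absurd hr ac
      · exact Or.inr rfl
  obtain ⟨k, m, vk, hk⟩ := h.exists_one_neighbor hv ab
  have hpot := pot_single_ge (G := G) v ∅ (by simp)
  rw [h.deg] at hpot
  exact h.false_of_live h8 (Grow.single v) (by simpa using hpot) (hlive hv ab)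
    (hlive (h.nbrs hv.snd hv.fst hv.thd hv.fth ⟨vn.1.symm, vn.2.2.2.1, vn.2.2.2.2.1, vn.2.1,
      vn.2.2.1, vn.2.2.2.2.2⟩) ab.symm) ab (mem_bdry_single.2 vk) (h.two_le_outn_single hk)

lemma exists_tree_of_card_eq_two (hG : G.Connected) (hV : Fintype.card V = 2) :
    ∃ T ≤ G, T.IsTree ∧
      (2 / 5 : ℚ) * (Fintype.card {v : V // 4 ≤ G.degree v}) +
        (1 / 5 : ℚ) * (Fintype.card {v : V // G.degree v = 3}) + 2 ≤ leafCount T := by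
  have : Nontrivial V := Fintype.one_lt_card_iff_nontrivial.1 (by omega)
  obtain ⟨T, hT, ht⟩ := hG.exists_isTree_le
  have hdeg : ∀ (H : SimpleGraph V) (v : V), H.degree v < 2 := fun H v => by
    have := H.degree_lt_card_verts v
    omega
  have h4 : Fintype.card {v : V // 4 ≤ G.degree v} = 0 :=
    Fintype.card_eq_zero_iff.2 ⟨fun v => by have := hdeg G v; have := v.2; omega⟩
  have h3 : Fintype.card {v : V // G.degree v = 3} = 0 :=
    Fintype.card_eq_zero_iff.2 ⟨fun v => by have := hdeg G v; have := v.2; omega⟩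
  have hl : leafCount T = 2 := by
    rw [leafCount, Fintype.card_subtype, Finset.filter_true_of_mem, Finset.card_univ, hV]
    intro v _
    have h1 := ht.connected.preconnected.degree_pos_of_nontrivial v
    have := hdeg T v
    omega
  exact ⟨T, hT, ht, by rw [h4, h3, hl]; norm_num⟩

end LeafyTree

/-- Every connected graph with at least two vertices which is isomorphic to none of
`C₆²`, `C₈²`, `G₈` has a spanning tree with at least `(2/5)·t + (1/5)·s + 2` leaves,
where `t` and `s` are the numbers of vertices of degree at least 4 and of degree 3. -/
theorem spanning_tree_leaves_ge_two_fifths_t_one_fifth_s_add_two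
    {V : Type*} [Fintype V] (G : SimpleGraph V) (hG : G.Connected)
    (hV : 2 ≤ Fintype.card V)
    (h6 : IsEmpty (G ≃g cycleSq 6)) (h8 : IsEmpty (G ≃g cycleSq 8))
    (hG8 : IsEmpty (G ≃g G8)) :
    ∃ T ≤ G, T.IsTree ∧
      (2 / 5 : ℚ) * (Fintype.card {v : V // 4 ≤ G.degree v}) +
        (1 / 5 : ℚ) * (Fintype.card {v : V // G.degree v = 3}) + 2 ≤ leafCount T := by
  by_contra hcon
  have : Nontrivial V := Fintype.one_lt_card_iff_nontrivial.1 hV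
  by_cases hV2 : Fintype.card V = 2
  · exact hcon (LeafyTree.exists_tree_of_card_eq_two hG hV2)
  have hbad : LeafyTree.Bad G := ⟨hG, fun D hD hs => by
    by_contra! hp
    exact hcon (LeafyTree.exists_tree_of_pot hD hs hp)⟩
  have hquartic : LeafyTree.Quartic G := ⟨hbad, hbad.degree_eq_four (by omega)⟩
  obtain ⟨v⟩ := hG.nonempty
  exact (hquartic.tame h6 hG8).false_of_nonempty h8 v
end

section
/- The maximum number of leaves of a spanning tree of the graph C_6^2 equals 4. Equivalently, C_6^2 has a spanning tree with 4 leaves, and every spanning tree of C_6^2 has at most 4 leaves (so the bound (2/5)·6 + 8/5 = 4 of the main theorem is attained with additive constant exactly 8/5). -/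
open scoped Classical

theorem leafCount_eq_card_filter {V : Type*} [Fintype V] (T : SimpleGraph V)
    [DecidableRel T.Adj] :
    leafCount T = (Finset.univ.filter fun v => T.degree v = 1).card := by
  rw [leafCount, Fintype.card_subtype]
  congr!

theorem SimpleGraph.IsTree.mul_leafCount_add_le {V : Type*} [Fintype V]
    {T : SimpleGraph V} (hT : T.IsTree) {d : ℕ} (hd : 1 ≤ d) (h : ∀ v, T.degree v ≤ d) :
    (d - 1) * leafCount T + 2 * (Fintype.card V - 1) ≤ d * Fintype.card V := by
  have hsum : ∑ v, T.degree v = 2 * (Fintype.card V - 1) := by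
    rw [T.sum_degrees_eq_twice_card_edges, ← hT.card_edgeFinset, Nat.add_sub_cancel]
  have hle : ∑ v, ((d - 1) * (if T.degree v = 1 then 1 else 0) + T.degree v) ≤ ∑ _v : V, d := by
    refine Finset.sum_le_sum fun v _ => ?_
    have := h v
    split_ifs <;> omega
  rw [Finset.sum_add_distrib, ← Finset.mul_sum, ← Finset.card_filter,
    ← leafCount_eq_card_filter, hsum] at hle
  simpa [mul_comm] using hle

instance (k : ℕ) : DecidableRel (cycleSq k).Adj := fun i j =>
  decidable_of_iff (i ≠ j ∧ ((i - j = 1 ∨ i - j = 2) ∨ (j - i = 1 ∨ j - i = 2))) Iff.rfl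

theorem degree_cycleSq_six (v : ZMod 6) : (cycleSq 6).degree v = 4 := by
  revert v
  decide

/-- The spanning tree of `C₆²` with edges `01`, `02`, `04`, `05` and `13`. -/
def doubleStarSix : SimpleGraph (ZMod 6) :=
  SimpleGraph.fromRel (fun i j => i = 0 ∧ j ≠ 3 ∨ i = 1 ∧ j = 3)

instance : DecidableRel doubleStarSix.Adj := fun i j =>
  decidable_of_iff (i ≠ j ∧ ((i = 0 ∧ j ≠ 3 ∨ i = 1 ∧ j = 3) ∨ (j = 0 ∧ i ≠ 3 ∨ j = 1 ∧ i = 3)))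
    Iff.rfl

theorem doubleStarSix_le : doubleStarSix ≤ cycleSq 6 := by
  have h : ∀ i j, doubleStarSix.Adj i j → (cycleSq 6).Adj i j := by decide
  exact h

theorem doubleStarSix_connected : doubleStarSix.Connected := by
  refine (SimpleGraph.connected_iff_exists_forall_reachable _).2 ⟨0, fun v => ?_⟩
  have h : ∀ v, v = 0 ∨ doubleStarSix.Adj 0 v ∨
      doubleStarSix.Adj 0 1 ∧ doubleStarSix.Adj 1 v := by decide
  rcases h v with rfl | h | ⟨h₁, h₂⟩
  · rfl
  · exact h.reachable
  · exact h₁.reachable.trans h₂.reachable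

theorem doubleStarSix_isTree : doubleStarSix.IsTree := by
  refine SimpleGraph.isTree_iff_connected_and_card.2 ⟨doubleStarSix_connected, ?_⟩
  have hsum : ∑ v, doubleStarSix.degree v = 10 := by decide
  rw [doubleStarSix.sum_degrees_eq_twice_card_edges] at hsum
  rw [Nat.card_eq_fintype_card, ← SimpleGraph.edgeFinset_card, Nat.card_zmod]
  omega

theorem leafCount_doubleStarSix : leafCount doubleStarSix = 4 := by
  rw [leafCount_eq_card_filter]
  decide

/-- The maximum number of leaves of a spanning tree of `C₆²` equals 4:
there is a spanning tree with 4 leaves, and every spanning tree has at most 4 leaves. -/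
theorem maxLeaves_cycleSq_six :
    (∃ T ≤ cycleSq 6, T.IsTree ∧ leafCount T = 4) ∧
    (∀ T ≤ cycleSq 6, T.IsTree → leafCount T ≤ 4) := by
  refine ⟨⟨doubleStarSix, doubleStarSix_le, doubleStarSix_isTree, leafCount_doubleStarSix⟩,
    fun T hle hT => ?_⟩
  have h := hT.mul_leafCount_add_le (d := 4) (by norm_num) fun v =>
    (SimpleGraph.degree_le_of_le hle).trans (degree_cycleSq_six v).le
  rw [ZMod.card] at h
  omega
end

section
/- The maximum number of leaves of a spanning tree of the graph G_8 equals 5. In particular, G_8 has no spanning tree with at least (2/5)·8 + 2 = 26/5 leaves, so G_8 is an exclusion to the bound with additive constant 2. -/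
open scoped Classical

instance decidableRelG8 : DecidableRel G8.Adj := fun u v =>
  decidable_of_iff _ (SimpleGraph.fromRel_adj _ u v).symm

/-- A spanning tree of `G₈` with leaves `a₂`, `b₁`, `b₃`, `r₂`, `r₃`. -/
def fiveLeafTree : SimpleGraph (Fin 8) :=
  SimpleGraph.fromRel (fun u v =>
    (u, v) ∈ [((0 : Fin 8), (1 : Fin 8)), (0, 5), (0, 6), (0, 7), (5, 3), (5, 4), (3, 2)])

instance decidableRelFiveLeafTree : DecidableRel fiveLeafTree.Adj := fun u v =>
  decidable_of_iff _ (SimpleGraph.fromRel_adj _ u v).symm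

theorem fiveLeafTree_le : fiveLeafTree ≤ G8 := by
  have h : ∀ u v, fiveLeafTree.Adj u v → G8.Adj u v := by decide
  exact fun u v => h u v

theorem fiveLeafTree_connected : fiveLeafTree.Connected := by
  have adj {u v : Fin 8} (h : fiveLeafTree.Adj u v) : fiveLeafTree.Reachable u v := h.reachable
  have h5 : fiveLeafTree.Reachable 0 5 := adj (by decide)
  have h3 : fiveLeafTree.Reachable 0 3 := h5.trans (adj (by decide))
  have h : ∀ v, fiveLeafTree.Reachable 0 v := by
    intro v
    fin_cases v
    · exact .refl _
    · exact adj (by decide)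
    · exact h3.trans (adj (by decide))
    · exact h3
    · exact h5.trans (adj (by decide))
    · exact h5
    · exact adj (by decide)
    · exact adj (by decide)
  exact (SimpleGraph.connected_iff_exists_forall_reachable _).2 ⟨0, h⟩

theorem fiveLeafTree_isTree : fiveLeafTree.IsTree := by
  have hsum : ∑ v, fiveLeafTree.degree v = 14 := by decide
  have hedges := fiveLeafTree.sum_degrees_eq_twice_card_edges
  rw [SimpleGraph.isTree_iff_connected_and_card]
  refine ⟨fiveLeafTree_connected, ?_⟩
  rw [Nat.card_eq_fintype_card, ← SimpleGraph.edgeFinset_card, Nat.card_eq_fintype_card,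
    Fintype.card_fin]
  omega

theorem leafCount_fiveLeafTree : leafCount fiveLeafTree = 5 := by
  rw [leafCount_eq_card_filter]
  decide

theorem degree_G8 (v : Fin 8) : G8.degree v = 4 := by
  revert v
  decide

theorem exists_common_neighbor_G8 (u v : Fin 8) : ∃ w, G8.Adj u w ∧ G8.Adj v w := by
  revert u v
  decide

theorem sum_degrees_of_isTree {V : Type*} [Fintype V] {T : SimpleGraph V} (hT : T.IsTree) :
    ∑ v, T.degree v + 2 = 2 * Fintype.card V := by
  rw [T.sum_degrees_eq_twice_card_edges, ← hT.card_edgeFinset]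
  ring

theorem adj_of_le_of_degree_le {V : Type*} [Fintype V] {T G : SimpleGraph V}
    [DecidableRel T.Adj] [DecidableRel G.Adj] (hTG : T ≤ G) {u w : V}
    (hdeg : G.degree u ≤ T.degree u) (h : G.Adj u w) : T.Adj u w := by
  have hsub : T.neighborFinset u ⊆ G.neighborFinset u := fun x hx => by
    simp only [SimpleGraph.mem_neighborFinset] at hx ⊢
    exact hTG hx
  have heq := Finset.eq_of_subset_of_card_le hsub hdeg
  rwa [← SimpleGraph.mem_neighborFinset, heq, SimpleGraph.mem_neighborFinset]

theorem leafCount_le_five {T : SimpleGraph (Fin 8)} (hTG : T ≤ G8) (hT : T.IsTree) :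
    leafCount T ≤ 5 := by
  by_contra! hlt
  rw [leafCount_eq_card_filter] at hlt
  have hdeg (v : Fin 8) : T.degree v ≤ 4 :=
    (SimpleGraph.degree_le_of_le hTG).trans_eq (degree_G8 v)
  have hsum := sum_degrees_of_isTree hT
  have hcard := Finset.card_filter_add_card_filter_not (s := (Finset.univ : Finset (Fin 8)))
    (fun v => T.degree v = 1)
  rw [← Finset.sum_filter_add_sum_filter_not _ (fun v => T.degree v = 1),
    Finset.sum_congr rfl (g := fun _ => 1) (fun v hv => (Finset.mem_filter.1 hv).2),
    Finset.sum_const, smul_eq_mul, mul_one, Fintype.card_fin] at hsum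
  rw [Finset.card_univ, Fintype.card_fin] at hcard
  have hle := Finset.sum_le_card_nsmul
    (Finset.univ.filter fun v => ¬ T.degree v = 1) (fun v => T.degree v) 4 fun v _ => hdeg v
  rw [smul_eq_mul] at hle
  have htwo : (Finset.univ.filter fun v => ¬ T.degree v = 1).card = 2 := by omega
  obtain ⟨u, v, huv, hS⟩ := Finset.card_eq_two.1 htwo
  rw [hS, Finset.sum_pair huv] at hsum
  have hu := hdeg u
  have hv := hdeg v
  obtain ⟨w, huw, hvw⟩ := exists_common_neighbor_G8 u v
  have hTu : T.Adj u w := adj_of_le_of_degree_le hTG (by rw [degree_G8]; omega) huw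
  have hTv : T.Adj v w := adj_of_le_of_degree_le hTG (by rw [degree_G8]; omega) hvw
  have hw : T.degree w = 1 := by
    by_contra hw
    have : w ∈ ({u, v} : Finset (Fin 8)) := hS ▸ Finset.mem_filter.2 ⟨Finset.mem_univ w, hw⟩
    rcases Finset.mem_insert.1 this with rfl | h
    · exact hTu.ne rfl
    · exact hTv.ne (Finset.mem_singleton.1 h).symm
  exact huv ((SimpleGraph.degree_eq_one_iff_existsUnique_adj.1 hw).unique hTu.symm hTv.symm)

/-- The maximum number of leaves of a spanning tree of `G₈` equals 5:
there is a spanning tree with 5 leaves, and every spanning tree has at most 5 leaves.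
In particular `G₈` has no spanning tree with at least `(2/5)·8 + 2 = 26/5` leaves. -/
theorem maxLeaves_G8 :
    ((∃ T ≤ G8, T.IsTree ∧ leafCount T = 5) ∧
      (∀ T ≤ G8, T.IsTree → leafCount T ≤ 5)) ∧
    ¬ ∃ T ≤ G8, T.IsTree ∧ (26 / 5 : ℚ) ≤ leafCount T := by
  refine ⟨⟨⟨fiveLeafTree, fiveLeafTree_le, fiveLeafTree_isTree, leafCount_fiveLeafTree⟩,
    fun T hTG hT => leafCount_le_five hTG hT⟩, ?_⟩
  rintro ⟨T, hTG, hT, hle⟩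
  have h : (leafCount T : ℚ) ≤ 5 := by exact_mod_cast leafCount_le_five hTG hT
  linarith
end
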